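/- Let (X_i)_{i∈ℤ} be a strictly stationary sequence of ℝ^d-valued random vectors whose marginal c.d.f.s F_1,…,F_d are continuous and whose strong mixing coefficients satisfy α_r = O(r^{-a}) for some a > 1, and suppose the copula C of X_0 satisfies Condition 2. Then sup_{(s,t,u)∈Δ×[0,1]^d} |C̄_n(s,t,u) − C̃_n(s,t,u)| converges to 0 in outer probability as n → ∞, where C̃_n(s,t,u) = B_n(s,t,u) − Σ_{j=1}^d Ċ_j(u)·B_n(s,t,u^{(j)}). -/

import Mathlib

open MeasureTheory Set Filter

noncomputable section

variable {Ω : Type*}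

/-- Rescaled maximal rank (pseudo-observation): the `j`-th component of
`Û_i^{k:l} = R_i^{k:l}/(l−k+1)`, computed within the subsample `X_k, …, X_l`. -/
def pseudoObs (d : ℕ) (X : ℤ → Ω → Fin d → ℝ) (k l i : ℕ) (ω : Ω) (j : Fin d) : ℝ :=
  (((Finset.Icc k l).filter fun t : ℕ => X t ω j ≤ X i ω j).card : ℝ) / ((l : ℝ) - (k : ℝ) + 1)

/-- Empirical copula of the subsample `X_k, …, X_l` (equal to `0` if `k > l`). -/
def empCop (d : ℕ) (X : ℤ → Ω → Fin d → ℝ) (k l : ℕ) (u : Fin d → ℝ) (ω : Ω) : ℝ :=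
  if k ≤ l then
    ((l : ℝ) - (k : ℝ) + 1)⁻¹ *
      ∑ i ∈ Finset.Icc k l, (if ∀ j, pseudoObs d X k l i ω j ≤ u j then (1 : ℝ) else 0)
  else 0

/-- Two-sided sequential empirical copula process
`C̄_n(s,t,u) = √n·λ_n(s,t)·(C_{⌊ns⌋+1:⌊nt⌋}(u) − C(u))`. -/
def seqEmpCopProc (d : ℕ) (X : ℤ → Ω → Fin d → ℝ) (C : (Fin d → ℝ) → ℝ)
    (n : ℕ) (s t : ℝ) (u : Fin d → ℝ) (ω : Ω) : ℝ :=
  Real.sqrt n * (((⌊(n : ℝ) * t⌋₊ : ℝ) - (⌊(n : ℝ) * s⌋₊ : ℝ)) / n) *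
    (empCop d X (⌊(n : ℝ) * s⌋₊ + 1) ⌊(n : ℝ) * t⌋₊ u ω - C u)

/-- The process `B_n(s,t,u) = n^{-1/2} Σ_{i=⌊ns⌋+1}^{⌊nt⌋} (1(U_i ≤ u) − C(u))`, where
`U_{ij} = F_j(X_{ij})`. -/
def seqEmpProc (d : ℕ) (X : ℤ → Ω → Fin d → ℝ) (F : Fin d → ℝ → ℝ)
    (C : (Fin d → ℝ) → ℝ) (n : ℕ) (s t : ℝ) (u : Fin d → ℝ) (ω : Ω) : ℝ :=
  (Real.sqrt n)⁻¹ *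
    ∑ i ∈ Finset.Icc (⌊(n : ℝ) * s⌋₊ + 1) ⌊(n : ℝ) * t⌋₊,
      ((if ∀ j, F j (X i ω j) ≤ u j then (1 : ℝ) else 0) - C u)

/-- `u^{(j)}`: the vector whose `j`-th coordinate is `u j` and whose others are `1`. -/
def coordVec (d : ℕ) (u : Fin d → ℝ) (j : Fin d) : Fin d → ℝ :=
  Function.update (fun _ => (1 : ℝ)) j (u j)

/-- `C̃_n(s,t,u) = B_n(s,t,u) − Σ_j Ċ_j(u)·B_n(s,t,u^{(j)})`. -/
def seqEmpCopProcApprox (d : ℕ) (X : ℤ → Ω → Fin d → ℝ) (F : Fin d → ℝ → ℝ)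
    (C : (Fin d → ℝ) → ℝ) (Cdot : Fin d → (Fin d → ℝ) → ℝ)
    (n : ℕ) (s t : ℝ) (u : Fin d → ℝ) (ω : Ω) : ℝ :=
  seqEmpProc d X F C n s t u ω
    - ∑ j, Cdot j u * seqEmpProc d X F C n s t (coordVec d u j) ω

theorem exists_abs_integral_mul_le {Ω : Type*} {m₁ mΩ : MeasurableSpace Ω}
    (P : Measure Ω) [IsProbabilityMeasure P] (h₁ : m₁ ≤ mΩ) {f h : Ω → ℝ} {a : ℝ}
    (hf : Measurable[m₁] f) (hfa : ∀ ω, |f ω| ≤ a) (hh : Integrable h P) (hh0 : ∫ ω, h ω ∂P = 0) :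
    ∃ A, MeasurableSet[m₁] A ∧ |∫ ω, f ω * h ω ∂P| ≤ 2 * a * |∫ ω in A, h ω ∂P| := by
  have hfS : StronglyMeasurable[m₁] f := hf.stronglyMeasurable
  have hfi : Integrable (f * h) P :=
    hh.bdd_mul (c := a) (hfS.mono h₁).aestronglyMeasurable (Eventually.of_forall hfa)
  set g : Ω → ℝ := P[h|m₁] with hg
  have hgS : StronglyMeasurable[m₁] g := stronglyMeasurable_condExp
  have hgi : Integrable g P := integrable_condExp
  set A : Set Ω := {ω | 0 ≤ g ω} with hA
  have hAm : MeasurableSet[m₁] A := measurableSet_le measurable_const hgS.measurable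
  refine ⟨A, hAm, ?_⟩
  have e1 : ∫ ω, f ω * h ω ∂P = ∫ ω, f ω * g ω ∂P := by
    have := condExp_mul_of_stronglyMeasurable_left (μ := P) hfS hfi hh
    calc ∫ ω, f ω * h ω ∂P = ∫ ω, (P[f * h|m₁]) ω ∂P := (integral_condExp h₁).symm
      _ = _ := integral_congr_ae this
  have e2 : |∫ ω, f ω * g ω ∂P| ≤ ∫ ω, a * |g ω| ∂P := by
    rw [← Real.norm_eq_abs]
    refine norm_integral_le_of_norm_le (hgi.abs.const_mul a) (Eventually.of_forall fun ω => ?_)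
    rw [Real.norm_eq_abs, abs_mul]
    exact mul_le_mul_of_nonneg_right (hfa ω) (abs_nonneg _)
  have hAm' := h₁ _ hAm
  have e3 : ∫ ω, |g ω| ∂P = 2 * ∫ ω in A, h ω ∂P := by
    rw [← integral_add_compl hAm' hgi.abs,
      setIntegral_congr_fun (g := g) hAm' (fun ω hω => abs_of_nonneg hω),
      setIntegral_congr_fun (g := fun ω => - g ω) hAm'.compl
        (fun ω hω => abs_of_neg (not_le.1 hω)), integral_neg,
      setIntegral_condExp h₁ hh hAm, setIntegral_condExp h₁ hh hAm.compl]
    have := integral_add_compl hAm' hh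
    linarith
  have ha : 0 ≤ a := by
    obtain ⟨ω⟩ := nonempty_of_isProbabilityMeasure P
    exact (abs_nonneg _).trans (hfa ω)
  rw [e1]
  refine e2.trans ?_
  rw [integral_const_mul, e3]
  nlinarith [mul_le_mul_of_nonneg_left (le_abs_self (∫ ω in A, h ω ∂P)) ha]

theorem abs_cov_le {Ω : Type*} {m₁ m₂ mΩ : MeasurableSpace Ω}
    (P : Measure Ω) [IsProbabilityMeasure P] (h₁ : m₁ ≤ mΩ) (h₂ : m₂ ≤ mΩ) {α : ℝ}
    (hα : ∀ A B, MeasurableSet[m₁] A → MeasurableSet[m₂] B →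
      |P.real (A ∩ B) - P.real A * P.real B| ≤ α)
    {f g : Ω → ℝ} {a b : ℝ} (hf : Measurable[m₁] f) (hg : Measurable[m₂] g)
    (hfa : ∀ ω, |f ω| ≤ a) (hgb : ∀ ω, |g ω| ≤ b) :
    |∫ ω, f ω * g ω ∂P - (∫ ω, f ω ∂P) * ∫ ω, g ω ∂P| ≤ 4 * α * a * b := by
  have hfi : Integrable f P := .of_bound (hf.mono h₁ le_rfl).aestronglyMeasurable a
    (Eventually.of_forall hfa)
  have hgi : Integrable g P := .of_bound (hg.mono h₂ le_rfl).aestronglyMeasurable b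
    (Eventually.of_forall hgb)
  have hfgi : Integrable (fun ω => f ω * g ω) P :=
    hgi.bdd_mul (c := a) (hf.mono h₁ le_rfl).aestronglyMeasurable (Eventually.of_forall hfa)
  obtain ⟨ω₀⟩ := nonempty_of_isProbabilityMeasure P
  have ha : 0 ≤ a := (abs_nonneg _).trans (hfa ω₀)
  have hb : 0 ≤ b := (abs_nonneg _).trans (hgb ω₀)
  obtain ⟨A, hA, hAle⟩ := exists_abs_integral_mul_le P h₁ (h := fun ω => g ω - ∫ ω, g ω ∂P) hf hfa
    (hgi.sub (integrable_const _)) (by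
      rw [integral_sub hgi (integrable_const _)]; simp)
  have hA' := h₁ _ hA
  have iA : Integrable (A.indicator (fun _ => (1 : ℝ))) P := (integrable_const _).indicator hA'
  obtain ⟨B, hB, hBle⟩ := exists_abs_integral_mul_le P h₂
    (h := fun ω => A.indicator (fun _ => (1 : ℝ)) ω - P.real A) hg hgb
    (iA.sub (integrable_const _)) (by
      rw [integral_sub iA (integrable_const _), integral_indicator hA']; simp)
  have hB' := h₂ _ hB
  have e1 : ∫ ω, f ω * (g ω - ∫ ω, g ω ∂P) ∂P
      = ∫ ω, f ω * g ω ∂P - (∫ ω, f ω ∂P) * ∫ ω, g ω ∂P := by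
    simp only [mul_sub]
    rw [integral_sub hfgi (hfi.mul_const _), integral_mul_const]
  have e2 : ∫ ω in A, (g ω - ∫ ω, g ω ∂P) ∂P
      = ∫ ω, g ω * (A.indicator (fun _ => (1 : ℝ)) ω - P.real A) ∂P := by
    simp only [mul_sub]
    have hgA : (fun ω => g ω * A.indicator (fun _ => (1 : ℝ)) ω) = A.indicator g := by
      ext ω; by_cases h : ω ∈ A <;> simp [h]
    rw [integral_sub (by rw [hgA]; exact hgi.indicator hA') (hgi.mul_const _), integral_mul_const,
      hgA, integral_indicator hA', integral_sub hgi.integrableOn (integrable_const _)]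
    simp [mul_comm]
  have e3 : ∫ ω in B, (A.indicator (fun _ => (1 : ℝ)) ω - P.real A) ∂P
      = P.real (A ∩ B) - P.real A * P.real B := by
    rw [integral_sub iA.integrableOn (integrable_const _), integral_indicator hA',
      Measure.restrict_restrict hA']
    simp [mul_comm]
  rw [e1, e2] at hAle
  rw [e3] at hBle
  calc _ ≤ _ := hAle
    _ ≤ 2 * a * (2 * b * α) := by
      refine mul_le_mul_of_nonneg_left (hBle.trans ?_) (by positivity)
      exact mul_le_mul_of_nonneg_left (hα A B hA hB) (by positivity)
    _ = _ := by ring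

theorem sum_cov_le {Ω ι : Type*} {m₁ m₂ mΩ : MeasurableSpace Ω}
    (P : Measure Ω) [IsProbabilityMeasure P] (h₁ : m₁ ≤ mΩ) (h₂ : m₂ ≤ mΩ) {α : ℝ}
    (hα : ∀ A B, MeasurableSet[m₁] A → MeasurableSet[m₂] B →
      |P.real (A ∩ B) - P.real A * P.real B| ≤ α)
    (s : Finset ι) {f g : ι → Ω → ℝ} {a b : ℝ} (hf : ∀ c, Measurable[m₁] (f c))
    (hg : ∀ c, Measurable[m₂] (g c))
    (hfa : ∀ ω, ∑ c ∈ s, |f c ω| ≤ a) (hgb : ∀ ω, ∑ c ∈ s, |g c ω| ≤ b) :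
    ∑ c ∈ s, (∫ ω, f c ω * g c ω ∂P - (∫ ω, f c ω ∂P) * ∫ ω, g c ω ∂P) ≤ 4 * α * a * b := by
  classical
  have key : ∀ t ⊆ s, ∃ F G : Ω → ℝ, Measurable[m₁] F ∧ Measurable[m₂] G ∧
      (∀ ω, |F ω| ≤ ∑ c ∈ t, |f c ω|) ∧ (∀ ω, |G ω| ≤ ∑ c ∈ t, |g c ω|) ∧
      ∑ c ∈ t, (∫ ω, f c ω * g c ω ∂P - (∫ ω, f c ω ∂P) * ∫ ω, g c ω ∂P)
        ≤ ∫ ω, F ω * G ω ∂P - (∫ ω, F ω ∂P) * ∫ ω, G ω ∂P := by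
    intro t
    induction t using Finset.induction_on with
    | empty => exact fun _ => ⟨fun _ => 0, fun _ => 0, measurable_const, measurable_const, by simp⟩
    | insert c t hc ih =>
      intro hts
      obtain ⟨F, G, hF, hG, hFb, hGb, hle⟩ := ih ((Finset.subset_insert c t).trans hts)
      have hcs : c ∈ s := hts (Finset.mem_insert_self c t)
      have hts' : t ⊆ s := (Finset.subset_insert c t).trans hts
      have bF : ∀ ω, ‖F ω‖ ≤ a := fun ω => (hFb ω).trans
        ((Finset.sum_le_sum_of_subset_of_nonneg hts' fun _ _ _ => abs_nonneg _).trans (hfa ω))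
      have bG : ∀ ω, ‖G ω‖ ≤ b := fun ω => (hGb ω).trans
        ((Finset.sum_le_sum_of_subset_of_nonneg hts' fun _ _ _ => abs_nonneg _).trans (hgb ω))
      have bf : ∀ ω, ‖f c ω‖ ≤ a := fun ω =>
        (Finset.single_le_sum (f := fun c => |f c ω|) (fun _ _ => abs_nonneg _) hcs).trans (hfa ω)
      have bg : ∀ ω, ‖g c ω‖ ≤ b := fun ω =>
        (Finset.single_le_sum (f := fun c => |g c ω|) (fun _ _ => abs_nonneg _) hcs).trans (hgb ω)
      have mF := (hF.mono h₁ le_rfl).aestronglyMeasurable (μ := P)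
      have mG := (hG.mono h₂ le_rfl).aestronglyMeasurable (μ := P)
      have mf := ((hf c).mono h₁ le_rfl).aestronglyMeasurable (μ := P)
      have mg := ((hg c).mono h₂ le_rfl).aestronglyMeasurable (μ := P)
      have iF : Integrable F P := .of_bound mF a (Eventually.of_forall bF)
      have iG : Integrable G P := .of_bound mG b (Eventually.of_forall bG)
      have jf : Integrable (f c) P := .of_bound mf a (Eventually.of_forall bf)
      have jg : Integrable (g c) P := .of_bound mg b (Eventually.of_forall bg)
      have iFG : Integrable (fun ω => F ω * G ω) P := iG.bdd_mul mF (Eventually.of_forall bF)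
      have iFg : Integrable (fun ω => F ω * g c ω) P := jg.bdd_mul mF (Eventually.of_forall bF)
      have ifG : Integrable (fun ω => f c ω * G ω) P := iG.bdd_mul mf (Eventually.of_forall bf)
      have ifg : Integrable (fun ω => f c ω * g c ω) P := jg.bdd_mul mf (Eventually.of_forall bf)
      have ep : ∫ ω, (F ω + f c ω) * (G ω + g c ω) ∂P = ∫ ω, F ω * G ω ∂P + ∫ ω, F ω * g c ω ∂P
          + ∫ ω, f c ω * G ω ∂P + ∫ ω, f c ω * g c ω ∂P := by
        have i2 : Integrable (fun ω => F ω * G ω + F ω * g c ω) P := iFG.add iFg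
        have i3 : Integrable (fun ω => F ω * G ω + F ω * g c ω + f c ω * G ω) P := i2.add ifG
        rw [← integral_add iFG iFg, ← integral_add i2 ifG, ← integral_add i3 ifg]
        congr 1; ext ω; ring
      have em : ∫ ω, (F ω - f c ω) * (G ω - g c ω) ∂P = ∫ ω, F ω * G ω ∂P - ∫ ω, F ω * g c ω ∂P
          - ∫ ω, f c ω * G ω ∂P + ∫ ω, f c ω * g c ω ∂P := by
        have i2 : Integrable (fun ω => F ω * G ω - F ω * g c ω) P := iFG.sub iFg
        have i3 : Integrable (fun ω => F ω * G ω - F ω * g c ω - f c ω * G ω) P := i2.sub ifG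
        rw [← integral_sub iFG iFg, ← integral_sub i2 ifG, ← integral_add i3 ifg]
        congr 1; ext ω; ring
      simp only [Finset.sum_insert hc]
      rcases le_total (0 : ℝ) (∫ ω, F ω * g c ω ∂P + ∫ ω, f c ω * G ω ∂P
        - (∫ ω, F ω ∂P) * ∫ ω, g c ω ∂P - (∫ ω, f c ω ∂P) * ∫ ω, G ω ∂P) with h0 | h0
      · refine ⟨fun ω => F ω + f c ω, fun ω => G ω + g c ω, hF.add (hf c), hG.add (hg c),
          fun ω => ?_, fun ω => ?_, ?_⟩
        · linarith [abs_add_le (F ω) (f c ω), hFb ω]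
        · linarith [abs_add_le (G ω) (g c ω), hGb ω]
        · rw [ep, integral_add iF jf, integral_add iG jg]
          nlinarith
      · refine ⟨fun ω => F ω - f c ω, fun ω => G ω - g c ω, hF.sub (hf c), hG.sub (hg c),
          fun ω => ?_, fun ω => ?_, ?_⟩
        · linarith [abs_sub (F ω) (f c ω), hFb ω]
        · linarith [abs_sub (G ω) (g c ω), hGb ω]
        · rw [em, integral_sub iF jf, integral_sub iG jg]
          nlinarith
  obtain ⟨F, G, hF, hG, hFb, hGb, hle⟩ := key s subset_rfl
  exact hle.trans ((le_abs_self _).trans (abs_cov_le P h₁ h₂ hα hF hG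
    (fun ω => (hFb ω).trans (hfa ω)) (fun ω => (hGb ω).trans (hgb ω))))

/-- The σ-algebra generated by `X i`, `i ≤ p`. -/
abbrev pastAlg {Ω E : Type*} [MeasurableSpace E] (X : ℤ → Ω → E) (p : ℤ) : MeasurableSpace Ω :=
  ⨆ i : {i : ℤ // i ≤ p}, MeasurableSpace.comap (X i.1) inferInstance

/-- The σ-algebra generated by `X i`, `p ≤ i`. -/
abbrev futureAlg {Ω E : Type*} [MeasurableSpace E] (X : ℤ → Ω → E) (p : ℤ) : MeasurableSpace Ω :=
  ⨆ i : {i : ℤ // p ≤ i}, MeasurableSpace.comap (X i.1) inferInstance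

/-- An identically distributed sequence with strong mixing coefficients at most `K * r ^ (-a)`. -/
structure IsMixing {Ω E : Type*} [MeasurableSpace Ω] [MeasurableSpace E] (P : Measure Ω)
    (X : ℤ → Ω → E) (K a : ℝ) : Prop where
  meas : ∀ i, Measurable (X i)
  law : ∀ i A, MeasurableSet A → P.real (X i ⁻¹' A) = P.real (X 0 ⁻¹' A)
  mix : ∀ r : ℕ, 1 ≤ r → ∀ p : ℤ, ∀ A B : Set Ω, MeasurableSet[pastAlg X p] A →
    MeasurableSet[futureAlg X (p + r)] B →
    |P.real (A ∩ B) - P.real A * P.real B| ≤ K * (r : ℝ) ^ (-a)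

/-- The centred number of visits of `X` to `A` during the time interval `[x, y)`. -/
def centeredCount {Ω E : Type*} [MeasurableSpace Ω] (P : Measure Ω)
    (X : ℤ → Ω → E) (A : Set E) (x y : ℕ) (ω : Ω) : ℝ :=
  ∑ i ∈ Finset.Ico x y, (A.indicator (fun _ => (1 : ℝ)) (X i ω) - P.real (X 0 ⁻¹' A))

theorem measurable_centeredCount {Ω E : Type*} {m mΩ : MeasurableSpace Ω} [MeasurableSpace E]
    (P : Measure Ω) {X : ℤ → Ω → E} {A : Set E} (hA : MeasurableSet A)
    {x y : ℕ} (hX : ∀ i : ℕ, x ≤ i → i < y → Measurable[m] (X i)) :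
    Measurable[m] (centeredCount P X A x y) := by
  unfold centeredCount
  refine Finset.measurable_fun_sum _ fun i hi => ?_
  rw [Finset.mem_Ico] at hi
  exact ((measurable_const.indicator hA).comp (hX i hi.1 hi.2)).sub_const _

theorem sum_sum_le_of_le_dist (c : ℕ → ℕ → ℝ) (h : ℕ → ℝ) (H : ℝ)
    (hH : ∀ s : Finset ℕ, ∑ r ∈ s, h r ≤ H) (x y : ℕ) (hxy : x ≤ y)
    (hc : ∀ i j, i ≤ j → c i j ≤ h (j - i)) (hsymm : ∀ i j, c i j = c j i) :
    ∑ i ∈ Finset.Ico x y, ∑ j ∈ Finset.Ico x y, c i j ≤ ((y : ℝ) - x) * (2 * H) := by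
  have key : ∀ i ∈ Finset.Ico x y, ∑ j ∈ Finset.Ico x y, c i j ≤ 2 * H := by
    intro i _
    rw [← Finset.sum_filter_add_sum_filter_not _ (fun j => i ≤ j)]
    have e1 : ∑ j ∈ Finset.Ico x y with i ≤ j, c i j ≤ H := by
      calc _ ≤ ∑ j ∈ Finset.Ico x y with i ≤ j, h (j - i) :=
            Finset.sum_le_sum fun j hj => hc i j (Finset.mem_filter.1 hj).2
        _ = ∑ r ∈ ((Finset.Ico x y).filter (i ≤ ·)).image (fun j => j - i), h r := by
            rw [Finset.sum_image]
            intro j hj k hk hjk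
            simp at hj hk hjk
            omega
        _ ≤ H := hH _
    have e2 : ∑ j ∈ Finset.Ico x y with ¬ i ≤ j, c i j ≤ H := by
      calc _ ≤ ∑ j ∈ Finset.Ico x y with ¬ i ≤ j, h (i - j) :=
            Finset.sum_le_sum fun j hj => by
              rw [hsymm]; exact hc j i (not_le.1 (Finset.mem_filter.1 hj).2).le
        _ = ∑ r ∈ ((Finset.Ico x y).filter (¬ i ≤ ·)).image (fun j => i - j), h r := by
            rw [Finset.sum_image]
            intro j hj k hk hjk
            simp at hj hk hjk
            omega
        _ ≤ H := hH _
    linarith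
  refine (Finset.sum_le_sum key).trans ?_
  simp [Nat.cast_sub hxy]

theorem measurable_pastAlg {Ω E : Type*} [MeasurableSpace E] {X : ℤ → Ω → E} {i p : ℤ}
    (h : i ≤ p) : Measurable[pastAlg X p] (X i) :=
  (comap_measurable (X i)).mono
    (le_iSup (fun i : {i : ℤ // i ≤ p} => MeasurableSpace.comap (X i.1) inferInstance) ⟨i, h⟩) le_rfl

theorem measurable_futureAlg {Ω E : Type*} [MeasurableSpace E] {X : ℤ → Ω → E} {i p : ℤ}
    (h : p ≤ i) : Measurable[futureAlg X p] (X i) :=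
  (comap_measurable (X i)).mono
    (le_iSup (fun i : {i : ℤ // p ≤ i} => MeasurableSpace.comap (X i.1) inferInstance) ⟨i, h⟩) le_rfl

theorem IsMixing.nonneg {Ω E : Type*} [MeasurableSpace Ω] [MeasurableSpace E]
    {P : Measure Ω} {X : ℤ → Ω → E} {K a : ℝ} (h : IsMixing P X K a) : 0 ≤ K := by
  simpa using h.mix 1 le_rfl 0 ∅ ∅ (@MeasurableSet.empty _ (pastAlg X 0))
    (@MeasurableSet.empty _ (futureAlg X _))

theorem abs_indicator_sub_le {Ω E : Type*} [MeasurableSpace Ω] {P : Measure Ω}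
    [IsProbabilityMeasure P] {X : ℤ → Ω → E} (A : Set E) (e : E) :
    |A.indicator (fun _ => (1 : ℝ)) e - P.real (X 0 ⁻¹' A)| ≤ 1 := by
  have h1 : P.real (X 0 ⁻¹' A) ≤ 1 := measureReal_le_one
  have h0 : 0 ≤ P.real (X 0 ⁻¹' A) := measureReal_nonneg
  rw [abs_le]
  by_cases h : e ∈ A <;> simp only [h, indicator_of_mem, indicator_of_notMem, not_false_eq_true] <;>
    constructor <;> linarith

theorem abs_centeredCount_le {Ω E : Type*} [MeasurableSpace Ω] {P : Measure Ω}
    [IsProbabilityMeasure P] {X : ℤ → Ω → E} (A : Set E) {x y : ℕ} (hxy : x ≤ y) (ω : Ω) :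
    |centeredCount P X A x y ω| ≤ (y : ℝ) - x := by
  refine (Finset.abs_sum_le_sum_abs _ _).trans ?_
  refine (Finset.sum_le_sum fun (i : ℕ) _ => abs_indicator_sub_le (P := P) (X := X) A (X i ω)).trans ?_
  simp [Nat.cast_sub hxy]

section
variable {Ω E : Type*} [MeasurableSpace Ω] [MeasurableSpace E] {P : Measure Ω}
  [IsProbabilityMeasure P] {X : ℤ → Ω → E} {K a : ℝ}

theorem pastAlg_le (hX : ∀ i, Measurable (X i)) (p : ℤ) : pastAlg X p ≤ ‹MeasurableSpace Ω› :=
  iSup_le fun i => (hX i).comap_le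

theorem futureAlg_le (hX : ∀ i, Measurable (X i)) (p : ℤ) : futureAlg X p ≤ ‹MeasurableSpace Ω› :=
  iSup_le fun i => (hX i).comap_le

theorem sum_measureReal_le_one (hX : Measurable (X 0)) {ι : Type*} (s : Finset ι) {A : ι → Set E}
    (hA : ∀ c, MeasurableSet (A c))
    (hdisj : ∀ e, ∑ c ∈ s, (A c).indicator (fun _ => (1 : ℝ)) e ≤ 1) :
    ∑ c ∈ s, P.real (X 0 ⁻¹' A c) ≤ 1 := by
  have e : ∀ c, P.real (X 0 ⁻¹' A c) = ∫ ω, (A c).indicator (fun _ => (1 : ℝ)) (X 0 ω) ∂P := by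
    intro c
    have : (fun ω => (A c).indicator (fun _ => (1 : ℝ)) (X 0 ω))
        = (X 0 ⁻¹' A c).indicator (fun _ => (1 : ℝ)) := rfl
    rw [this, integral_indicator (hX (hA c))]
    simp
  simp only [e]
  rw [← integral_finsetSum]
  · calc _ ≤ ∫ ω, (1 : ℝ) ∂P := by
          refine integral_mono_of_nonneg (Eventually.of_forall fun ω => ?_) (integrable_const _)
            (Eventually.of_forall fun ω => hdisj _)
          exact Finset.sum_nonneg fun c _ => indicator_nonneg (fun _ _ => zero_le_one) _
      _ = 1 := by simp
  · intro c _
    exact (integrable_const (1 : ℝ)).indicator (hX (hA c))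

theorem sum_abs_centeredCount_le (hX : Measurable (X 0)) {ι : Type*} (s : Finset ι) {A : ι → Set E}
    (hA : ∀ c, MeasurableSet (A c))
    (hdisj : ∀ e, ∑ c ∈ s, (A c).indicator (fun _ => (1 : ℝ)) e ≤ 1) {x y : ℕ} (hxy : x ≤ y)
    (ω : Ω) : ∑ c ∈ s, |centeredCount P X (A c) x y ω| ≤ 2 * ((y : ℝ) - x) := by
  have h1 : ∀ c ∈ s, |centeredCount P X (A c) x y ω| ≤ ∑ i ∈ Finset.Ico x y,
      ((A c).indicator (fun _ => (1 : ℝ)) (X i ω) + P.real (X 0 ⁻¹' A c)) := by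
    intro c _
    refine (Finset.abs_sum_le_sum_abs _ _).trans (Finset.sum_le_sum fun i _ => ?_)
    refine (abs_sub _ _).trans_eq ?_
    rw [abs_of_nonneg (indicator_nonneg (fun _ _ => zero_le_one) _), abs_of_nonneg measureReal_nonneg]
  refine (Finset.sum_le_sum h1).trans ?_
  rw [Finset.sum_comm]
  have h2 : ∀ i ∈ Finset.Ico x y, ∑ c ∈ s,
      ((A c).indicator (fun _ => (1 : ℝ)) (X i ω) + P.real (X 0 ⁻¹' A c)) ≤ 2 := by
    intro i _
    rw [Finset.sum_add_distrib]
    linarith [hdisj (X i ω), sum_measureReal_le_one (P := P) hX s hA hdisj]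
  refine (Finset.sum_le_sum h2).trans_eq ?_
  simp [Nat.cast_sub hxy]; ring

theorem integral_centeredCount_sq (h : IsMixing P X K a) {A : Set E} (hA : MeasurableSet A)
    (x y : ℕ) : ∫ ω, centeredCount P X A x y ω ^ 2 ∂P = ∑ i ∈ Finset.Ico x y, ∑ j ∈ Finset.Ico x y,
      (P.real (X i ⁻¹' A ∩ X j ⁻¹' A) - P.real (X 0 ⁻¹' A) ^ 2) := by
  set π := P.real (X 0 ⁻¹' A) with hπ
  have hm : ∀ i : ℤ, Measurable (fun ω => A.indicator (fun _ => (1 : ℝ)) (X i ω) - π) := fun i =>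
    ((measurable_const.indicator hA).comp (h.meas i)).sub_const _
  have hb : ∀ (i : ℤ) ω, ‖A.indicator (fun _ => (1 : ℝ)) (X i ω) - π‖ ≤ 1 := fun i ω =>
    abs_indicator_sub_le A _
  have hint : ∀ i : ℤ, Integrable (fun ω => A.indicator (fun _ => (1 : ℝ)) (X i ω)) P := fun i =>
    (integrable_const (1 : ℝ)).indicator (h.meas i hA)
  have hval : ∀ i : ℤ, ∫ ω, A.indicator (fun _ => (1 : ℝ)) (X i ω) ∂P = π := by
    intro i
    have : (fun ω => A.indicator (fun _ => (1 : ℝ)) (X i ω))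
        = (X i ⁻¹' A).indicator (fun _ => (1 : ℝ)) := rfl
    rw [this, integral_indicator (h.meas i hA)]
    simpa using h.law i A hA
  have hint2 : ∀ i j : ℤ, Integrable (fun ω => (A.indicator (fun _ => (1 : ℝ)) (X i ω) - π) *
      (A.indicator (fun _ => (1 : ℝ)) (X j ω) - π)) P := fun i j =>
    Integrable.bdd_mul (c := 1) ((hint j).sub (integrable_const _)) (hm i).aestronglyMeasurable
      (Eventually.of_forall (hb i))
  have hexp : ∀ ω, centeredCount P X A x y ω ^ 2 = ∑ i ∈ Finset.Ico x y, ∑ j ∈ Finset.Ico x y,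
      (A.indicator (fun _ => (1 : ℝ)) (X i ω) - π) * (A.indicator (fun _ => (1 : ℝ)) (X j ω) - π) := by
    intro ω
    rw [centeredCount, sq, Finset.sum_mul_sum]
  simp only [hexp]
  rw [integral_finsetSum]
  swap
  · exact fun i _ => integrable_finsetSum _ fun j _ => hint2 i j
  refine Finset.sum_congr rfl fun i _ => ?_
  rw [integral_finsetSum]
  swap
  · exact fun j _ => hint2 i j
  refine Finset.sum_congr rfl fun j _ => ?_
  have e : ∀ ω, (A.indicator (fun _ => (1 : ℝ)) (X i ω) - π) *
      (A.indicator (fun _ => (1 : ℝ)) (X j ω) - π)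
      = (X i ⁻¹' A ∩ X j ⁻¹' A).indicator (fun _ => (1 : ℝ)) ω
        - A.indicator (fun _ => (1 : ℝ)) (X i ω) * π
        - (A.indicator (fun _ => (1 : ℝ)) (X j ω) * π - π ^ 2) := by
    intro ω
    by_cases h1 : X i ω ∈ A <;> by_cases h2 : X j ω ∈ A <;> simp [h1, h2] <;> ring
  have hmi := (h.meas i hA).inter (h.meas j hA)
  simp only [e]
  rw [integral_sub, integral_sub, integral_sub, integral_mul_const, integral_mul_const,
    hval, hval, integral_indicator hmi]
  · simp; ring
  · exact (hint j).mul_const _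
  · exact integrable_const _
  · exact (integrable_const _).indicator hmi
  · exact (hint i).mul_const _
  · exact ((integrable_const _).indicator hmi).sub ((hint i).mul_const _)
  · exact ((hint j).mul_const _).sub (integrable_const _)

theorem sum_rpow_le_tsum {a K : ℝ} (ha : 1 < a) (hK : 0 ≤ K) (s : Finset ℕ) :
    ∑ r ∈ s, ((if r = 0 then 1 else 0) + K * (r : ℝ) ^ (-a))
      ≤ 1 + K * ∑' r : ℕ, (r : ℝ) ^ (-a) := by
  rw [Finset.sum_add_distrib, ← Finset.mul_sum]
  have h1 : ∑ r ∈ s, (if r = 0 then (1 : ℝ) else 0) ≤ 1 := by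
    rw [Finset.sum_ite_eq']; split_ifs <;> norm_num
  have h2 : ∑ r ∈ s, (r : ℝ) ^ (-a) ≤ ∑' r : ℕ, (r : ℝ) ^ (-a) :=
    (Real.summable_nat_rpow.2 (by linarith)).sum_le_tsum _ fun r _ => by positivity
  nlinarith [mul_le_mul_of_nonneg_left h2 hK]

/-- Variance bounds for a disjoint family of sets of probability at most `δ`. -/
theorem exists_variance_bound (a K : ℝ) (ha : 1 < a) : ∃ κ : ℝ, 0 < κ ∧ ∃ C : ℝ, 0 ≤ C ∧
    ∀ {Ω E ι : Type*} [MeasurableSpace Ω] [MeasurableSpace E] (P : Measure Ω)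
      [IsProbabilityMeasure P] (X : ℤ → Ω → E), IsMixing P X K a →
      ∀ (s : Finset ι) (A : ι → Set E) (δ : ℝ), (∀ c, MeasurableSet (A c)) →
      (∀ e, ∑ c ∈ s, (A c).indicator (fun _ => (1 : ℝ)) e ≤ 1) →
      (∀ c ∈ s, P.real (X 0 ⁻¹' A c) ≤ δ) → ∀ x y : ℕ, x ≤ y →
      (∀ c ∈ s, ∫ ω, centeredCount P X (A c) x y ω ^ 2 ∂P ≤ C * ((y : ℝ) - x) * δ ^ κ) ∧
      ∑ c ∈ s, ∫ ω, centeredCount P X (A c) x y ω ^ 2 ∂P ≤ C * ((y : ℝ) - x) := by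
  set θ : ℝ := (1 + 1 / a) / 2 with hθ
  have ha0 : 0 < a := by linarith
  have hainv : 1 / a < 1 := by rw [div_lt_one ha0]; exact ha
  have hainv0 : 0 < 1 / a := by positivity
  have hθ1 : θ < 1 := by rw [hθ]; linarith
  have hθ0 : 0 < θ := by positivity
  have haθ : 1 < a * θ := by
    rw [hθ]; field_simp; linarith
  rcases lt_or_ge K 0 with hK | hK
  · refine ⟨1, one_pos, 0, le_rfl, ?_⟩
    intro Ω E ι _ _ P _ X h
    exact absurd h.nonneg (not_le.2 hK)
  set H₁ : ℝ := 1 + K ^ θ * ∑' r : ℕ, (r : ℝ) ^ (-(a * θ)) with hH₁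
  set H₂ : ℝ := 1 + (4 * K) * ∑' r : ℕ, (r : ℝ) ^ (-a) with hH₂
  have t1 : 0 ≤ ∑' r : ℕ, (r : ℝ) ^ (-(a * θ)) := tsum_nonneg fun r => by positivity
  have t2 : 0 ≤ ∑' r : ℕ, (r : ℝ) ^ (-a) := tsum_nonneg fun r => by positivity
  have hH₁0 : 0 ≤ H₁ := by positivity
  have hH₂0 : 0 ≤ H₂ := by positivity
  refine ⟨1 - θ, by linarith, 2 * H₁ + 2 * H₂, by positivity, ?_⟩
  intro Ω E ι _ _ P _ X h s A δ hA hdisj hδ x y hxy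
  have hyx : (0 : ℝ) ≤ (y : ℝ) - x := by simpa using hxy
  have hmix : ∀ c i j, i < j → |P.real (X (i : ℕ) ⁻¹' A c ∩ X (j : ℕ) ⁻¹' A c)
      - P.real (X 0 ⁻¹' A c) ^ 2| ≤ K * ((j - i : ℕ) : ℝ) ^ (-a) := by
    intro c i j hij
    have := h.mix (j - i) (by omega) i _ _ (measurable_pastAlg (X := X) (le_refl (i : ℤ)) (hA c))
      (measurable_futureAlg (X := X) (i := (j : ℤ)) (by omega) (hA c))
    rwa [h.law i _ (hA c), h.law j _ (hA c), ← sq] at this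
  constructor
  · intro c hc
    have hπδ := hδ c hc
    set π := P.real (X 0 ⁻¹' A c) with hπ
    have hπ0 : 0 ≤ π := measureReal_nonneg
    have hδ0 : 0 ≤ δ := hπ0.trans hπδ
    rw [integral_centeredCount_sq h (hA c)]
    have hπ1 : π ≤ 1 := measureReal_le_one
    have main : ∀ i j : ℕ, i ≤ j → P.real (X i ⁻¹' A c ∩ X j ⁻¹' A c) - π ^ 2 ≤
        δ ^ (1 - θ) * ((if j - i = 0 then 1 else 0) + K ^ θ * ((j - i : ℕ) : ℝ) ^ (-(a * θ))) := by
      intro i j hij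
      have hle : P.real (X i ⁻¹' A c ∩ X j ⁻¹' A c) - π ^ 2 ≤ π := by
        have : P.real (X i ⁻¹' A c ∩ X j ⁻¹' A c) ≤ P.real (X i ⁻¹' A c) :=
          measureReal_mono inter_subset_left
        rw [h.law _ _ (hA c)] at this
        nlinarith
      rcases hij.eq_or_lt with rfl | hij
      · refine hle.trans ?_
        have h1 : π ≤ π ^ (1 - θ) := by
          have := Real.rpow_le_rpow_of_exponent_ge_of_imp hπ0 hπ1
            (show 1 - θ ≤ 1 by linarith) (fun _ => by intro h1; linarith)
          simpa using this
        have h2 : π ^ (1 - θ) ≤ δ ^ (1 - θ) := Real.rpow_le_rpow hπ0 hπδ (by linarith)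
        have h3 : (0 : ℝ) ^ (-(a * θ)) = 0 := Real.zero_rpow (by linarith)
        simp only [Nat.sub_self, if_true, Nat.cast_zero, h3]
        linarith
      · rw [if_neg (by omega), zero_add]
        have hr : (0 : ℝ) ≤ ((j - i : ℕ) : ℝ) := by positivity
        set z := P.real (X i ⁻¹' A c ∩ X j ⁻¹' A c) - π ^ 2 with hz
        rcases le_or_gt z 0 with hz0 | hz0
        · exact hz0.trans (by positivity)
        have hz2 : z ≤ K * ((j - i : ℕ) : ℝ) ^ (-a) := (le_abs_self z).trans (hmix c i j hij)
        calc z = z ^ (1 - θ) * z ^ θ := by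
              rw [← Real.rpow_add hz0]; simp
          _ ≤ δ ^ (1 - θ) * (K * ((j - i : ℕ) : ℝ) ^ (-a)) ^ θ := by
              refine mul_le_mul (Real.rpow_le_rpow hz0.le (hle.trans hπδ) (by linarith))
                (Real.rpow_le_rpow hz0.le hz2 hθ0.le) (by positivity) (by positivity)
          _ = _ := by
              rw [Real.mul_rpow hK (by positivity), ← Real.rpow_mul hr]
              ring_nf
    have := sum_sum_le_of_le_dist (fun i j => P.real (X i ⁻¹' A c ∩ X j ⁻¹' A c) - π ^ 2)
      (fun r => δ ^ (1 - θ) * ((if r = 0 then 1 else 0) + K ^ θ * (r : ℝ) ^ (-(a * θ))))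
      (δ ^ (1 - θ) * H₁) (fun t => by
        rw [← Finset.mul_sum]
        exact mul_le_mul_of_nonneg_left (sum_rpow_le_tsum haθ (by positivity) t) (by positivity))
      x y hxy main (fun i j => by rw [inter_comm])
    refine this.trans ?_
    have h3 : 0 ≤ ((y : ℝ) - x) * δ ^ (1 - θ) := by positivity
    nlinarith
  · simp only [integral_centeredCount_sq h (hA _)]
    rw [Finset.sum_comm]
    simp only [Finset.sum_comm (s := s)]
    have main : ∀ i j : ℕ, i ≤ j →
        ∑ c ∈ s, (P.real (X i ⁻¹' A c ∩ X j ⁻¹' A c) - P.real (X 0 ⁻¹' A c) ^ 2) ≤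
        (if j - i = 0 then 1 else 0) + 4 * K * ((j - i : ℕ) : ℝ) ^ (-a) := by
      intro i j hij
      rcases hij.eq_or_lt with rfl | hij
      · have h3 : (0 : ℝ) ^ (-a) = 0 := Real.zero_rpow (by linarith)
        simp only [Nat.sub_self, if_true, Nat.cast_zero, h3, inter_self, h.law _ _ (hA _)]
        have := sum_measureReal_le_one (P := P) (h.meas 0) s hA hdisj
        refine (Finset.sum_le_sum (g := fun c => P.real (X 0 ⁻¹' A c)) fun c _ => ?_).trans
          (by linarith)
        nlinarith [sq_nonneg (P.real (X 0 ⁻¹' A c))]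
      · rw [if_neg (by omega), zero_add]
        have hsum : ∀ (i : ℤ) ω, ∑ c ∈ s, |(A c).indicator (fun _ => (1 : ℝ)) (X i ω)| ≤ 1 := by
          intro i ω
          refine le_trans (Finset.sum_le_sum fun c _ => ?_) (hdisj (X i ω))
          rw [abs_of_nonneg (indicator_nonneg (fun _ _ => zero_le_one) _)]
        have hval : ∀ B : Set Ω, MeasurableSet B → ∫ ω, B.indicator (fun _ => (1 : ℝ)) ω ∂P
            = P.real B := by
          intro B hB
          rw [integral_indicator hB]; simp
        have := sum_cov_le P (pastAlg_le h.meas i) (futureAlg_le h.meas (i + (j - i : ℕ)))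
          (h.mix (j - i) (by omega) i) s
          (f := fun c ω => (A c).indicator (fun _ => (1 : ℝ)) (X i ω))
          (g := fun c ω => (A c).indicator (fun _ => (1 : ℝ)) (X j ω))
          (fun c => (measurable_const.indicator (hA c)).comp (measurable_pastAlg le_rfl))
          (fun c => (measurable_const.indicator (hA c)).comp (measurable_futureAlg (by omega)))
          (hsum i) (hsum j)
        refine le_trans (le_of_eq (Finset.sum_congr rfl fun c _ => ?_)) (this.trans_eq (by ring))
        have e1 := hval _ (h.meas i (hA c))
        have e2 := hval _ (h.meas j (hA c))
        have e3 := hval _ ((h.meas i (hA c)).inter (h.meas j (hA c)))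
        rw [h.law i _ (hA c)] at e1
        rw [h.law j _ (hA c)] at e2
        have e4 : ∀ ω, (A c).indicator (fun _ => (1 : ℝ)) (X i ω)
            * (A c).indicator (fun _ => (1 : ℝ)) (X j ω)
            = (X i ⁻¹' A c ∩ X j ⁻¹' A c).indicator (fun _ => (1 : ℝ)) ω := by
          intro ω
          by_cases h1 : X i ω ∈ A c <;> by_cases h2 : X j ω ∈ A c <;> simp [h1, h2]
        simp only [e4, e3]
        rw [sq, ← e1]
        nth_rewrite 2 [e1]
        rw [← e2]
        rfl
    have := sum_sum_le_of_le_dist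
      (fun i j => ∑ c ∈ s, (P.real (X i ⁻¹' A c ∩ X j ⁻¹' A c) - P.real (X 0 ⁻¹' A c) ^ 2))
      (fun r => ((if r = 0 then 1 else 0) + 4 * K * (r : ℝ) ^ (-a)))
      H₂ (sum_rpow_le_tsum ha (by positivity))
      x y hxy main (fun i j => by simp only [inter_comm])
    refine this.trans ?_
    nlinarith
end

theorem add_rpow_le_of_pos {u v p τ : ℝ} (hu : 0 ≤ u) (hv : 0 ≤ v) (hp : 0 ≤ p) (hτ : 0 < τ) :
    (u + v) ^ p ≤ (1 + τ) ^ p * u ^ p + (1 + 1 / τ) ^ p * v ^ p := by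
  rcases le_total v (τ * u) with h | h
  · have : (u + v) ^ p ≤ ((1 + τ) * u) ^ p := Real.rpow_le_rpow (by positivity) (by linarith) hp
    rw [Real.mul_rpow (by positivity) hu] at this
    have h2 : 0 ≤ (1 + 1 / τ) ^ p * v ^ p := by positivity
    linarith
  · have h' : u ≤ 1 / τ * v := by
      rw [one_div, ← div_eq_inv_mul, le_div_iff₀ hτ]; linarith
    have : (u + v) ^ p ≤ ((1 + 1 / τ) * v) ^ p := Real.rpow_le_rpow (by positivity) (by linarith) hp
    rw [Real.mul_rpow (by positivity) hv] at this
    have h2 : 0 ≤ (1 + τ) ^ p * u ^ p := by positivity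
    linarith

theorem add_rpow_le_of_le {u v p : ℝ} (hv : 0 ≤ v) (huv : v ≤ u) (hp : 1 ≤ p) :
    (u + v) ^ p ≤ u ^ p + p * 2 ^ (p - 1) * (u ^ (p - 1) * v) := by
  have hu : 0 ≤ u := hv.trans huv
  rcases hu.eq_or_lt with h0 | hu0
  · have hv0 : v = 0 := by linarith
    subst hv0
    simp
  have hs : 0 < u + v := by linarith
  have hb := one_add_mul_self_le_rpow_one_add (s := -(v / (u + v))) (p := p)
    (by rw [neg_le_neg_iff, div_le_one hs]; linarith) hp
  have e1 : 1 + -(v / (u + v)) = u / (u + v) := by field_simp; ring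
  rw [e1, Real.div_rpow hu hs.le] at hb
  have hsp : 0 < (u + v) ^ p := by positivity
  have e2 : (u + v) ^ p = (u + v) ^ (p - 1) * (u + v) := by
    rw [← Real.rpow_add_one hs.ne']; ring_nf
  rw [le_div_iff₀ hsp] at hb
  have e3 : (1 + p * -(v / (u + v))) * (u + v) ^ p = (u + v) ^ p - p * (u + v) ^ (p - 1) * v := by
    rw [add_mul, one_mul]
    nth_rewrite 2 [e2]
    field_simp
    ring
  rw [e3] at hb
  have h2 : (u + v) ^ (p - 1) ≤ 2 ^ (p - 1) * u ^ (p - 1) := by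
    rw [← Real.mul_rpow (by norm_num) hu]
    exact Real.rpow_le_rpow hs.le (by linarith) (by linarith)
  have h3 : p * (u + v) ^ (p - 1) * v ≤ p * (2 ^ (p - 1) * u ^ (p - 1)) * v := by gcongr
  linarith

theorem add_rpow_le_cross {u v p : ℝ} (hu : 0 ≤ u) (hv : 0 ≤ v) (hp : 1 ≤ p) :
    (u + v) ^ p ≤ u ^ p + v ^ p +
      p * 2 ^ (p - 1) * (u ^ (p - 1) * v ^ (1 : ℝ) + u ^ (1 : ℝ) * v ^ (p - 1)) := by
  have h1 : 0 ≤ p * 2 ^ (p - 1) * (u ^ (p - 1) * v) := by positivity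
  have h2 : 0 ≤ p * 2 ^ (p - 1) * (u * v ^ (p - 1)) := by positivity
  have h3 : 0 ≤ u ^ p := by positivity
  have h4 : 0 ≤ v ^ p := by positivity
  simp only [Real.rpow_one]
  rcases le_total v u with h | h
  · have := add_rpow_le_of_le hv h hp
    nlinarith
  · have := add_rpow_le_of_le hu h hp
    rw [add_comm v u, mul_comm (v ^ (p - 1))] at this
    nlinarith

theorem sum_rpow_le_rpow_sum {ι : Type*} (s : Finset ι) (f : ι → ℝ) (hf : ∀ c, 0 ≤ f c) {r : ℝ}
    (hr : 1 ≤ r) : ∑ c ∈ s, f c ^ r ≤ (∑ c ∈ s, f c) ^ r := by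
  classical
  induction s using Finset.induction_on with
  | empty => simp [Real.zero_rpow (by linarith : r ≠ 0)]
  | insert c s hc ih =>
    rw [Finset.sum_insert hc, Finset.sum_insert hc]
    have := Real.add_rpow_le_rpow_add (hf c) (Finset.sum_nonneg fun c (_ : c ∈ s) => hf c) hr
    linarith

theorem integral_abs_rpow_le {Ω : Type*} [MeasurableSpace Ω] (P : Measure Ω)
    [IsProbabilityMeasure P] {S : Ω → ℝ} (hS : Measurable S) {M : ℝ} (hM : ∀ ω, |S ω| ≤ M) {r : ℝ}
    (hr0 : 0 ≤ r) (hr2 : r ≤ 2) :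
    ∫ ω, |S ω| ^ r ∂P ≤ (∫ ω, S ω ^ 2 ∂P) ^ (r / 2) := by
  have e : ∀ ω, |S ω| ^ r = (S ω ^ 2) ^ (r / 2) := by
    intro ω
    rw [← sq_abs, ← Real.rpow_natCast, ← Real.rpow_mul (abs_nonneg _)]
    congr 1; push_cast; ring
  simp only [e]
  have hc := Real.concaveOn_rpow (p := r / 2) (by linarith) (by linarith)
  refine hc.le_map_integral (continuousOn_id.rpow_const fun _ _ => ?_) isClosed_Ici
    (Eventually.of_forall fun ω => mem_Ici.2 (sq_nonneg (S ω))) ?_ ?_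
  · right; linarith
  · refine .of_bound (hS.pow_const 2).aestronglyMeasurable (M ^ 2) (Eventually.of_forall fun ω => ?_)
    rw [Real.norm_eq_abs, abs_pow]
    exact pow_le_pow_left₀ (abs_nonneg _) (hM ω) 2
  · refine .of_bound ((hS.pow_const 2).pow_const _).aestronglyMeasurable (M ^ r)
      (Eventually.of_forall fun ω => ?_)
    simp only [Function.comp]
    rw [← e, Real.norm_eq_abs, abs_of_nonneg (by positivity)]
    exact Real.rpow_le_rpow (abs_nonneg _) (hM ω) hr0

theorem integrable_abs_rpow {Ω : Type*} [MeasurableSpace Ω] (P : Measure Ω)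
    [IsProbabilityMeasure P] {S : Ω → ℝ} (hS : Measurable S) {M : ℝ} (hM : ∀ ω, |S ω| ≤ M) {r : ℝ}
    (hr : 0 ≤ r) : Integrable (fun ω => |S ω| ^ r) P := by
  refine .of_bound (hS.abs.pow_const _).aestronglyMeasurable (M ^ r)
    (Eventually.of_forall fun ω => ?_)
  rw [Real.norm_eq_abs, abs_of_nonneg (by positivity)]
  exact Real.rpow_le_rpow (abs_nonneg _) (hM ω) hr

theorem integrable_abs_rpow_mul {Ω : Type*} [MeasurableSpace Ω] (P : Measure Ω)
    [IsProbabilityMeasure P] {S T : Ω → ℝ} (hS : Measurable S) {M N : ℝ} (hM : ∀ ω, |S ω| ≤ M)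
    (hT : Measurable T) (hN : ∀ ω, |T ω| ≤ N) {r t : ℝ} (hr : 0 ≤ r) (ht : 0 ≤ t) :
    Integrable (fun ω => |S ω| ^ r * |T ω| ^ t) P := by
  refine (integrable_abs_rpow P hT hN ht).bdd_mul (c := M ^ r)
    (hS.abs.pow_const _).aestronglyMeasurable (Eventually.of_forall fun ω => ?_)
  rw [Real.norm_eq_abs, abs_of_nonneg (by positivity)]
  exact Real.rpow_le_rpow (abs_nonneg _) (hM ω) hr

theorem sum_cross_moment_le {Ω E ι : Type*} [MeasurableSpace Ω] [MeasurableSpace E] {P : Measure Ω}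
    [IsProbabilityMeasure P] {X : ℤ → Ω → E} {K a : ℝ} (h : IsMixing P X K a)
    (s : Finset ι) {A : ι → Set E} (hA : ∀ c, MeasurableSet (A c))
    (hdisj : ∀ e, ∑ c ∈ s, (A c).indicator (fun _ => (1 : ℝ)) e ≤ 1) {x y z w q : ℕ}
    (hxy : x ≤ y) (hz : z = y + q) (hq : 1 ≤ q) (hzw : z ≤ w) {n v V : ℝ}
    (hv0 : 0 ≤ v) (hn1 : (y : ℝ) - x ≤ n) (hn2 : (w : ℝ) - z ≤ n)
    (hv1 : ∀ c ∈ s, ∫ ω, centeredCount P X (A c) x y ω ^ 2 ∂P ≤ v)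
    (hv2 : ∀ c ∈ s, ∫ ω, centeredCount P X (A c) z w ω ^ 2 ∂P ≤ v)
    (hV1 : ∑ c ∈ s, ∫ ω, centeredCount P X (A c) x y ω ^ 2 ∂P ≤ V)
    (hV2 : ∑ c ∈ s, ∫ ω, centeredCount P X (A c) z w ω ^ 2 ∂P ≤ V)
    {r t : ℝ} (hr1 : 1 ≤ r) (hr2 : r ≤ 2) (ht1 : 1 ≤ t) (ht2 : t ≤ 2) :
    ∑ c ∈ s, ∫ ω, |centeredCount P X (A c) x y ω| ^ r * |centeredCount P X (A c) z w ω| ^ t ∂P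
      ≤ (2 * v) ^ ((r + t) / 2 - 1) * (2 * V)
        + 4 * (K * (q : ℝ) ^ (-a)) * (2 * n) ^ r * (2 * n) ^ t := by
  have hxy' : (0 : ℝ) ≤ (y : ℝ) - x := by simpa using hxy
  have hzw' : (0 : ℝ) ≤ (w : ℝ) - z := by simpa using hzw
  have hm1 : ∀ c, Measurable[pastAlg X y] (centeredCount P X (A c) x y) := fun c =>
    measurable_centeredCount P (hA c) fun i _ hi => measurable_pastAlg (by omega)
  have hm2 : ∀ c, Measurable[futureAlg X (y + q)] (centeredCount P X (A c) z w) := fun c =>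
    measurable_centeredCount P (hA c) fun i hi _ => measurable_futureAlg (by omega)
  have hM1 : ∀ c, Measurable (centeredCount P X (A c) x y) := fun c =>
    (hm1 c).mono (pastAlg_le h.meas _) le_rfl
  have hM2 : ∀ c, Measurable (centeredCount P X (A c) z w) := fun c =>
    (hm2 c).mono (futureAlg_le h.meas _) le_rfl
  have habs : ∀ {x y : ℕ}, x ≤ y → (y : ℝ) - x ≤ n → ∀ {r : ℝ}, 1 ≤ r → ∀ ω,
      ∑ c ∈ s, |(|centeredCount P X (A c) x y ω| ^ r)| ≤ (2 * n) ^ r := by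
    intro x y hxy hn r hr ω
    have : ∀ c, |(|centeredCount P X (A c) x y ω| ^ r)| = |centeredCount P X (A c) x y ω| ^ r :=
      fun c => abs_of_nonneg (by positivity)
    simp only [this]
    refine (sum_rpow_le_rpow_sum s _ (fun c => abs_nonneg _) hr).trans ?_
    refine Real.rpow_le_rpow (Finset.sum_nonneg fun c _ => abs_nonneg _) ?_ (by linarith)
    exact (sum_abs_centeredCount_le (h.meas 0) s hA hdisj hxy ω).trans (by linarith)
  have hcov := sum_cov_le P (pastAlg_le h.meas y) (futureAlg_le h.meas (y + q)) (h.mix q hq y) s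
    (f := fun c ω => |centeredCount P X (A c) x y ω| ^ r)
    (g := fun c ω => |centeredCount P X (A c) z w ω| ^ t)
    (fun c => (measurable_norm.comp (hm1 c)).pow_const _)
    (fun c => (measurable_norm.comp (hm2 c)).pow_const _)
    (habs hxy hn1 hr1) (habs hzw hn2 ht1)
  rw [Finset.sum_sub_distrib] at hcov
  have hprod : ∑ c ∈ s, (∫ ω, |centeredCount P X (A c) x y ω| ^ r ∂P)
      * ∫ ω, |centeredCount P X (A c) z w ω| ^ t ∂P ≤ (2 * v) ^ ((r + t) / 2 - 1) * (2 * V) := by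
    set v1 : ι → ℝ := fun c => ∫ ω, centeredCount P X (A c) x y ω ^ 2 ∂P with hv1d
    set v2 : ι → ℝ := fun c => ∫ ω, centeredCount P X (A c) z w ω ^ 2 ∂P with hv2d
    have p1 : ∀ c, 0 ≤ v1 c := fun c => integral_nonneg fun ω => sq_nonneg _
    have p2 : ∀ c, 0 ≤ v2 c := fun c => integral_nonneg fun ω => sq_nonneg _
    have hterm : ∀ c ∈ s, (∫ ω, |centeredCount P X (A c) x y ω| ^ r ∂P)
        * ∫ ω, |centeredCount P X (A c) z w ω| ^ t ∂P
        ≤ (2 * v) ^ ((r + t) / 2 - 1) * (v1 c + v2 c) := by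
      intro c hc
      have i1 := integral_abs_rpow_le P (hM1 c) (abs_centeredCount_le (P := P) (X := X) (A c) hxy)
        (by linarith) hr2
      have i2 := integral_abs_rpow_le P (hM2 c) (abs_centeredCount_le (P := P) (X := X) (A c) hzw)
        (by linarith) ht2
      have q1 := p1 c
      have q2 := p2 c
      have hW : v1 c + v2 c ≤ 2 * v := by linarith [hv1 c hc, hv2 c hc]
      calc _ ≤ (v1 c + v2 c) ^ (r / 2) * (v1 c + v2 c) ^ (t / 2) := by
            refine mul_le_mul (i1.trans ?_) (i2.trans ?_)
              (integral_nonneg fun ω => by positivity) (by positivity)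
            · exact Real.rpow_le_rpow q1 (by linarith) (by linarith)
            · exact Real.rpow_le_rpow q2 (by linarith) (by linarith)
        _ = (v1 c + v2 c) ^ ((r + t) / 2 - 1) * (v1 c + v2 c) := by
            rw [← Real.rpow_add_of_nonneg (by positivity) (by linarith) (by linarith)]
            nth_rewrite 3 [← Real.rpow_one (v1 c + v2 c)]
            rw [← Real.rpow_add_of_nonneg (by positivity) (by linarith) (by linarith)]
            congr 1; ring
        _ ≤ _ := by
            refine mul_le_mul_of_nonneg_right ?_ (by positivity)
            exact Real.rpow_le_rpow (by positivity) hW (by linarith)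
    refine (Finset.sum_le_sum hterm).trans ?_
    rw [← Finset.mul_sum, Finset.sum_add_distrib]
    exact mul_le_mul_of_nonneg_left (by linarith) (by positivity)
  linarith

theorem growth_le {p β G κ m n : ℝ} (hβ : 0 ≤ β) (hβp : β ≤ p / 2) (hG : 0 ≤ G) (hκ : 0 < κ)
    (hκ1 : κ ≤ 1) (hm : 0 ≤ m) (hn : 0 ≤ n) (hmn : m ≤ κ * n) :
    m ^ (p / 2) * G + m ^ β ≤ κ ^ β * (n ^ (p / 2) * G + n ^ β) := by
  have h1 : m ^ (p / 2) ≤ κ ^ β * n ^ (p / 2) := by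
    refine (Real.rpow_le_rpow hm hmn (by linarith)).trans ?_
    rw [Real.mul_rpow hκ.le hn]
    exact mul_le_mul_of_nonneg_right (Real.rpow_le_rpow_of_exponent_ge hκ hκ1 hβp) (by positivity)
  have h2 : m ^ β ≤ κ ^ β * n ^ β := by
    rw [← Real.mul_rpow hκ.le hn]
    exact Real.rpow_le_rpow hm hmn hβ
  have h3 := mul_le_mul_of_nonneg_right h1 hG
  linarith

set_option maxHeartbeats 1000000 in
theorem exists_recursion_bound (p β a L : ℝ) (hp : 2 < p) (hβ : 1 < β) (hβp : β ≤ p / 2)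
    (ha : 0 ≤ a) (haβ : p - a ≤ β) (hL : 0 ≤ L) : ∃ D : ℝ, 0 ≤ D ∧ ∀ (Φ : ℕ → ℕ → ℝ) (G : ℝ),
    0 ≤ G → (∀ x n : ℕ, Φ x (x + n) ≤ (2 * (n : ℝ)) ^ p) →
    (∀ τ : ℝ, 0 < τ → ∀ x m q m' : ℕ, 1 ≤ q → Φ x (x + m + q + m') ≤
      (1 + τ) ^ p * (Φ x (x + m) + Φ (x + m + q) (x + m + q + m') +
        L * (((m + q + m' : ℕ) : ℝ) ^ (p / 2) * G + (q : ℝ) ^ (-a) * ((m + q + m' : ℕ) : ℝ) ^ p)) +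
      (1 + 1 / τ) ^ p * Φ (x + m) (x + m + q)) →
    ∀ n x : ℕ, Φ x (x + n) ≤ D * ((n : ℝ) ^ (p / 2) * G + (n : ℝ) ^ β) := by
  have hp0 : 0 < p := by linarith
  set τ : ℝ := 2 ^ ((β - 1) / (2 * p)) - 1 with hτ
  have hτ0 : 0 < τ := by
    have : (1 : ℝ) < 2 ^ ((β - 1) / (2 * p)) :=
      Real.one_lt_rpow (by norm_num) (div_pos (by linarith) (by linarith))
    linarith
  set ρ : ℝ := (1 + τ) ^ p * (2 * (1 / 2) ^ β) with hρ
  have hρ1 : ρ < 1 := by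
    have e1 : (1 + τ) ^ p = 2 ^ ((β - 1) / 2) := by
      rw [hτ, add_sub_cancel, ← Real.rpow_mul (by norm_num)]
      congr 1; field_simp
    have e2 : (2 : ℝ) * (1 / 2) ^ β = 2 ^ (1 - β) := by
      rw [Real.rpow_sub (by norm_num), Real.rpow_one, one_div, Real.inv_rpow (by norm_num)]
      rfl
    rw [hρ, e1, e2, ← Real.rpow_add (by norm_num)]
    exact Real.rpow_lt_one_of_one_lt_of_neg (by norm_num) (by linarith)
  have hρ0 : 0 < ρ := by positivity
  set T : ℝ := (1 + 1 / τ) ^ p with hT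
  have hT0 : 0 < T := by positivity
  obtain ⟨N, hN⟩ := exists_nat_ge (max 1 (2 * T / (1 - ρ)))
  have hN1 : (1 : ℝ) ≤ N := (le_max_left _ _).trans hN
  have hN1' : 1 ≤ N := by exact_mod_cast hN1
  have hN2 : T * (1 / N) ^ β ≤ (1 - ρ) / 2 := by
    have h1 : ((1 : ℝ) / N) ^ β ≤ 1 / N := by
      have := Real.rpow_le_rpow_of_exponent_ge (x := (1 : ℝ) / N) (by positivity)
        (by rw [div_le_one (by positivity)]; exact hN1) hβ.le
      simpa using this
    have h2 : 2 * T / (1 - ρ) ≤ N := (le_max_right _ _).trans hN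
    rw [div_le_iff₀ (by linarith)] at h2
    calc T * (1 / N) ^ β ≤ T * (1 / N) := by gcongr
      _ ≤ _ := by rw [mul_one_div, div_le_iff₀ (by positivity)]; linarith
  set E : ℝ := (1 + τ) ^ p * (L * (2 * (N : ℝ)) ^ a) with hE
  have hE0 : 0 ≤ E := by positivity
  have h1ρ : 0 < 1 - ρ := by linarith
  refine ⟨(2 * (N : ℝ)) ^ p + 2 * E / (1 - ρ), by positivity, ?_⟩
  set D : ℝ := (2 * (N : ℝ)) ^ p + 2 * E / (1 - ρ) with hD
  have hD0 : 0 ≤ D := by positivity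
  have hDN : (2 * (N : ℝ)) ^ p ≤ D := by
    have : 0 ≤ 2 * E / (1 - ρ) := by positivity
    linarith
  have hDE : E ≤ D * ((1 - ρ) / 2) := by
    have : 2 * E / (1 - ρ) ≤ D := by
      have : 0 ≤ (2 * (N : ℝ)) ^ p := by positivity
      linarith
    rw [div_le_iff₀ h1ρ] at this
    linarith
  intro Φ G hG hΦ hrec n
  induction n using Nat.strong_induction_on with
  | _ n ih =>
  intro x
  have hg : ∀ n : ℕ, 0 ≤ (n : ℝ) ^ (p / 2) * G + (n : ℝ) ^ β := fun n => by positivity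
  rcases lt_or_ge n N with hnN | hnN
  · refine (hΦ x n).trans ?_
    rcases Nat.eq_zero_or_pos n with rfl | hn
    · rw [Nat.cast_zero, mul_zero, Real.zero_rpow hp0.ne']
      have := hg 0
      rw [Nat.cast_zero] at this
      positivity
    · have hn1 : (1 : ℝ) ≤ n := by exact_mod_cast hn
      have h1 : (2 * (n : ℝ)) ^ p ≤ (2 * (N : ℝ)) ^ p := by
        have : (n : ℝ) ≤ N := by exact_mod_cast hnN.le
        gcongr
      have h2 : (1 : ℝ) ≤ (n : ℝ) ^ β := Real.one_le_rpow hn1 (by linarith)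
      have h3 : 0 ≤ (n : ℝ) ^ (p / 2) * G := by positivity
      exact h1.trans (hDN.trans (le_mul_of_one_le_right hD0 (by linarith)))
  · obtain ⟨q, hq⟩ : ∃ q, q = n / N := ⟨_, rfl⟩
    have hq1 : 1 ≤ q := hq ▸ (Nat.one_le_div_iff hN1').2 hnN
    have hqN : q * N ≤ n := hq ▸ Nat.div_mul_le_self n N
    have hqn : n < (q + 1) * N := by
      rw [hq, mul_comm]; exact Nat.lt_mul_div_succ n hN1'
    have hqle : q ≤ n := (Nat.le_mul_of_pos_right q hN1').trans hqN
    obtain ⟨m, hm⟩ : ∃ m, m = (n - q) / 2 := ⟨_, rfl⟩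
    obtain ⟨m', hm'⟩ : ∃ m', m' = n - q - m := ⟨_, rfl⟩
    have hsum : m + q + m' = n := by omega
    have hm2 : 2 * m ≤ n := by omega
    have hm2' : 2 * m' ≤ n := by omega
    have hn0 : 0 < n := by omega
    have hn1 : (1 : ℝ) ≤ n := by exact_mod_cast hn0
    have R := hrec τ hτ0 x m q m' hq1
    have e : x + m + q + m' = x + n := by omega
    have i1 := ih m (by omega) x
    have i2 := ih m' (by omega) (x + m + q)
    have b1 := growth_le (p := p) (β := β) (G := G) (κ := 1 / 2) (m := m) (n := n) (by linarith)
      hβp hG (by norm_num) (by norm_num) (by positivity) (by positivity)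
      (by have : (2 * m : ℝ) ≤ n := by exact_mod_cast hm2
          linarith)
    have b2 := growth_le (p := p) (β := β) (G := G) (κ := 1 / 2) (m := m') (n := n) (by linarith)
      hβp hG (by norm_num) (by norm_num) (by positivity) (by positivity)
      (by have : (2 * m' : ℝ) ≤ n := by exact_mod_cast hm2'
          linarith)
    have hqN' : (q : ℝ) * N ≤ n := by exact_mod_cast hqN
    have b3 := growth_le (p := p) (β := β) (G := G) (κ := 1 / N) (m := q) (n := n) (by linarith)
      hβp hG (by positivity) (by rw [div_le_one (by positivity)]; exact hN1) (by positivity)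
      (by positivity)
      (by rw [div_mul_eq_mul_div, one_mul, le_div_iff₀ (by positivity)]; exact hqN')
    have b4 : (q : ℝ) ^ (-a) * (n : ℝ) ^ p ≤ (2 * (N : ℝ)) ^ a * (n : ℝ) ^ β := by
      have hq1' : (1 : ℝ) ≤ q := by exact_mod_cast hq1
      have hqn' : (n : ℝ) ≤ (q + 1) * N := by exact_mod_cast hqn.le
      have hqn2 : (n : ℝ) ≤ (2 * N) * q := by
        refine hqn'.trans ?_
        have : ((q : ℝ) + 1) * N ≤ (q + q) * N := by gcongr
        linarith
      have h1 : (n : ℝ) ^ a ≤ (2 * (N : ℝ)) ^ a * (q : ℝ) ^ a := by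
        rw [← Real.mul_rpow (by positivity) (by positivity)]
        exact Real.rpow_le_rpow (by positivity) hqn2 ha
      have h2 : (n : ℝ) ^ p ≤ (n : ℝ) ^ a * (n : ℝ) ^ β := by
        rw [← Real.rpow_add (by positivity)]
        exact Real.rpow_le_rpow_of_exponent_le hn1 (by linarith)
      rw [Real.rpow_neg (by positivity), inv_mul_le_iff₀ (by positivity)]
      calc (n : ℝ) ^ p ≤ (n : ℝ) ^ a * (n : ℝ) ^ β := h2
        _ ≤ ((2 * (N : ℝ)) ^ a * (q : ℝ) ^ a) * (n : ℝ) ^ β := by gcongr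
        _ = _ := by ring
    have b5 : (n : ℝ) ^ (p / 2) * G + (q : ℝ) ^ (-a) * (n : ℝ) ^ p
        ≤ (2 * (N : ℝ)) ^ a * ((n : ℝ) ^ (p / 2) * G + (n : ℝ) ^ β) := by
      have : (1 : ℝ) ≤ (2 * (N : ℝ)) ^ a := Real.one_le_rpow (by linarith) ha
      have h3 := le_mul_of_one_le_left (show 0 ≤ (n : ℝ) ^ (p / 2) * G by positivity) this
      rw [mul_add]
      exact add_le_add h3 b4
    have hgn := hg n
    set g : ℝ := (n : ℝ) ^ (p / 2) * G + (n : ℝ) ^ β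
    rw [e, hsum] at R
    have i3 : Φ (x + m) (x + m + q) ≤ D * ((1 / N) ^ β * g) := by
      rcases Nat.lt_or_ge q n with hlt | hge
      · exact (ih q hlt (x + m)).trans (by gcongr)
      · have hN' : N = 1 := by
          have : q = n := le_antisymm hqle hge
          rw [this] at hqN
          exact le_antisymm (Nat.le_of_mul_le_mul_left (by omega) hn0) hN1'
        exfalso
        have h2T : 2 * T / (1 - ρ) ≤ N := (le_max_right _ _).trans hN
        have hT1 : 1 ≤ T := Real.one_le_rpow (by have : 0 < 1 / τ := by positivity
                                                 linarith) hp0.le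
        rw [hN', Nat.cast_one, div_le_one h1ρ] at h2T
        linarith
    calc Φ x (x + n) ≤ (1 + τ) ^ p * (D * ((1 / 2) ^ β * g) + D * ((1 / 2) ^ β * g)
          + L * ((2 * (N : ℝ)) ^ a * g)) + T * (D * ((1 / N) ^ β * g)) := by
          refine R.trans ?_
          have j1 := i1.trans (mul_le_mul_of_nonneg_left b1 hD0)
          have j2 := i2.trans (mul_le_mul_of_nonneg_left b2 hD0)
          rw [e] at j2
          gcongr
      _ = (D * ρ + D * (T * (1 / N) ^ β) + E) * g := by rw [hρ, hE]; ring
      _ ≤ (D * ρ + D * ((1 - ρ) / 2) + D * ((1 - ρ) / 2)) * g := by gcongr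
      _ = D * g := by ring

theorem sum_integral_rpow_le {Ω E ι : Type*} [MeasurableSpace Ω] [MeasurableSpace E]
    {P : Measure Ω} [IsProbabilityMeasure P] {X : ℤ → Ω → E} (hX : ∀ i, Measurable (X i))
    (s : Finset ι) {A : ι → Set E} (hA : ∀ c, MeasurableSet (A c))
    (hdisj : ∀ e, ∑ c ∈ s, (A c).indicator (fun _ => (1 : ℝ)) e ≤ 1) {p : ℝ} (hp : 1 ≤ p)
    {x y : ℕ} (hxy : x ≤ y) :
    ∑ c ∈ s, ∫ ω, |centeredCount P X (A c) x y ω| ^ p ∂P ≤ (2 * ((y : ℝ) - x)) ^ p := by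
  have hM : ∀ c, Measurable (centeredCount P X (A c) x y) := fun c =>
    measurable_centeredCount P (hA c) fun i _ _ => hX i
  have hi : ∀ c, Integrable (fun ω => |centeredCount P X (A c) x y ω| ^ p) P := fun c =>
    integrable_abs_rpow P (hM c) (abs_centeredCount_le (A c) hxy) (by linarith)
  rw [← integral_finsetSum _ fun c _ => hi c]
  have : ∀ ω, ∑ c ∈ s, |centeredCount P X (A c) x y ω| ^ p ≤ (2 * ((y : ℝ) - x)) ^ p := fun ω =>
    (sum_rpow_le_rpow_sum s _ (fun c => abs_nonneg _) hp).trans <|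
      Real.rpow_le_rpow (Finset.sum_nonneg fun c _ => abs_nonneg _)
        (sum_abs_centeredCount_le (hX 0) s hA hdisj hxy ω) (by linarith)
  calc _ ≤ ∫ ω, (2 * ((y : ℝ) - x)) ^ p ∂P :=
        integral_mono (integrable_finsetSum _ fun c _ => hi c) (integrable_const _) this
    _ = _ := by simp

theorem centeredCount_add_add {Ω E : Type*} [MeasurableSpace Ω] (P : Measure Ω)
    (X : ℤ → Ω → E) (A : Set E) {x y z w : ℕ} (hxy : x ≤ y) (hyz : y ≤ z) (hzw : z ≤ w) (ω : Ω) :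
    centeredCount P X A x w ω =
      centeredCount P X A x y ω + centeredCount P X A z w ω + centeredCount P X A y z ω := by
  unfold centeredCount
  rw [← Finset.sum_Ico_consecutive _ hxy (hyz.trans hzw), ← Finset.sum_Ico_consecutive _ hyz hzw]
  ring

theorem exists_moment_bound (a K p β : ℝ) (ha : 1 < a) (hp : 2 < p) (hp3 : p ≤ 3) (hβ : 1 < β)
    (hβp : β ≤ p / 2) (haβ : p - a ≤ β) : ∃ γ : ℝ, 0 < γ ∧ ∃ D : ℝ, 0 ≤ D ∧
    ∀ {Ω E ι : Type*} [MeasurableSpace Ω] [MeasurableSpace E] (P : Measure Ω)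
      [IsProbabilityMeasure P] (X : ℤ → Ω → E), IsMixing P X K a →
      ∀ (s : Finset ι) (A : ι → Set E) (δ : ℝ), 0 ≤ δ → (∀ c, MeasurableSet (A c)) →
      (∀ e, ∑ c ∈ s, (A c).indicator (fun _ => (1 : ℝ)) e ≤ 1) →
      (∀ c ∈ s, P.real (X 0 ⁻¹' A c) ≤ δ) → ∀ n x : ℕ,
      ∑ c ∈ s, ∫ ω, |centeredCount P X (A c) x (x + n) ω| ^ p ∂P
        ≤ D * ((n : ℝ) ^ (p / 2) * δ ^ γ + (n : ℝ) ^ β) := by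
  obtain ⟨κ, hκ, C, hC, hvar⟩ := exists_variance_bound a K ha
  rcases lt_or_ge K 0 with hK | hK
  · refine ⟨1, one_pos, 0, le_rfl, ?_⟩
    intro Ω E ι _ _ P _ X h
    exact absurd h.nonneg (not_le.2 hK)
  set R : ℝ := p * 2 ^ (p - 1) with hR
  have hR0 : 0 ≤ R := by positivity
  set L : ℝ := R * (2 * ((2 * C) ^ (p / 2) + 4 * K * 2 ^ p)) with hL
  have hL0 : 0 ≤ L := by positivity
  obtain ⟨D, hD, hrec⟩ := exists_recursion_bound p β a L hp hβ hβp (by linarith) haβ hL0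
  refine ⟨κ * (p / 2 - 1), mul_pos hκ (by linarith), D, hD, ?_⟩
  intro Ω E ι _ _ P _ X h s A δ hδ hA hdisj hAδ n x
  refine hrec (fun x y => ∑ c ∈ s, ∫ ω, |centeredCount P X (A c) x y ω| ^ p ∂P)
    (δ ^ (κ * (p / 2 - 1))) (by positivity) ?_ ?_ n x
  · intro x n
    have := sum_integral_rpow_le (P := P) h.meas s hA hdisj (p := p) (by linarith)
      (Nat.le_add_right x n)
    simpa using this
  · intro τ hτ x m q m' hq
    set y := x + m with hy
    set z := y + q with hz
    set w := z + m' with hw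
    set N : ℝ := ((m + q + m' : ℕ) : ℝ) with hN
    have hN0 : 0 ≤ N := by positivity
    have hxy : x ≤ y := by omega
    have hyz : y ≤ z := by omega
    have hzw : z ≤ w := by omega
    have l1 : (y : ℝ) - x ≤ N := by rw [hy, hN]; push_cast; linarith [Nat.cast_nonneg (α := ℝ) q, Nat.cast_nonneg (α := ℝ) m']
    have l2 : (w : ℝ) - z ≤ N := by rw [hw, hN]; push_cast; linarith [Nat.cast_nonneg (α := ℝ) q, Nat.cast_nonneg (α := ℝ) m]
    obtain ⟨v1, V1⟩ := hvar P X h s A δ hA hdisj hAδ x y hxy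
    obtain ⟨v2, V2⟩ := hvar P X h s A δ hA hdisj hAδ z w hzw
    have c1 : C * ((y : ℝ) - x) ≤ C * N := by gcongr
    have c2 : C * ((w : ℝ) - z) ≤ C * N := by gcongr
    have c3 : C * ((y : ℝ) - x) * δ ^ κ ≤ C * N * δ ^ κ := by gcongr
    have c4 : C * ((w : ℝ) - z) * δ ^ κ ≤ C * N * δ ^ κ := by gcongr
    have cross : ∀ {r t : ℝ}, 1 ≤ r → r ≤ 2 → 1 ≤ t → t ≤ 2 → r + t = p →
        ∑ c ∈ s, ∫ ω, |centeredCount P X (A c) x y ω| ^ r * |centeredCount P X (A c) z w ω| ^ t ∂P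
          ≤ ((2 * C) ^ (p / 2) + 4 * K * 2 ^ p) *
            (N ^ (p / 2) * δ ^ (κ * (p / 2 - 1)) + (q : ℝ) ^ (-a) * N ^ p) := by
      intro r t hr1 hr2 ht1 ht2 hrt
      refine (sum_cross_moment_le h s hA hdisj hxy hz hq hzw (v := C * N * δ ^ κ) (V := C * N)
        (by positivity) l1 l2 (fun c hc => (v1 c hc).trans c3) (fun c hc => (v2 c hc).trans c4)
        (V1.trans c1) (V2.trans c2) hr1 hr2 ht1 ht2).trans ?_
      have e1 : (2 * (C * N * δ ^ κ)) ^ ((r + t) / 2 - 1) * (2 * (C * N))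
          = (2 * C) ^ (p / 2) * (N ^ (p / 2) * δ ^ (κ * (p / 2 - 1))) := by
        have e2 : 2 * (C * N * δ ^ κ) = (2 * C * N) * δ ^ κ := by ring
        have e3 : (2 * C * N) ^ (p / 2) = (2 * C * N) ^ (p / 2 - 1) * (2 * C * N) := by
          nth_rewrite 3 [← Real.rpow_one (2 * C * N)]
          rw [← Real.rpow_add_of_nonneg (by positivity) (by linarith) (by norm_num)]
          congr 1; ring
        rw [hrt, e2, Real.mul_rpow (by positivity) (by positivity), ← Real.rpow_mul hδ,
          ← mul_assoc ((2 * C) ^ (p / 2)), ← Real.mul_rpow (by positivity) hN0, e3]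
        ring
      have e2 : 4 * (K * (q : ℝ) ^ (-a)) * (2 * N) ^ r * (2 * N) ^ t
          = 4 * K * 2 ^ p * ((q : ℝ) ^ (-a) * N ^ p) := by
        rw [mul_assoc, ← Real.rpow_add_of_nonneg (by positivity) (by linarith) (by linarith), hrt,
          Real.mul_rpow (by norm_num) hN0]
        ring
      rw [e1, e2]
      have n1 : 0 ≤ (2 * C) ^ (p / 2) := by positivity
      have n2 : 0 ≤ 4 * K * 2 ^ p := by positivity
      have n3 : 0 ≤ N ^ (p / 2) * δ ^ (κ * (p / 2 - 1)) := by positivity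
      have n4 : 0 ≤ (q : ℝ) ^ (-a) * N ^ p := by positivity
      nlinarith [mul_nonneg n1 n4, mul_nonneg n2 n3]
    have cr1 := cross (r := p - 1) (t := 1) (by linarith) (by linarith) le_rfl (by norm_num)
      (by ring)
    have cr2 := cross (r := 1) (t := p - 1) le_rfl (by norm_num) (by linarith) (by linarith)
      (by ring)
    have hM : ∀ c x y, Measurable (centeredCount P X (A c) x y) := fun c x y =>
      measurable_centeredCount P (hA c) fun i _ _ => h.meas i
    have hi : ∀ c {x y : ℕ}, x ≤ y → Integrable (fun ω => |centeredCount P X (A c) x y ω| ^ p) P :=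
      fun c x y hxy => integrable_abs_rpow P (hM c x y) (abs_centeredCount_le (A c) hxy)
        (by linarith)
    have hii : ∀ c {r t : ℝ}, 0 ≤ r → 0 ≤ t → Integrable (fun ω =>
        |centeredCount P X (A c) x y ω| ^ r * |centeredCount P X (A c) z w ω| ^ t) P :=
      fun c r t hr ht => integrable_abs_rpow_mul P (hM c x y) (abs_centeredCount_le (A c) hxy)
        (hM c z w) (abs_centeredCount_le (A c) hzw) hr ht
    have hterm : ∀ c, ∫ ω, |centeredCount P X (A c) x w ω| ^ p ∂P ≤
        (1 + τ) ^ p * (∫ ω, |centeredCount P X (A c) x y ω| ^ p ∂P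
          + ∫ ω, |centeredCount P X (A c) z w ω| ^ p ∂P
          + R * (∫ ω, |centeredCount P X (A c) x y ω| ^ (p - 1)
                * |centeredCount P X (A c) z w ω| ^ (1 : ℝ) ∂P
            + ∫ ω, |centeredCount P X (A c) x y ω| ^ (1 : ℝ)
                * |centeredCount P X (A c) z w ω| ^ (p - 1) ∂P))
        + (1 + 1 / τ) ^ p * ∫ ω, |centeredCount P X (A c) y z ω| ^ p ∂P := by
      intro c
      have j1 := hi c hxy
      have j2 := hi c hzw
      have j3 := hii c (r := p - 1) (t := 1) (by linarith) (by norm_num)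
      have j4 := hii c (r := 1) (t := p - 1) (by norm_num) (by linarith)
      have j5 := hi c hyz
      have j6 : Integrable (fun ω => |centeredCount P X (A c) x y ω| ^ p
          + |centeredCount P X (A c) z w ω| ^ p) P := j1.add j2
      have j7 : Integrable (fun ω => R * (|centeredCount P X (A c) x y ω| ^ (p - 1)
          * |centeredCount P X (A c) z w ω| ^ (1 : ℝ) + |centeredCount P X (A c) x y ω| ^ (1 : ℝ)
          * |centeredCount P X (A c) z w ω| ^ (p - 1))) P := (j3.add j4).const_mul R
      have j8 : Integrable (fun ω => (1 + τ) ^ p * (|centeredCount P X (A c) x y ω| ^ p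
          + |centeredCount P X (A c) z w ω| ^ p + R * (|centeredCount P X (A c) x y ω| ^ (p - 1)
          * |centeredCount P X (A c) z w ω| ^ (1 : ℝ) + |centeredCount P X (A c) x y ω| ^ (1 : ℝ)
          * |centeredCount P X (A c) z w ω| ^ (p - 1)))) P := (j6.add j7).const_mul _
      rw [← integral_add j3 j4, ← integral_const_mul, ← integral_add j1 j2,
        ← integral_add j6 j7, ← integral_const_mul,
        ← integral_const_mul, ← integral_add j8 (j5.const_mul _)]
      refine integral_mono (hi c (hxy.trans (hyz.trans hzw)))
        (j8.add (j5.const_mul _)) fun ω => ?_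
      have k1 : |centeredCount P X (A c) x w ω| ≤ (|centeredCount P X (A c) x y ω|
          + |centeredCount P X (A c) z w ω|) + |centeredCount P X (A c) y z ω| := by
        rw [centeredCount_add_add P X (A c) hxy hyz hzw]
        exact abs_add_three _ _ _
      refine (Real.rpow_le_rpow (abs_nonneg _) k1 (by linarith)).trans ?_
      refine (add_rpow_le_of_pos (by positivity) (by positivity) (by linarith) hτ).trans ?_
      have := add_rpow_le_cross (abs_nonneg (centeredCount P X (A c) x y ω))
        (abs_nonneg (centeredCount P X (A c) z w ω)) (p := p) (by linarith)
      gcongr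
    refine (Finset.sum_le_sum fun c _ => hterm c).trans ?_
    simp only [Finset.sum_add_distrib, ← Finset.mul_sum]
    have hR2 := mul_le_mul_of_nonneg_left (add_le_add cr1 cr2) hR0
    refine add_le_add (mul_le_mul_of_nonneg_left (add_le_add le_rfl (hR2.trans_eq ?_))
      (by positivity)) le_rfl
    rw [hL]
    ring

/-- `f` is a combination, with coefficients in `[-1, 1]`, of indicators of dyadic blocks
`{z | z / 2 ^ j = c}` contained in `[0, 2 ^ (J + 1))`, three for each level `j ≤ h`. -/
def IsDyadicSum (J h : ℕ) (f : ℕ → ℝ) : Prop :=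
  ∃ (a : ℕ × Fin 3 → ℝ) (c : ℕ × Fin 3 → ℕ), (∀ e, |a e| ≤ 1) ∧
    (∀ e : ℕ × Fin 3, e.1 ≤ h → c e < 2 ^ (J + 1 - e.1)) ∧
    ∀ z, f z = ∑ e ∈ Finset.range (h + 1) ×ˢ Finset.univ,
      a e * if z / 2 ^ e.1 = c e then 1 else 0

theorem ite_lt_sub_ite_half_lt (u v : ℕ) :
    (if u < v then (1 : ℝ) else 0) - (if u / 2 < v / 2 then 1 else 0) =
      ((v % 2 : ℕ) : ℝ) * if u = 2 * (v / 2) then 1 else 0 := by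
  rcases Nat.mod_two_eq_zero_or_one v with h | h <;> rw [h] <;> split_ifs <;> first | omega | norm_num

theorem ite_lt_sub_ite_div_lt (z y h : ℕ) :
    (if z < y then (1 : ℝ) else 0) - (if z / 2 ^ h < y / 2 ^ h then 1 else 0) =
      ∑ j ∈ Finset.range h, ((y / 2 ^ j % 2 : ℕ) : ℝ) *
        if z / 2 ^ j = 2 * (y / 2 ^ j / 2) then 1 else 0 := by
  induction h with
  | zero => simp
  | succ h ih =>
    rw [Finset.sum_range_succ, ← ih, ← ite_lt_sub_ite_half_lt, Nat.div_div_eq_div_mul,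
      Nat.div_div_eq_div_mul, ← pow_succ]
    ring

theorem isDyadicSum_Ico {J h x y : ℕ} (hxy : x ≤ y) (hyx : y ≤ x + 2 ^ h) (hy : y ≤ 2 ^ J)
    (hJ : h ≤ J) : IsDyadicSum J h fun z => if x ≤ z ∧ z < y then 1 else 0 := by
  have hd : y / 2 ^ h = x / 2 ^ h ∨ y / 2 ^ h = x / 2 ^ h + 1 := by
    have h1 : x / 2 ^ h ≤ y / 2 ^ h := Nat.div_le_div_right hxy
    have h2 : y / 2 ^ h ≤ x / 2 ^ h + 1 := by
      rw [← Nat.add_div_right _ (by positivity)]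
      exact Nat.div_le_div_right hyx
    omega
  have hblock : ∀ j ≤ h, ∀ v ≤ 2 ^ J, v / 2 ^ j < 2 ^ (J + 1 - j) := by
    intro j hj v hv
    rw [Nat.div_lt_iff_lt_mul (by positivity), ← pow_add]
    have : J + 1 - j + j = J + 1 := by omega
    rw [this, pow_succ]
    have := Nat.pow_pos (n := J) (show 0 < 2 by norm_num)
    omega
  have hbit : ∀ v j : ℕ, |((v / 2 ^ j % 2 : ℕ) : ℝ)| ≤ 1 := by
    intro v j
    rw [abs_of_nonneg (by positivity)]
    have : v / 2 ^ j % 2 ≤ 1 := by omega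
    exact_mod_cast this
  refine ⟨fun e => ![if e.1 < h then ((y / 2 ^ e.1 % 2 : ℕ) : ℝ) else 0,
      if e.1 < h then -((x / 2 ^ e.1 % 2 : ℕ) : ℝ) else 0,
      if e.1 = h ∧ y / 2 ^ h ≠ x / 2 ^ h then 1 else 0] e.2,
    fun e => ![2 * (y / 2 ^ e.1 / 2), 2 * (x / 2 ^ e.1 / 2), x / 2 ^ e.1] e.2, ?_, ?_, ?_⟩
  · rintro ⟨j, l⟩
    fin_cases l
    · simp only [Fin.zero_eta, Matrix.cons_val_zero]
      split_ifs
      · exact hbit y j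
      · simp
    · change |if j < h then -((x / 2 ^ j % 2 : ℕ) : ℝ) else 0| ≤ 1
      split_ifs
      · rw [abs_neg]; exact hbit x j
      · simp
    · change |if j = h ∧ y / 2 ^ h ≠ x / 2 ^ h then (1 : ℝ) else 0| ≤ 1
      split_ifs <;> simp
  · rintro ⟨j, l⟩ hj
    have h1 := hblock j hj y hy
    have h2 := hblock j hj x (hxy.trans hy)
    fin_cases l
    · simp only [Fin.zero_eta, Matrix.cons_val_zero]
      omega
    · change 2 * (x / 2 ^ j / 2) < 2 ^ (J + 1 - j)
      omega
    · exact h2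
  · intro z
    rw [Finset.sum_product, Finset.sum_range_succ]
    simp only [Fin.sum_univ_three, Matrix.cons_val_zero, Matrix.cons_val_one, Matrix.cons_val,
      lt_irrefl, true_and, if_false, zero_mul, zero_add]
    have e1 : ∀ j ∈ Finset.range h,
        (((if j < h then ((y / 2 ^ j % 2 : ℕ) : ℝ) else 0) *
            if z / 2 ^ j = 2 * (y / 2 ^ j / 2) then 1 else 0) +
          (if j < h then -((x / 2 ^ j % 2 : ℕ) : ℝ) else 0) *
            if z / 2 ^ j = 2 * (x / 2 ^ j / 2) then 1 else 0) +
          ((if j = h ∧ y / 2 ^ h ≠ x / 2 ^ h then (1 : ℝ) else 0) *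
            if z / 2 ^ j = x / 2 ^ j then 1 else 0) =
        (((y / 2 ^ j % 2 : ℕ) : ℝ) * if z / 2 ^ j = 2 * (y / 2 ^ j / 2) then 1 else 0) -
          ((x / 2 ^ j % 2 : ℕ) : ℝ) * if z / 2 ^ j = 2 * (x / 2 ^ j / 2) then 1 else 0 := by
      intro j hj
      rw [Finset.mem_range] at hj
      rw [if_pos hj, if_pos hj, if_neg (fun h' : j = h ∧ y / 2 ^ h ≠ x / 2 ^ h => hj.ne h'.1)]
      ring
    refine Eq.trans ?_ (congrArg (· + _) (Finset.sum_congr rfl e1).symm)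
    rw [Finset.sum_sub_distrib, ← ite_lt_sub_ite_div_lt,
      ← ite_lt_sub_ite_div_lt]
    rcases hd with hd | hd
    · rw [hd]
      split_ifs <;> first | omega | norm_num
    · rw [hd]
      split_ifs <;> first | omega | (norm_num; done) | norm_num [*]

/-- The dyadic cell of levels `l (some k)` and positions `c (some k)` in the coordinates `W k`. -/
def dyadicCell {E κ : Type*} (W : κ → E → ℕ) (l c : Option κ → ℕ) : Set E :=
  {x | ∀ k, W k x / 2 ^ l (some k) = c (some k)}

/-- The centred number of visits to a dyadic cell during a dyadic time block. -/
def blockCount {Ω E κ : Type*} [MeasurableSpace Ω] (P : Measure Ω) (X : ℤ → Ω → E)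
    (W : κ → E → ℕ) (l c : Option κ → ℕ) (ω : Ω) : ℝ :=
  centeredCount P X (dyadicCell W l c) (c none * 2 ^ l none) ((c none + 1) * 2 ^ l none) ω

/-- Indices of the terms of a product of dyadic sums that have a factor of level at most `h`. -/
def dyadicTerms (κ : Type*) [Fintype κ] [DecidableEq κ] (J h : ℕ) :
    Finset (Option κ → ℕ × Fin 3) :=
  (Fintype.piFinset fun _ => Finset.range (J + 1) ×ˢ Finset.univ).filter fun e => ∃ k, (e k).1 ≤ h

theorem measurableSet_dyadicCell {E κ : Type*} [MeasurableSpace E] [Finite κ] {W : κ → E → ℕ}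
    (hW : ∀ k, Measurable (W k)) (l c : Option κ → ℕ) : MeasurableSet (dyadicCell W l c) := by
  unfold dyadicCell
  rw [ofPred_forall]
  exact MeasurableSet.iInter fun k =>
    (measurable_from_nat (f := fun z => z / 2 ^ l (some k))).comp (hW k)
      (measurableSet_singleton _)

theorem mul_indicator_eq_sum {E κ : Type*} [Fintype κ] [DecidableEq κ] {W : κ → E → ℕ}
    {A : Set E} {φ : ℕ → ℝ} {f : Option κ → ℕ → ℝ}
    (hprod : ∀ i x, φ i * A.indicator (fun _ => (1 : ℝ)) x = f none i * ∏ k, f (some k) (W k x))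
    (t : Option κ → Finset (ℕ × Fin 3)) (a : Option κ → ℕ × Fin 3 → ℝ)
    (c : Option κ → ℕ × Fin 3 → ℕ)
    (hf : ∀ k z, f k z = ∑ e ∈ t k, a k e * if z / 2 ^ e.1 = c k e then 1 else 0) (i : ℕ) (x : E) :
    φ i * A.indicator (fun _ => (1 : ℝ)) x = ∑ e ∈ Fintype.piFinset t, (∏ k, a k (e k)) *
      ((if i / 2 ^ (e none).1 = c none (e none) then 1 else 0) *
        (dyadicCell W (fun k => (e k).1) fun k => c k (e k)).indicator (fun _ => (1 : ℝ)) x) := by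
  classical
  set z : Option κ → ℕ := fun k => k.elim i fun k => W k x with hz
  have h1 : φ i * A.indicator (fun _ => (1 : ℝ)) x = ∏ k, f k (z k) := by
    rw [hprod, Fintype.prod_option]
    simp [hz]
  rw [h1]
  simp only [hf]
  rw [Finset.prod_univ_sum]
  refine Finset.sum_congr rfl fun e _ => ?_
  rw [Finset.prod_mul_distrib]
  congr 1
  rw [Fintype.prod_option]
  simp only [hz, Option.elim_none, Option.elim_some]
  congr 1
  rw [Finset.prod_boole, indicator_apply]
  simp only [dyadicCell, Finset.mem_univ, forall_const, mem_ofPred_eq]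
  congr

theorem sum_range_div_eq {N j b : ℕ} (h : (b + 1) * 2 ^ j ≤ N) (g : ℕ → ℝ) :
    ∑ i ∈ Finset.range N, (if i / 2 ^ j = b then 1 else 0) * g i =
      ∑ i ∈ Finset.Ico (b * 2 ^ j) ((b + 1) * 2 ^ j), g i := by
  simp only [ite_mul, one_mul, zero_mul]
  rw [← Finset.sum_filter]
  refine Finset.sum_congr ?_ fun _ _ => rfl
  ext i
  simp only [Finset.mem_filter, Finset.mem_range, Finset.mem_Ico]
  rw [Nat.div_eq_iff (by positivity)]
  have : 0 < 2 ^ j := by positivity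
  have e : (b + 1) * 2 ^ j = b * 2 ^ j + 2 ^ j := by ring
  rw [e] at h ⊢
  omega

theorem abs_sum_le_sum_dyadicTerms {Ω E κ : Type*} [MeasurableSpace Ω] [MeasurableSpace E]
    [Fintype κ] [DecidableEq κ] {P : Measure Ω} [IsProbabilityMeasure P] {X : ℤ → Ω → E}
    (hX : Measurable (X 0)) {W : κ → E → ℕ} (hW : ∀ k, Measurable (W k)) {J h : ℕ} {ω : Ω}
    {M : (Option κ → ℕ) → ℝ} (hM0 : ∀ l, 0 ≤ M l)
    (hM : ∀ l c, (∀ k, l k ≤ J) → (∀ k, c k < 2 ^ (J + 1 - l k)) → |blockCount P X W l c ω| ≤ M l)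
    {A : Set E} (hA : MeasurableSet A) {φ : ℕ → ℝ} {f : Option κ → ℕ → ℝ}
    (hprod : ∀ i x, φ i * A.indicator (fun _ => (1 : ℝ)) x = f none i * ∏ k, f (some k) (W k x))
    {H : Option κ → ℕ} (hf : ∀ k, IsDyadicSum J (H k) (f k)) (hHJ : ∀ k, H k ≤ J)
    (hh : ∃ k, H k ≤ h) :
    |∑ i ∈ Finset.range (2 ^ (J + 1)),
        φ i * (A.indicator (fun _ => (1 : ℝ)) (X i ω) - P.real (X 0 ⁻¹' A))| ≤
      ∑ e ∈ dyadicTerms κ J h, M fun k => (e k).1 := by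
  choose a c ha hc hf using hf
  set t : Option κ → Finset (ℕ × Fin 3) := fun k => Finset.range (H k + 1) ×ˢ Finset.univ with ht
  have key := mul_indicator_eq_sum hprod t a c hf
  set cell : (Option κ → ℕ × Fin 3) → Set E :=
    fun e => dyadicCell W (fun k => (e k).1) fun k => c k (e k) with hcell
  have hcm : ∀ e, MeasurableSet (cell e) := fun e => measurableSet_dyadicCell hW _ _
  have real_eq : ∀ B : Set E, MeasurableSet B →
      P.real (X 0 ⁻¹' B) = ∫ ω, B.indicator (fun _ => (1 : ℝ)) (X 0 ω) ∂P := by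
    intro B hB
    have : (fun ω => B.indicator (fun _ => (1 : ℝ)) (X 0 ω))
        = (X 0 ⁻¹' B).indicator (fun _ => (1 : ℝ)) := rfl
    rw [this, integral_indicator_const _ (hX hB)]
    simp
  have hint : ∀ B : Set E, MeasurableSet B →
      Integrable (fun ω => B.indicator (fun _ => (1 : ℝ)) (X 0 ω)) P := fun B hB =>
    (integrable_const (1 : ℝ)).indicator (hX hB)
  have key2 : ∀ i : ℕ, φ i * P.real (X 0 ⁻¹' A) = ∑ e ∈ Fintype.piFinset t, (∏ k, a k (e k)) *
      ((if i / 2 ^ (e none).1 = c none (e none) then 1 else 0) * P.real (X 0 ⁻¹' cell e)) := by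
    intro i
    rw [real_eq A hA, ← integral_const_mul]
    simp only [key]
    rw [integral_finsetSum _ fun e _ => ((hint _ (hcm e)).const_mul _).const_mul _]
    refine Finset.sum_congr rfl fun e _ => ?_
    rw [integral_const_mul, integral_const_mul, real_eq _ (hcm e)]
  have hmem : ∀ e ∈ Fintype.piFinset t, ∀ k, (e k).1 ≤ H k := by
    intro e he k
    have := Fintype.mem_piFinset.1 he k
    simp only [ht, Finset.mem_product, Finset.mem_range] at this
    omega
  have hsum : ∑ i ∈ Finset.range (2 ^ (J + 1)),
      φ i * (A.indicator (fun _ => (1 : ℝ)) (X i ω) - P.real (X 0 ⁻¹' A)) =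
      ∑ e ∈ Fintype.piFinset t, (∏ k, a k (e k)) *
        blockCount P X W (fun k => (e k).1) (fun k => c k (e k)) ω := by
    simp only [mul_sub, key, key2, ← Finset.sum_sub_distrib]
    rw [Finset.sum_comm]
    refine Finset.sum_congr rfl fun e he => ?_
    have h1 := hmem e he none
    have h2 := hc none (e none) h1
    have h3 := hHJ none
    have h4 : (c none (e none) + 1) * 2 ^ (e none).1 ≤ 2 ^ (J + 1) := by
      have : 2 ^ (J + 1) = 2 ^ (J + 1 - (e none).1) * 2 ^ (e none).1 := by
        rw [← pow_add]; congr 1; omega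
      rw [this]
      exact Nat.mul_le_mul_right _ h2
    unfold blockCount centeredCount
    rw [← sum_range_div_eq h4, Finset.mul_sum]
    refine Finset.sum_congr rfl fun i _ => ?_
    ring
  rw [hsum]
  refine (Finset.abs_sum_le_sum_abs _ _).trans ?_
  have hterm : ∀ e ∈ Fintype.piFinset t, |(∏ k, a k (e k)) *
      blockCount P X W (fun k => (e k).1) (fun k => c k (e k)) ω| ≤ M fun k => (e k).1 := by
    intro e he
    rw [abs_mul, Finset.abs_prod]
    have h1 : ∏ k, |a k (e k)| ≤ 1 := Finset.prod_le_one (fun _ _ => abs_nonneg _) fun k _ => ha k _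
    have h2 := hM (fun k => (e k).1) (fun k => c k (e k))
      (fun k => (hmem e he k).trans (hHJ k)) fun k => hc k _ (hmem e he k)
    exact (mul_le_of_le_one_left (abs_nonneg _) h1).trans h2
  refine (Finset.sum_le_sum hterm).trans ?_
  refine Finset.sum_le_sum_of_subset_of_nonneg (fun e he => ?_) fun _ _ _ => hM0 _
  obtain ⟨k0, hk0⟩ := hh
  simp only [dyadicTerms, Finset.mem_filter, Fintype.mem_piFinset, Finset.mem_product,
    Finset.mem_range, Finset.mem_univ, and_true]
  exact ⟨fun k => by have := hmem e he k; have := hHJ k; omega, k0, (hmem e he k0).trans hk0⟩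

theorem measurableSet_setOf_forall_lt {E κ : Type*} [MeasurableSpace E] [Finite κ] {W : κ → E → ℕ}
    (hW : ∀ k, Measurable (W k)) (v w : κ → ℕ) :
    MeasurableSet {x | ∀ k, v k ≤ W k x ∧ W k x < w k} := by
  rw [ofPred_forall]
  exact MeasurableSet.iInter fun k => hW k (MeasurableSet.of_discrete (s := Ico (v k) (w k)))

theorem sum_range_ite_mul_eq {N x y : ℕ} (h : y ≤ N) (g : ℕ → ℝ) :
    ∑ i ∈ Finset.range N, (if x ≤ i ∧ i < y then 1 else 0) * g i = ∑ i ∈ Finset.Ico x y, g i := by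
  simp only [ite_mul, one_mul, zero_mul]
  rw [← Finset.sum_filter]
  refine Finset.sum_congr ?_ fun _ _ => rfl
  ext i
  simp only [Finset.mem_filter, Finset.mem_range, Finset.mem_Ico]
  omega

theorem abs_centeredCount_box_le {Ω E κ : Type*} [MeasurableSpace Ω] [MeasurableSpace E]
    [Fintype κ] [DecidableEq κ] {P : Measure Ω} [IsProbabilityMeasure P] {X : ℤ → Ω → E}
    (hX : Measurable (X 0)) {W : κ → E → ℕ} (hW : ∀ k, Measurable (W k)) {J h : ℕ} {ω : Ω}
    {M : (Option κ → ℕ) → ℝ} (hM0 : ∀ l, 0 ≤ M l)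
    (hM : ∀ l c, (∀ k, l k ≤ J) → (∀ k, c k < 2 ^ (J + 1 - l k)) → |blockCount P X W l c ω| ≤ M l)
    (hhJ : h ≤ J) {x y : ℕ} (hxy : x ≤ y) (hy : y ≤ 2 ^ J) {v w : κ → ℕ} (hvw : ∀ k, v k ≤ w k)
    (hw : ∀ k, w k ≤ 2 ^ J) (hsmall : y ≤ x + 2 ^ h ∨ ∃ k, w k ≤ v k + 2 ^ h) :
    |centeredCount P X {x | ∀ k, v k ≤ W k x ∧ W k x < w k} x y ω| ≤
      ∑ e ∈ dyadicTerms κ J h, M fun k => (e k).1 := by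
  set A : Set E := {x | ∀ k, v k ≤ W k x ∧ W k x < w k} with hA
  have hAm : MeasurableSet A := measurableSet_setOf_forall_lt hW v w
  set lo : Option κ → ℕ := fun k => k.elim x v
  set hi : Option κ → ℕ := fun k => k.elim y w
  have h1 : ∀ k, lo k ≤ hi k := fun k => by cases k <;> simp [lo, hi, hxy, hvw]
  have h2 : ∀ k, hi k ≤ 2 ^ J := fun k => by cases k <;> simp [hi, hy, hw]
  have h3 : ∃ k, hi k ≤ lo k + 2 ^ h := by
    rcases hsmall with h | ⟨k, hk⟩
    · exact ⟨none, h⟩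
    · exact ⟨some k, hk⟩
  obtain ⟨k0, hk0⟩ := h3
  set H : Option κ → ℕ := fun k => if k = k0 then h else J
  have := abs_sum_le_sum_dyadicTerms (A := A) (X := X) (P := P) (ω := ω) (J := J) (h := h) hX hW hM0
    hM hAm
    (φ := fun i => if x ≤ i ∧ i < y then 1 else 0)
    (f := fun k z => if lo k ≤ z ∧ z < hi k then 1 else 0) (H := H) ?_ ?_ ?_ ⟨k0, by simp [H]⟩
  · unfold centeredCount
    rwa [sum_range_ite_mul_eq (hy.trans (Nat.pow_le_pow_right (by norm_num) (by omega)))] at this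
  · intro i e
    classical
    rw [Finset.prod_boole, indicator_apply]
    simp only [hA, lo, hi, Option.elim_none, Option.elim_some, Finset.mem_univ, forall_const,
      mem_ofPred_eq]
    congr
  · intro k
    by_cases hk : k = k0
    · subst hk
      simp only [H, if_true]
      exact isDyadicSum_Ico (h1 k) hk0 (h2 k) hhJ
    · simp only [H, if_neg hk]
      exact isDyadicSum_Ico (h1 k) ((h2 k).trans (Nat.le_add_left _ _)) (h2 k) le_rfl
  · intro k
    simp only [H]
    split_ifs <;> omega

theorem centeredCount_add_of_indicator {Ω E : Type*} [MeasurableSpace Ω] [MeasurableSpace E]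
    {P : Measure Ω} [IsProbabilityMeasure P] {X : ℤ → Ω → E} (hX : Measurable (X 0))
    {A B : Set E} (hB : MeasurableSet B) (hAB : Disjoint A B) (x y : ℕ)
    (ω : Ω) : centeredCount P X (A ∪ B) x y ω
      = centeredCount P X A x y ω + centeredCount P X B x y ω := by
  unfold centeredCount
  rw [← Finset.sum_add_distrib]
  refine Finset.sum_congr rfl fun i _ => ?_
  rw [indicator_union_of_disjoint hAB, preimage_union,
    measureReal_union (hAB.preimage _) (hX hB)]
  ring

theorem abs_centeredCount_lowerBox_sub_le {Ω E κ : Type*} [MeasurableSpace Ω] [MeasurableSpace E]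
    [Fintype κ] [DecidableEq κ] {P : Measure Ω} [IsProbabilityMeasure P] {X : ℤ → Ω → E}
    (hX : Measurable (X 0)) {W : κ → E → ℕ} (hW : ∀ k, Measurable (W k)) {J h : ℕ} {ω : Ω}
    {M : (Option κ → ℕ) → ℝ} (hM0 : ∀ l, 0 ≤ M l)
    (hM : ∀ l c, (∀ k, l k ≤ J) → (∀ k, c k < 2 ^ (J + 1 - l k)) → |blockCount P X W l c ω| ≤ M l)
    (hhJ : h ≤ J) {x y : ℕ} (hxy : x ≤ y) (hy : y ≤ 2 ^ J) {v w : κ → ℕ}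
    (hv : ∀ k, v k ≤ 2 ^ J) (hw : ∀ k, w k ≤ 2 ^ J) (hvw : ∀ k, w k ≤ v k + 2 ^ h)
    (hwv : ∀ k, v k ≤ w k + 2 ^ h) :
    |centeredCount P X {x | ∀ k, 0 ≤ W k x ∧ W k x < v k} x y ω -
        centeredCount P X {x | ∀ k, 0 ≤ W k x ∧ W k x < w k} x y ω| ≤
      Fintype.card κ * ∑ e ∈ dyadicTerms κ J h, M fun k => (e k).1 := by
  set T := ∑ e ∈ dyadicTerms κ J h, M fun k => (e k).1
  set Z : (κ → ℕ) → ℝ := fun u => centeredCount P X {x | ∀ k, 0 ≤ W k x ∧ W k x < u k} x y ω with hZ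
  have mono : ∀ (u : κ → ℕ) (k : κ) (b : ℕ), (∀ k, u k ≤ 2 ^ J) → b ≤ u k → u k ≤ b + 2 ^ h →
      |Z u - Z (Function.update u k b)| ≤ T := by
    intro u k b hu hb hub
    have hsplit : {x | ∀ i, 0 ≤ W i x ∧ W i x < u i} =
        {x | ∀ i, 0 ≤ W i x ∧ W i x < Function.update u k b i} ∪
        {x | ∀ i, Function.update (fun _ => 0) k b i ≤ W i x ∧ W i x < u i} := by
      ext e
      simp only [mem_ofPred_eq, mem_union]
      constructor
      · intro H
        rcases lt_or_ge (W k e) b with hlt | hge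
        · refine Or.inl fun i => ⟨Nat.zero_le _, ?_⟩
          rcases eq_or_ne i k with rfl | hi
          · simpa using hlt
          · simpa [hi] using (H i).2
        · refine Or.inr fun i => ⟨?_, (H i).2⟩
          rcases eq_or_ne i k with rfl | hi
          · simpa using hge
          · simp [hi]
      · rintro (H | H) i
        · refine ⟨Nat.zero_le _, (H i).2.trans_le ?_⟩
          rcases eq_or_ne i k with rfl | hi
          · simpa using hb
          · simp [hi]
        · exact ⟨Nat.zero_le _, (H i).2⟩
    have hdisj : Disjoint {x | ∀ i, 0 ≤ W i x ∧ W i x < Function.update u k b i}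
        {x | ∀ i, Function.update (fun _ => 0) k b i ≤ W i x ∧ W i x < u i} := by
      rw [Set.disjoint_left]
      intro e h1 h2
      have a1 := (h1 k).2
      have a2 := (h2 k).1
      simp at a1 a2
      omega
    have : Z u = Z (Function.update u k b) +
        centeredCount P X {x | ∀ i, Function.update (fun _ => 0) k b i ≤ W i x ∧ W i x < u i}
          x y ω := by
      simp only [hZ]
      rw [hsplit, centeredCount_add_of_indicator hX (measurableSet_setOf_forall_lt hW _ _) hdisj]
    rw [this, add_sub_cancel_left]
    refine abs_centeredCount_box_le hX hW hM0 hM hhJ hxy hy (fun i => ?_) hu (Or.inr ⟨k, ?_⟩)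
    · rcases eq_or_ne i k with rfl | hi
      · simpa using hb
      · simp [hi]
    · simpa using hub
  have step : ∀ (u : κ → ℕ) (k : κ) (b : ℕ), (∀ k, u k ≤ 2 ^ J) → b ≤ 2 ^ J → b ≤ u k + 2 ^ h →
      u k ≤ b + 2 ^ h → |Z u - Z (Function.update u k b)| ≤ T := by
    intro u k b hu hbJ h1 h2
    rcases le_total b (u k) with hb | hb
    · exact mono u k b hu hb h2
    · have := mono (Function.update u k b) k (u k) (fun i => ?_) (by simpa using hb)
        (by simpa using h1)
      · rw [Function.update_idem, Function.update_eq_self] at this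
        rwa [abs_sub_comm]
      · rcases eq_or_ne i k with rfl | hi
        · simpa using hbJ
        · simpa [hi] using hu i
  have ind : ∀ s : Finset κ, |Z v - Z (s.piecewise w v)| ≤ s.card * T := by
    intro s
    induction s using Finset.induction_on with
    | empty => simp
    | insert k s hk ih =>
      rw [Finset.piecewise_insert, Finset.card_insert_of_notMem hk]
      have hle : ∀ i, s.piecewise w v i ≤ 2 ^ J := fun i => by
        by_cases hi : i ∈ s <;> simp [hi, hv, hw]
      have := step (s.piecewise w v) k (w k) hle (hw k) (by simpa [hk] using hvw k)
        (by simpa [hk] using hwv k)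
      have tri := abs_sub_le (Z v) (Z (s.piecewise w v))
        (Z (Function.update (s.piecewise w v) k (w k)))
      push_cast
      linarith
  have := ind Finset.univ
  rwa [Finset.piecewise_univ, Finset.card_univ] at this

/-- The index of the dyadic interval `(w / 2 ^ J, (w + 1) / 2 ^ J]` that contains `y`. -/
def gridIndex (J : ℕ) (y : ℝ) : ℕ := ⌈2 ^ J * y⌉₊ - 1

/-- The random variables `G k ∘ Y` are uniformly distributed on `[0, 1]`. -/
structure UniformMargins {Ω E κ : Type*} [MeasurableSpace Ω] [MeasurableSpace E] (P : Measure Ω)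
    (Y : Ω → E) (G : κ → E → ℝ) : Prop where
  meas : ∀ k, Measurable (G k)
  mem_Icc : ∀ k x, G k x ∈ Icc (0 : ℝ) 1
  law : ∀ k, ∀ v ∈ Icc (0 : ℝ) 1, P.real (Y ⁻¹' {x | G k x ≤ v}) = v

theorem gridIndex_lt_iff {J w : ℕ} {y : ℝ} (hw : 0 < w) : gridIndex J y < w ↔ 2 ^ J * y ≤ w := by
  rw [← Nat.ceil_le, gridIndex]
  omega

theorem gridIndex_lt {J : ℕ} {y : ℝ} (hy : y ≤ 1) : gridIndex J y < 2 ^ J := by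
  rw [gridIndex_lt_iff (by positivity)]
  push_cast
  exact mul_le_of_le_one_right (by positivity) hy

theorem measurable_gridIndex (J : ℕ) : Measurable (gridIndex J) :=
  (measurable_from_nat (f := fun z => z - 1)).comp
    (Nat.measurable_ceil.comp (measurable_const_mul _))

section UniformMargins

variable {Ω E κ : Type*} [MeasurableSpace Ω] [MeasurableSpace E] {P : Measure Ω}
  {Y : Ω → E} {G : κ → E → ℝ}

theorem UniformMargins.measureReal_gridIndex_lt (hU : UniformMargins P Y G) {J : ℕ} (k : κ)
    {w : ℕ} (hw : w ≤ 2 ^ J) : P.real (Y ⁻¹' {x | gridIndex J (G k x) < w}) = w / 2 ^ J := by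
  rcases Nat.eq_zero_or_pos w with rfl | h0
  · simp
  · have h2 : (w : ℝ) ≤ 2 ^ J := by exact_mod_cast hw
    rw [← hU.law k (w / 2 ^ J) ⟨by positivity, div_le_one_of_le₀ h2 (by positivity)⟩]
    congr 2
    ext x
    simp only [mem_ofPred_eq]
    rw [gridIndex_lt_iff h0, le_div_iff₀ (by positivity), mul_comm]

theorem UniformMargins.measureReal_gridIndex_Ico_le [IsProbabilityMeasure P] (hU : UniformMargins P Y G)
    (hY : Measurable Y) {J : ℕ} (k : κ) {v w : ℕ} (hvw : v ≤ w) :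
    P.real (Y ⁻¹' {x | v ≤ gridIndex J (G k x) ∧ gridIndex J (G k x) < w}) ≤
      (w - v) / 2 ^ J := by
  have hm : ∀ b, MeasurableSet (Y ⁻¹' {x | gridIndex J (G k x) < b}) := fun b =>
    hY (((measurable_gridIndex J).comp (hU.meas k)) (MeasurableSet.of_discrete (s := Iio b)))
  rcases le_or_gt (2 ^ J) v with hv | hv
  · have : {x | v ≤ gridIndex J (G k x) ∧ gridIndex J (G k x) < w} = ∅ := by
      ext x
      have := gridIndex_lt (J := J) (hU.mem_Icc k x).2
      simp only [mem_ofPred_eq, mem_empty_iff_false, iff_false]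
      omega
    rw [this]
    have : (v : ℝ) ≤ w := by exact_mod_cast hvw
    simp only [preimage_empty, measureReal_empty]
    exact div_nonneg (by linarith) (by positivity)
  · have hsub : Y ⁻¹' {x | gridIndex J (G k x) < v} ⊆ Y ⁻¹' {x | gridIndex J (G k x) < w} :=
      fun x hx => lt_of_lt_of_le hx hvw
    have heq : Y ⁻¹' {x | v ≤ gridIndex J (G k x) ∧ gridIndex J (G k x) < w} =
        Y ⁻¹' {x | gridIndex J (G k x) < w} \ Y ⁻¹' {x | gridIndex J (G k x) < v} := by
      ext x
      simp only [mem_preimage, mem_ofPred_eq, Set.mem_sdiff, not_lt]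
      tauto
    rw [heq, measureReal_sdiff hsub (hm v), hU.measureReal_gridIndex_lt k hv.le, sub_div]
    refine sub_le_sub_right ?_ _
    rcases le_total w (2 ^ J) with hw | hw
    · exact (hU.measureReal_gridIndex_lt k hw).le
    · refine measureReal_le_one.trans ?_
      rw [one_le_div (by positivity)]
      exact_mod_cast hw

theorem UniformMargins.measureReal_dyadicCell_le [IsProbabilityMeasure P] [Fintype κ] [Nonempty κ]
    (hU : UniformMargins P Y G) (hY : Measurable Y) {J : ℕ} (l c : Option κ → ℕ)
    (hl : ∀ k, l k ≤ J) :
    P.real (Y ⁻¹' dyadicCell (fun k x => gridIndex J (G k x)) l c) ≤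
      ((2 : ℝ)⁻¹ ^ (∑ k : κ, (J - l (some k)))) ^ ((Fintype.card κ : ℝ)⁻¹) := by
  set q := P.real (Y ⁻¹' dyadicCell (fun k x => gridIndex J (G k x)) l c)
  have h1 : ∀ k : κ, q ≤ (2 : ℝ)⁻¹ ^ (J - l (some k)) := by
    intro k
    have := hU.measureReal_gridIndex_Ico_le hY (J := J) k
      (Nat.mul_le_mul_right (2 ^ l (some k)) (Nat.le_succ (c (some k))))
    refine (measureReal_mono (preimage_mono ?_)).trans (this.trans ?_)
    · intro x hx
      have : gridIndex J (G k x) / 2 ^ l (some k) = c (some k) := hx k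
      rw [Nat.div_eq_iff (by positivity)] at this
      have e : (c (some k) + 1) * 2 ^ l (some k) = c (some k) * 2 ^ l (some k) + 2 ^ l (some k) := by
        ring
      have : 0 < 2 ^ l (some k) := by positivity
      simp only [mem_ofPred_eq, Nat.succ_eq_add_one]
      rw [e]
      omega
    · have : (2 : ℝ) ^ J = 2 ^ (J - l (some k)) * 2 ^ l (some k) := by
        rw [← pow_add, Nat.sub_add_cancel (hl _)]
      rw [this, inv_pow]
      push_cast
      field_simp
      simp
  have h2 : q ^ Fintype.card κ ≤ (2 : ℝ)⁻¹ ^ (∑ k : κ, (J - l (some k))) := by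
    rw [← Finset.prod_pow_eq_pow_sum, ← Finset.card_univ, ← Finset.prod_const]
    exact Finset.prod_le_prod (fun _ _ => measureReal_nonneg) fun k _ => h1 k
  calc q = (q ^ Fintype.card κ) ^ ((Fintype.card κ : ℝ)⁻¹) :=
        (Real.pow_rpow_inv_natCast measureReal_nonneg Fintype.card_ne_zero).symm
    _ ≤ _ := by
        gcongr

end UniformMargins

theorem abs_le_add_mul_abs_rpow {x p t : ℝ} (ht : 0 < t) (hp : 1 ≤ p) :
    |x| ≤ t + t ^ (1 - p) * |x| ^ p := by
  rcases le_or_gt |x| t with h | h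
  · have : 0 ≤ t ^ (1 - p) * |x| ^ p := by positivity
    linarith
  · have h1 : |x| ^ (1 - p) ≤ t ^ (1 - p) :=
      Real.rpow_le_rpow_of_nonpos ht h.le (by linarith)
    have h2 : |x| = |x| ^ (1 - p) * |x| ^ p := by
      rw [← Real.rpow_add (ht.trans h)]
      simp
    have h3 : |x| ^ (1 - p) * |x| ^ p ≤ t ^ (1 - p) * |x| ^ p := by gcongr
    linarith

theorem add_rpow_le_rpow_add_of_nonneg {p x y : ℝ} (hx : 0 ≤ x) (hy : 0 ≤ y) (hp : 1 ≤ p) :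
    x ^ p + y ^ p ≤ (x + y) ^ p := by
  lift x to NNReal using hx
  lift y to NNReal using hy
  exact_mod_cast NNReal.add_rpow_le_rpow_add x y hp

theorem dyadic_moment_exponent_le {J m S : ℕ} {p β c q : ℝ} (hβ : 1 ≤ β)
    (hmJ : m ≤ J) (hc : c ≤ p / 2 - 1) (hcq : c ≤ q) :
    (2 : ℝ) ^ (J + 1 - m) * (((2 ^ m : ℕ) : ℝ) ^ (p / 2) * (2 : ℝ) ^ (-(q * S)) +
      ((2 ^ m : ℕ) : ℝ) ^ β) ≤
    2 * (2 : ℝ) ^ (J * (p / 2)) *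
      ((2 : ℝ) ^ (-(c * ((J - m : ℕ) + S : ℕ))) + (2 : ℝ) ^ (-((p / 2 - β) * J))) := by
  have h2 : (2 : ℝ) ^ (J + 1 - m) = (2 : ℝ) ^ ((J : ℝ) - m + 1) := by
    rw [← Real.rpow_natCast]
    congr 1
    rw [Nat.cast_sub (by omega)]
    push_cast
    ring
  have hm : ∀ r : ℝ, ((2 ^ m : ℕ) : ℝ) ^ r = (2 : ℝ) ^ (m * r) := by
    intro r
    push_cast
    rw [← Real.rpow_natCast, ← Real.rpow_mul (by norm_num)]
  have two : (2 : ℝ) * (2 : ℝ) ^ (J * (p / 2)) = (2 : ℝ) ^ (1 + J * (p / 2)) := by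
    rw [Real.rpow_add (by norm_num), Real.rpow_one]
  have hmJ' : (m : ℝ) ≤ J := by exact_mod_cast hmJ
  rw [h2, hm, hm, two, mul_add, mul_add, ← Real.rpow_add (by norm_num),
    ← Real.rpow_add (by norm_num), ← Real.rpow_add (by norm_num), ← Real.rpow_add (by norm_num),
    ← Real.rpow_add (by norm_num)]
  push_cast [Nat.cast_sub hmJ]
  have hS : (0 : ℝ) ≤ S := Nat.cast_nonneg S
  refine add_le_add ?_ ?_ <;> refine Real.rpow_le_rpow_of_exponent_le (by norm_num) ?_
  · nlinarith [mul_le_mul_of_nonneg_right hcq hS,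
      mul_le_mul_of_nonneg_right hc (sub_nonneg.2 hmJ')]
  · nlinarith

theorem exists_blockCount_bound {Ω E κ : Type*} [MeasurableSpace Ω] [MeasurableSpace E]
    [Fintype κ] [Nonempty κ] {P : Measure Ω} [IsProbabilityMeasure P] {X : ℤ → Ω → E} {K a : ℝ}
    (hX : IsMixing P X K a) (ha : 1 < a) {G : κ → E → ℝ} (hU : UniformMargins P (X 0) G) :
    ∃ B θ η : ℝ, 0 ≤ B ∧ 0 < θ ∧ θ < 1 ∧ 0 < η ∧ η < 1 ∧ ∀ (J : ℕ) (l : Option κ → ℕ),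
      (∀ k, l k ≤ J) → ∃ M : Ω → ℝ, (∀ ω, 0 ≤ M ω) ∧ Integrable M P ∧
        ∫ ω, M ω ∂P ≤ B * √(2 ^ J) * ((∏ k, θ ^ (J - l k)) + η ^ J) ∧
        ∀ c, (∀ k, c k < 2 ^ (J + 1 - l k)) → ∀ ω,
          |blockCount P X (fun k x => gridIndex J (G k x)) l c ω| ≤ M ω := by
  classical
  set a' := min a (5 / 3) with ha'
  have ha1 : 1 < a' := lt_min ha (by norm_num)
  have ha2 : a' ≤ 5 / 3 := min_le_right _ _
  have ha3 : a' ≤ a := min_le_left _ _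
  set p := (3 * a' + 1) / 2 with hp
  set β := (a' + 1) / 2 with hβ
  have hp2 : 2 < p := by linarith
  have hβp : β < p / 2 := by linarith
  have hp0 : 0 < p := by linarith
  obtain ⟨γ, hγ, D, hD, hmom⟩ := exists_moment_bound a K p β ha hp2 (by linarith) (by linarith)
    hβp.le (by linarith)
  set d : ℝ := (Fintype.card κ : ℝ)
  have hd : 0 < d := by simp [d, Fintype.card_pos]
  set q := d⁻¹ * γ
  set c1 := min (p / 2 - 1) q with hc1
  have hc0 : 0 < c1 := lt_min (by linarith) (by positivity)
  set B0 := (2 * D + 1) ^ p⁻¹ with hB0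
  have hB0p : 0 < B0 := by positivity
  set θ := (2 : ℝ) ^ (-(c1 / p)) with hθ
  set η := (2 : ℝ) ^ (-((p / 2 - β) / p)) with hη
  refine ⟨2 * B0, θ, η, by positivity, by positivity, ?_, by positivity, ?_, fun J l hl => ?_⟩
  · exact Real.rpow_lt_one_of_one_lt_of_neg (by norm_num) (neg_lt_zero.2 (by positivity))
  · exact Real.rpow_lt_one_of_one_lt_of_neg (by norm_num)
      (neg_lt_zero.2 (div_pos (by linarith) hp0))
  set W : κ → E → ℕ := fun k x => gridIndex J (G k x)
  have hW : ∀ k, Measurable (W k) := fun k => (measurable_gridIndex J).comp (hU.meas k)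
  set t := B0 * √(2 ^ J) * ((∏ k, θ ^ (J - l k)) + η ^ J) with ht
  have hθ0 : 0 < θ := by positivity
  have hη0 : 0 < η := by positivity
  have htp : 0 < t := by positivity
  set S : ℕ := ∑ k : κ, (J - l (some k)) with hS
  set δ : ℝ := ((2 : ℝ)⁻¹ ^ S) ^ d⁻¹ with hδ
  have hδγ : δ ^ γ = (2 : ℝ) ^ (-(q * S)) := by
    rw [hδ, ← Real.rpow_mul (by positivity), inv_pow, ← Real.rpow_natCast,
      ← Real.rpow_neg (by norm_num), ← Real.rpow_mul (by norm_num)]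
    congr 1
    ring
  set cell : ℕ → (κ → ℕ) → Option κ → ℕ := fun b c k => k.elim b c with hcell
  set s : Finset (κ → ℕ) := Fintype.piFinset fun _ => Finset.range (2 ^ (J + 1)) with hs
  have hdc : ∀ b c, dyadicCell W l (cell b c) = dyadicCell W l (cell 0 c) := fun b c => rfl
  set Q : Ω → ℝ := fun ω => ∑ b ∈ Finset.range (2 ^ (J + 1 - l none)), ∑ c ∈ s,
    |centeredCount P X (dyadicCell W l (cell 0 c)) (b * 2 ^ l none)
      (b * 2 ^ l none + 2 ^ l none) ω| ^ p with hQ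
  have hcm : ∀ A : Set E, MeasurableSet A → ∀ x y, Measurable (centeredCount P X A x y) :=
    fun A hA x y => measurable_centeredCount P hA fun i _ _ => hX.meas i
  have hint : ∀ b c, Integrable (fun ω => |centeredCount P X (dyadicCell W l (cell 0 c))
      (b * 2 ^ l none) (b * 2 ^ l none + 2 ^ l none) ω| ^ p) P := by
    intro b c
    exact integrable_abs_rpow P (hcm _ (measurableSet_dyadicCell hW _ _) _ _)
      (fun ω => abs_centeredCount_le _ (Nat.le_add_right _ _) ω) hp0.le
  have hQint : Integrable Q P := integrable_finsetSum _ fun b _ =>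
    integrable_finsetSum _ fun c _ => hint b c
  have hdisj : ∀ e, ∑ c ∈ s, (dyadicCell W l (cell 0 c)).indicator (fun _ => (1 : ℝ)) e ≤ 1 := by
    intro e
    have h0 : ∀ c ∈ s, c ≠ (fun k => W k e / 2 ^ l (some k)) →
        (dyadicCell W l (cell 0 c)).indicator (fun _ => (1 : ℝ)) e = 0 := by
      intro c _ hc
      refine indicator_of_notMem (fun hmem => hc ?_) _
      funext k
      exact (hmem k).symm
    by_cases hmem : (fun k => W k e / 2 ^ l (some k)) ∈ s
    · rw [Finset.sum_eq_single_of_mem _ hmem h0]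
      exact indicator_le_self' (fun _ _ => zero_le_one) e
    · rw [Finset.sum_eq_zero fun c hc => h0 c hc fun h => hmem (h ▸ hc)]
      exact zero_le_one
  have hQle : ∫ ω, Q ω ∂P ≤ t ^ p := by
    have h1 : ∫ ω, Q ω ∂P ≤ (2 : ℝ) ^ (J + 1 - l none) * (D * (((2 ^ l none : ℕ) : ℝ) ^ (p / 2) *
        δ ^ γ + ((2 ^ l none : ℕ) : ℝ) ^ β)) := by
      simp only [hQ]
      rw [integral_finsetSum _ fun b _ => integrable_finsetSum _ fun c _ => hint b c]
      have : ∀ b ∈ Finset.range (2 ^ (J + 1 - l none)), ∫ ω, ∑ c ∈ s,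
          |centeredCount P X (dyadicCell W l (cell 0 c)) (b * 2 ^ l none)
          (b * 2 ^ l none + 2 ^ l none) ω| ^ p ∂P ≤ D * (((2 ^ l none : ℕ) : ℝ) ^ (p / 2) *
        δ ^ γ + ((2 ^ l none : ℕ) : ℝ) ^ β) := by
        intro b _
        rw [integral_finsetSum _ fun c _ => hint b c]
        exact hmom P X hX s _ δ (by positivity) (fun c => measurableSet_dyadicCell hW _ _) hdisj
          (fun c _ => hU.measureReal_dyadicCell_le (hX.meas 0) l _ hl) _ _
      refine (Finset.sum_le_sum this).trans ?_
      simp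
    have h2 := dyadic_moment_exponent_le (S := S) (β := β) (by linarith : 1 ≤ β) (hl none)
      (min_le_left (p / 2 - 1) q) (min_le_right _ _)
    rw [hδγ] at h1
    have h3 : (2 * D + 1) * ((2 : ℝ) ^ (J * (p / 2)) *
      ((2 : ℝ) ^ (-(c1 * ((J - l none : ℕ) + S : ℕ))) + (2 : ℝ) ^ (-((p / 2 - β) * J)))) ≤ t ^ p := by
      rw [ht, Real.mul_rpow (by positivity) (by positivity), Real.mul_rpow (by positivity)
        (by positivity), hB0, Real.rpow_inv_rpow (by positivity) hp0.ne', mul_assoc]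
      refine mul_le_mul_of_nonneg_left ?_ (by positivity)
      have e1 : √((2 : ℝ) ^ J) ^ p = (2 : ℝ) ^ (J * (p / 2)) := by
        rw [Real.sqrt_eq_rpow, ← Real.rpow_natCast, ← Real.rpow_mul (by norm_num),
          ← Real.rpow_mul (by norm_num)]
        congr 1
        ring
      rw [e1]
      refine mul_le_mul_of_nonneg_left ?_ (by positivity)
      refine le_trans (le_of_eq ?_) (add_rpow_le_rpow_add_of_nonneg (by positivity) (by positivity)
        (by linarith))
      congr 1
      · rw [Finset.prod_pow_eq_pow_sum, Fintype.sum_option, ← hS, hθ, ← Real.rpow_natCast,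
          ← Real.rpow_mul (by positivity), ← Real.rpow_mul (by positivity)]
        congr 1
        field_simp
      · rw [hη, ← Real.rpow_natCast, ← Real.rpow_mul (by positivity),
          ← Real.rpow_mul (by positivity)]
        congr 1
        field_simp
    refine h1.trans (le_trans ?_ h3)
    have h4 : 0 ≤ (2 : ℝ) ^ (J * (p / 2)) *
      ((2 : ℝ) ^ (-(c1 * ((J - l none : ℕ) + S : ℕ))) + (2 : ℝ) ^ (-((p / 2 - β) * J))) := by
      positivity
    nlinarith [mul_le_mul_of_nonneg_left h2 hD]
  refine ⟨fun ω => t + t ^ (1 - p) * Q ω, fun ω => ?_, (integrable_const _).add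
    (hQint.const_mul _), ?_, fun c hc ω => ?_⟩
  · have : 0 ≤ Q ω := Finset.sum_nonneg fun _ _ => Finset.sum_nonneg fun _ _ => by positivity
    positivity
  · rw [integral_add (integrable_const _) (hQint.const_mul _), integral_const_mul _ Q]
    have h1 : t ^ (1 - p) * ∫ ω, Q ω ∂P ≤ t ^ (1 - p) * t ^ p := by gcongr
    rw [← Real.rpow_add htp] at h1
    simp only [sub_add_cancel, Real.rpow_one] at h1
    simp only [integral_const, probReal_univ, smul_eq_mul, one_mul]
    have : 2 * B0 * √(2 ^ J) * ((∏ k, θ ^ (J - l k)) + η ^ J) = 2 * t := by rw [ht]; ring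
    linarith
  · refine (abs_le_add_mul_abs_rpow htp (p := p) (by linarith)).trans ?_
    refine add_le_add le_rfl (mul_le_mul_of_nonneg_left ?_ (by positivity))
    have hb : c none ∈ Finset.range (2 ^ (J + 1 - l none)) := Finset.mem_range.2 (hc none)
    have hcs : (fun k => c (some k)) ∈ s := by
      simp only [hs, Fintype.mem_piFinset, Finset.mem_range]
      exact fun k => (hc (some k)).trans_le (Nat.pow_le_pow_right (by norm_num) (Nat.sub_le _ _))
    have e : blockCount P X W l c ω = centeredCount P X (dyadicCell W l (cell 0 fun k => c (some k)))
        (c none * 2 ^ l none) (c none * 2 ^ l none + 2 ^ l none) ω := by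
      rw [blockCount, add_mul, one_mul]
      rfl
    rw [e]
    refine le_trans ?_ (Finset.single_le_sum (f := fun b => ∑ c ∈ s,
      |centeredCount P X (dyadicCell W l (cell 0 c)) (b * 2 ^ l none)
      (b * 2 ^ l none + 2 ^ l none) ω| ^ p)
      (fun _ _ => Finset.sum_nonneg fun _ _ => by positivity) hb)
    exact Finset.single_le_sum (f := fun c' => |centeredCount P X (dyadicCell W l (cell 0 c'))
      (c none * 2 ^ l none) (c none * 2 ^ l none + 2 ^ l none) ω| ^ p)
      (fun _ _ => by positivity) hcs

theorem sum_piFinset_prod_pow_le {κ : Type*} [Fintype κ] [DecidableEq κ] {ρ : ℝ} (h0 : 0 ≤ ρ)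
    (h1 : ρ < 1) (J : ℕ) :
    ∑ e ∈ Fintype.piFinset fun _ : κ => Finset.range (J + 1) ×ˢ (Finset.univ : Finset (Fin 3)),
      ∏ k, ρ ^ (J - (e k).1) ≤ (3 * (1 - ρ)⁻¹) ^ Fintype.card κ := by
  rw [← Finset.prod_univ_sum (fun _ : κ => Finset.range (J + 1) ×ˢ (Finset.univ : Finset (Fin 3)))
    fun _ e => ρ ^ (J - e.1)]
  rw [← Finset.card_univ, ← Finset.prod_const]
  refine Finset.prod_le_prod (fun _ _ => Finset.sum_nonneg fun _ _ => by positivity) fun k _ => ?_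
  rw [Finset.sum_product]
  simp only [Finset.sum_const, Finset.card_univ, Fintype.card_fin, nsmul_eq_mul]
  rw [← Finset.mul_sum]
  have := Finset.sum_range_reflect (fun j => ρ ^ j) (J + 1)
  simp only [Nat.add_sub_cancel] at this
  rw [this]
  push_cast
  gcongr
  rw [← tsum_geometric_of_lt_one h0 h1]
  exact (summable_geometric_of_lt_one h0 h1).sum_le_tsum _ fun _ _ => by positivity

theorem sum_dyadicTerms_le {κ : Type*} [Fintype κ] [DecidableEq κ] {θ η : ℝ} (h0 : 0 < θ)
    (h1 : θ < 1) (hη : 0 ≤ η) (J h : ℕ) :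
    ∑ e ∈ dyadicTerms κ J h, (∏ k, θ ^ (J - (e k).1) + η) ≤
      (√θ) ^ (J - h) * (3 * (1 - √θ)⁻¹) ^ Fintype.card (Option κ) +
        (3 * ((J : ℝ) + 1)) ^ Fintype.card (Option κ) * η := by
  set ρ := √θ with hρ
  have hρ0 : 0 ≤ ρ := Real.sqrt_nonneg _
  have hρ1 : ρ < 1 := by rw [hρ, Real.sqrt_lt' one_pos]; simpa
  have hsq : θ = ρ * ρ := (Real.mul_self_sqrt h0.le).symm
  rw [Finset.sum_add_distrib]
  refine add_le_add ?_ ?_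
  · have hterm : ∀ e ∈ dyadicTerms κ J h, ∏ k, θ ^ (J - (e k).1) ≤
        ρ ^ (J - h) * ∏ k, ρ ^ (J - (e k).1) := by
      intro e he
      obtain ⟨k0, hk0⟩ := (Finset.mem_filter.1 he).2
      simp only [hsq, mul_pow]
      rw [Finset.prod_mul_distrib]
      refine mul_le_mul_of_nonneg_right ?_ (by positivity)
      rw [Finset.prod_pow_eq_pow_sum]
      refine pow_le_pow_of_le_one hρ0 hρ1.le ?_
      exact (Nat.sub_le_sub_left hk0 J).trans
        (Finset.single_le_sum (f := fun k => J - (e k).1) (fun _ _ => Nat.zero_le _)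
          (Finset.mem_univ k0))
    refine (Finset.sum_le_sum hterm).trans ?_
    rw [← Finset.mul_sum]
    gcongr
    refine le_trans ?_ (sum_piFinset_prod_pow_le hρ0 hρ1 J)
    exact Finset.sum_le_sum_of_subset_of_nonneg (Finset.filter_subset _ _)
      fun _ _ _ => by positivity
  · rw [Finset.sum_const, nsmul_eq_mul]
    gcongr
    have : (dyadicTerms κ J h).card ≤ (3 * (J + 1)) ^ Fintype.card (Option κ) := by
      refine (Finset.card_filter_le _ _).trans ?_
      rw [Fintype.card_piFinset]
      simp [mul_comm]
    exact_mod_cast this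

theorem tendsto_pow_mul_pow_zero {η : ℝ} (h0 : 0 < η) (h1 : η < 1) (D : ℕ) :
    Tendsto (fun J : ℕ => (3 * ((J : ℝ) + 1)) ^ D * η ^ J) atTop (nhds 0) := by
  have h := (tendsto_add_atTop_iff_nat 1).2
    (tendsto_pow_const_mul_const_pow_of_abs_lt_one D (by rwa [abs_of_pos h0] : |η| < 1))
  have := h.const_mul ((3 : ℝ) ^ D * η⁻¹)
  rw [mul_zero] at this
  refine this.congr fun J => ?_
  push_cast
  rw [mul_pow, pow_succ]
  field_simp

theorem exists_chaining_bound {Ω E κ : Type*} [MeasurableSpace Ω] [MeasurableSpace E]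
    [Fintype κ] [Nonempty κ] {P : Measure Ω} [IsProbabilityMeasure P] {X : ℤ → Ω → E} {K a : ℝ}
    (hX : IsMixing P X K a) (ha : 1 < a) {G : κ → E → ℝ} (hU : UniformMargins P (X 0) G) :
    ∃ (B ρ : ℝ) (r : ℕ → ℝ), 0 ≤ B ∧ 0 < ρ ∧ ρ < 1 ∧ Tendsto r atTop (nhds 0) ∧ ∀ J h : ℕ,
      h ≤ J → ∃ T : Ω → ℝ, (∀ ω, 0 ≤ T ω) ∧ Integrable T P ∧
        ∫ ω, T ω ∂P ≤ B * √(2 ^ J) * (ρ ^ (J - h) + r J) ∧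
        ∀ ω, ∀ x y : ℕ, x ≤ y → y ≤ 2 ^ J → ∀ v : κ → ℕ, (∀ k, v k ≤ 2 ^ J) →
          (y ≤ x + 2 ^ h → |centeredCount P X
            {x | ∀ k, 0 ≤ gridIndex J (G k x) ∧ gridIndex J (G k x) < v k} x y ω| ≤ T ω) ∧
          ∀ w : κ → ℕ, (∀ k, w k ≤ 2 ^ J) → (∀ k, w k ≤ v k + 2 ^ h) → (∀ k, v k ≤ w k + 2 ^ h) →
            |centeredCount P X
                {x | ∀ k, 0 ≤ gridIndex J (G k x) ∧ gridIndex J (G k x) < v k} x y ω -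
              centeredCount P X
                {x | ∀ k, 0 ≤ gridIndex J (G k x) ∧ gridIndex J (G k x) < w k} x y ω| ≤
              Fintype.card κ * T ω := by
  classical
  obtain ⟨B, θ, η, hB, hθ0, hθ1, hη0, hη1, hM⟩ := exists_blockCount_bound hX ha hU
  set D := Fintype.card (Option κ)
  set C := (3 * (1 - √θ)⁻¹) ^ D with hC
  have hρ1 : √θ < 1 := by rw [Real.sqrt_lt' one_pos]; simpa
  have hC0 : 0 ≤ C := by
    have : 0 < 1 - √θ := by linarith
    positivity
  refine ⟨B * (C + 1), √θ, fun J => (3 * ((J : ℝ) + 1)) ^ D * η ^ J, by positivity,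
    Real.sqrt_pos.2 hθ0, hρ1, tendsto_pow_mul_pow_zero hη0 hη1 D, fun J h hhJ => ?_⟩
  have hM' : ∀ l : Option κ → ℕ, ∃ M : Ω → ℝ, (∀ k, l k ≤ J) → ((∀ ω, 0 ≤ M ω) ∧ Integrable M P ∧
        ∫ ω, M ω ∂P ≤ B * √(2 ^ J) * ((∏ k, θ ^ (J - l k)) + η ^ J) ∧
        ∀ c, (∀ k, c k < 2 ^ (J + 1 - l k)) → ∀ ω,
          |blockCount P X (fun k x => gridIndex J (G k x)) l c ω| ≤ M ω) := by
    intro l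
    by_cases hl : ∀ k, l k ≤ J
    · obtain ⟨M, h⟩ := hM J l hl
      exact ⟨M, fun _ => h⟩
    · exact ⟨0, fun h => absurd h hl⟩
  choose M' hM' using hM'
  set M : (Option κ → ℕ) → Ω → ℝ := fun l ω => if ∀ k, l k ≤ J then M' l ω else 0 with hMdef
  have hM0 : ∀ l ω, 0 ≤ M l ω := by
    intro l ω
    simp only [hMdef]
    split_ifs with hl
    · exact (hM' l hl).1 ω
    · exact le_rfl
  have hMb : ∀ ω l c, (∀ k, l k ≤ J) → (∀ k, c k < 2 ^ (J + 1 - l k)) →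
      |blockCount P X (fun k x => gridIndex J (G k x)) l c ω| ≤ M l ω := by
    intro ω l c hl hc
    simp only [hMdef, if_pos hl]
    exact (hM' l hl).2.2.2 c hc ω
  have hlev : ∀ e ∈ dyadicTerms κ J h, ∀ k, (e k).1 ≤ J := by
    intro e he k
    have := Fintype.mem_piFinset.1 (Finset.mem_filter.1 he).1 k
    simp only [Finset.mem_product, Finset.mem_range] at this
    omega
  have hMint : ∀ e ∈ dyadicTerms κ J h, Integrable (M fun k => (e k).1) P := by
    intro e he
    simp only [hMdef, if_pos (hlev e he)]
    exact (hM' _ (hlev e he)).2.1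
  have hW : ∀ k, Measurable fun x => gridIndex J (G k x) := fun k =>
    (measurable_gridIndex J).comp (hU.meas k)
  refine ⟨fun ω => ∑ e ∈ dyadicTerms κ J h, M (fun k => (e k).1) ω,
    fun ω => Finset.sum_nonneg fun _ _ => hM0 _ _, integrable_finsetSum _ hMint, ?_,
    fun ω x y hxy hy v hv => ⟨fun hyx => ?_, fun w hw hwv hvw => ?_⟩⟩
  · rw [integral_finsetSum _ hMint]
    have h1 : ∀ e ∈ dyadicTerms κ J h, ∫ ω, M (fun k => (e k).1) ω ∂P ≤
        B * √(2 ^ J) * ((∏ k, θ ^ (J - (e k).1)) + η ^ J) := by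
      intro e he
      simp only [hMdef, if_pos (hlev e he)]
      exact (hM' _ (hlev e he)).2.2.1
    refine (Finset.sum_le_sum h1).trans ?_
    rw [← Finset.mul_sum]
    refine (mul_le_mul_of_nonneg_left (sum_dyadicTerms_le hθ0 hθ1 (by positivity) J h)
      (by positivity)).trans ?_
    have e2 : 0 ≤ √θ ^ (J - h) := by positivity
    have e3 : 0 ≤ (3 * ((J : ℝ) + 1)) ^ D * η ^ J := by positivity
    have e4 : √θ ^ (J - h) * C + (3 * ((J : ℝ) + 1)) ^ D * η ^ J ≤
        (C + 1) * (√θ ^ (J - h) + (3 * ((J : ℝ) + 1)) ^ D * η ^ J) := by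
      nlinarith [mul_nonneg hC0 e3]
    calc _ ≤ B * √(2 ^ J) * ((C + 1) * (√θ ^ (J - h) + (3 * ((J : ℝ) + 1)) ^ D * η ^ J)) :=
          mul_le_mul_of_nonneg_left e4 (by positivity)
      _ = _ := by ring
  · exact abs_centeredCount_box_le (hX.meas 0) hW (fun l => hM0 l ω) (hMb ω) hhJ hxy hy
      (fun k => Nat.zero_le _) hv (Or.inl hyx)
  · exact abs_centeredCount_lowerBox_sub_le (hX.meas 0) hW (fun l => hM0 l ω) (hMb ω) hhJ hxy hy
      hv hw hwv hvw

/-- The event that all the coordinates `G k` are at most `u k`. -/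
def lowerOrthant {E κ : Type*} (G : κ → E → ℝ) (u : κ → ℝ) : Set E := {x | ∀ k, G k x ≤ u k}

theorem measurableSet_lowerOrthant {E κ : Type*} [MeasurableSpace E] [Finite κ] {G : κ → E → ℝ}
    (hG : ∀ k, Measurable (G k)) (u : κ → ℝ) : MeasurableSet (lowerOrthant G u) := by
  unfold lowerOrthant
  rw [ofPred_forall]
  exact MeasurableSet.iInter fun k => measurableSet_le (hG k) measurable_const

theorem abs_centeredCount_sub_le_of_subset {Ω E : Type*} [MeasurableSpace Ω] {P : Measure Ω}
    [IsProbabilityMeasure P] {X : ℤ → Ω → E} {A B C : Set E} (hAB : A ⊆ B) (hBC : B ⊆ C) {x y : ℕ}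
    (hxy : x ≤ y) (ω : Ω) :
    |centeredCount P X B x y ω - centeredCount P X A x y ω| ≤
      |centeredCount P X C x y ω - centeredCount P X A x y ω| +
        (y - x) * (P.real (X 0 ⁻¹' C) - P.real (X 0 ⁻¹' A)) := by
  have hcc : ∀ D : Set E, centeredCount P X D x y ω =
      ∑ i ∈ Finset.Ico x y, D.indicator (fun _ => (1 : ℝ)) (X i ω) -
        (y - x) * P.real (X 0 ⁻¹' D) := by
    intro D
    rw [centeredCount, Finset.sum_sub_distrib]
    simp [Nat.cast_sub hxy]
  have hmono : ∀ D D' : Set E, D ⊆ D' →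
      ∑ i ∈ Finset.Ico x y, D.indicator (fun _ => (1 : ℝ)) (X i ω) ≤
        ∑ i ∈ Finset.Ico x y, D'.indicator (fun _ => (1 : ℝ)) (X i ω) := fun D D' h =>
    Finset.sum_le_sum fun i _ => indicator_le_indicator_of_subset h (fun _ => zero_le_one) _
  have h1 := hmono A B hAB
  have h2 := hmono B C hBC
  have p1 : P.real (X 0 ⁻¹' A) ≤ P.real (X 0 ⁻¹' B) := measureReal_mono (preimage_mono hAB)
  have p2 : P.real (X 0 ⁻¹' B) ≤ P.real (X 0 ⁻¹' C) := measureReal_mono (preimage_mono hBC)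
  have hxy' : (0 : ℝ) ≤ (y : ℝ) - x := sub_nonneg.2 (by exact_mod_cast hxy)
  have q1 := mul_le_mul_of_nonneg_left p1 hxy'
  have q2 := mul_le_mul_of_nonneg_left p2 hxy'
  have h3 := le_abs_self (centeredCount P X C x y ω - centeredCount P X A x y ω)
  have h4 := abs_nonneg (centeredCount P X C x y ω - centeredCount P X A x y ω)
  have eA := hcc A
  have eB := hcc B
  have eC := hcc C
  rw [abs_le, mul_sub]
  constructor <;> linarith

theorem floor_le_floor_add_two_pow {J K : ℕ} (hK : K + 1 ≤ J) {u v : ℝ}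
    (huv : |u - v| ≤ (2 : ℝ)⁻¹ ^ (K + 1)) : ⌊2 ^ J * u⌋₊ ≤ ⌊2 ^ J * v⌋₊ + 2 ^ (J - K) := by
  rcases le_or_gt u 0 with hu | hu
  · rw [Nat.floor_of_nonpos (mul_nonpos_of_nonneg_of_nonpos (by positivity) hu)]
    exact Nat.zero_le _
  · have h1 := Nat.floor_le (show 0 ≤ 2 ^ J * u by positivity)
    have h2 := Nat.lt_floor_add_one (2 ^ J * v)
    have h3 : (2 : ℝ) ^ J * (2 : ℝ)⁻¹ ^ (K + 1) = 2 ^ (J - (K + 1)) := by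
      rw [inv_pow, ← div_eq_mul_inv, div_eq_iff (by positivity), ← pow_add]
      congr 1
      omega
    have h4 : (2 : ℝ) ^ J * (u - v) ≤ 2 ^ (J - (K + 1)) := by
      rw [← h3]
      exact mul_le_mul_of_nonneg_left ((le_abs_self _).trans huv) (by positivity)
    have h5 : (⌊2 ^ J * u⌋₊ : ℝ) < (⌊2 ^ J * v⌋₊ + 1 + 2 ^ (J - (K + 1)) : ℕ) := by
      push_cast
      linarith
    have h6 : ⌊2 ^ J * u⌋₊ < ⌊2 ^ J * v⌋₊ + 1 + 2 ^ (J - (K + 1)) := by exact_mod_cast h5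
    have h7 : 2 ^ (J - (K + 1)) ≤ 2 ^ (J - K) := Nat.pow_le_pow_right (by norm_num) (by omega)
    omega

theorem exists_lowerOrthant_bound {Ω E κ : Type*} [MeasurableSpace Ω] [MeasurableSpace E]
    [Fintype κ] [Nonempty κ] {P : Measure Ω} [IsProbabilityMeasure P] {X : ℤ → Ω → E} {K a : ℝ}
    (hX : IsMixing P X K a) (ha : 1 < a) {G : κ → E → ℝ} (hU : UniformMargins P (X 0) G) :
    ∃ (B ρ : ℝ) (r : ℕ → ℝ), 0 ≤ B ∧ 0 < ρ ∧ ρ < 1 ∧ Tendsto r atTop (nhds 0) ∧ ∀ J K : ℕ,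
      K ≤ J → ∃ T : Ω → ℝ, (∀ ω, 0 ≤ T ω) ∧ Integrable T P ∧
        ∫ ω, T ω ∂P ≤ B * √(2 ^ J) * (ρ ^ K + r J) ∧
        ∀ ω, ∀ x y : ℕ, x ≤ y → y ≤ 2 ^ J → ∀ u : κ → ℝ, (∀ k, u k ≤ 1) →
          (y ≤ x + 2 ^ (J - K) → |centeredCount P X (lowerOrthant G u) x y ω| ≤
            3 * Fintype.card κ * (T ω + 1)) ∧
          (K + 1 ≤ J → ∀ v : κ → ℝ, (∀ k, v k ≤ 1) → (∀ k, |u k - v k| ≤ (2 : ℝ)⁻¹ ^ (K + 1)) →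
            |centeredCount P X (lowerOrthant G u) x y ω -
              centeredCount P X (lowerOrthant G v) x y ω| ≤
              3 * Fintype.card κ * (T ω + 1)) := by
  obtain ⟨B, ρ, r, hB, hρ0, hρ1, hr, hT⟩ := exists_chaining_bound hX ha hU
  refine ⟨B, ρ, r, hB, hρ0, hρ1, hr, fun J K hKJ => ?_⟩
  obtain ⟨T, hT0, hTi, hTe, hTb⟩ := hT J (J - K) (Nat.sub_le _ _)
  rw [Nat.sub_sub_self hKJ] at hTe
  refine ⟨T, hT0, hTi, hTe, fun ω x y hxy hy => ?_⟩
  set box : (κ → ℕ) → Set E :=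
    fun w => {x | ∀ k, 0 ≤ gridIndex J (G k x) ∧ gridIndex J (G k x) < w k} with hbox
  set fl : (κ → ℝ) → κ → ℕ := fun u k => ⌊2 ^ J * u k⌋₊ with hfl
  have hfl1 : ∀ u : κ → ℝ, (∀ k, u k ≤ 1) → ∀ k, fl u k ≤ 2 ^ J := by
    intro u hu k
    have : (2 : ℝ) ^ J * u k ≤ (2 ^ J : ℕ) := by
      push_cast
      exact mul_le_of_le_one_right (by positivity) (hu k)
    exact Nat.floor_le_of_le this
  have hd : (1 : ℝ) ≤ Fintype.card κ := by exact_mod_cast Fintype.card_pos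
  have disc : ∀ u : κ → ℝ, (∀ k, u k ≤ 1) →
      |centeredCount P X (lowerOrthant G u) x y ω - centeredCount P X (box (fl u)) x y ω| ≤
        Fintype.card κ * T ω + Fintype.card κ := by
    intro u hu
    set w' : κ → ℕ := fun k => min (fl u k + 1) (2 ^ J) with hw'
    have hw1 : ∀ k, w' k ≤ 2 ^ J := fun k => min_le_right _ _
    have hw2 : ∀ k, fl u k ≤ w' k := fun k => le_min (Nat.le_succ _) (hfl1 u hu k)
    have hw3 : ∀ k, w' k ≤ fl u k + 1 := fun k => min_le_left _ _
    have hpow : 1 ≤ 2 ^ (J - K) := Nat.one_le_two_pow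
    have s1 : box (fl u) ⊆ lowerOrthant G u := by
      intro e he k
      have h1 := (he k).2
      have h2 : 0 < fl u k := by omega
      rw [gridIndex_lt_iff h2] at h1
      have h3 : 0 ≤ 2 ^ J * u k := by
        by_contra! hneg
        simp only [hfl] at h2
        rw [Nat.floor_of_nonpos hneg.le] at h2
        exact lt_irrefl _ h2
      have h4 := h1.trans (Nat.floor_le h3)
      exact le_of_mul_le_mul_left h4 (by positivity)
    have s2 : lowerOrthant G u ⊆ box (w') := by
      intro e he k
      refine ⟨Nat.zero_le _, lt_min ?_ (gridIndex_lt (hU.mem_Icc k e).2)⟩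
      rw [gridIndex_lt_iff (Nat.succ_pos _)]
      push_cast
      refine le_trans ?_ (Nat.lt_floor_add_one (2 ^ J * u k)).le
      exact mul_le_mul_of_nonneg_left (he k) (by positivity)
    refine (abs_centeredCount_sub_le_of_subset s1 s2 hxy ω).trans (add_le_add ?_ ?_)
    · exact (hTb ω x y hxy hy w' hw1).2 (fl u) (hfl1 u hu) (fun k => (hw2 k).trans
        (Nat.le_add_right _ _)) fun k => (hw3 k).trans (Nat.add_le_add_left hpow _)
    · have hsub : P.real (X 0 ⁻¹' box w') - P.real (X 0 ⁻¹' box (fl u)) ≤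
          Fintype.card κ * (1 / 2 ^ J) := by
        have h1 : X 0 ⁻¹' box w' ⊆ X 0 ⁻¹' box (fl u) ∪ ⋃ k, X 0 ⁻¹'
            {x | fl u k ≤ gridIndex J (G k x) ∧ gridIndex J (G k x) < w' k} := by
          intro e he
          by_cases hb : ∀ k, gridIndex J (G k (X 0 e)) < fl u k
          · exact Or.inl fun k => ⟨Nat.zero_le _, hb k⟩
          · push Not at hb
            obtain ⟨k, hk⟩ := hb
            exact Or.inr (mem_iUnion.2 ⟨k, hk, (he k).2⟩)
        have h2 := (measureReal_mono (μ := P) h1).trans (measureReal_union_le _ _)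
        have h3 := measureReal_iUnion_fintype_le (μ := P) fun k => X 0 ⁻¹'
            {x | fl u k ≤ gridIndex J (G k x) ∧ gridIndex J (G k x) < w' k}
        have h4 : ∀ k ∈ (Finset.univ : Finset κ), P.real (X 0 ⁻¹'
            {x | fl u k ≤ gridIndex J (G k x) ∧ gridIndex J (G k x) < w' k}) ≤ 1 / 2 ^ J := by
          intro k _
          refine (hU.measureReal_gridIndex_Ico_le (hX.meas 0) k (hw2 k)).trans ?_
          have : (w' k : ℝ) ≤ fl u k + 1 := by exact_mod_cast hw3 k
          gcongr
          linarith
        have h5 := Finset.sum_le_sum h4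
        simp only [Finset.sum_const, Finset.card_univ, nsmul_eq_mul] at h5
        linarith
      have hyx : (y : ℝ) - x ≤ 2 ^ J := by
        have : (y : ℝ) ≤ 2 ^ J := by exact_mod_cast hy
        have : (0 : ℝ) ≤ x := Nat.cast_nonneg x
        linarith
      have hyx0 : (0 : ℝ) ≤ (y : ℝ) - x := sub_nonneg.2 (by exact_mod_cast hxy)
      calc ((y : ℝ) - x) * (P.real (X 0 ⁻¹' box w') - P.real (X 0 ⁻¹' box (fl u)))
          ≤ ((y : ℝ) - x) * (Fintype.card κ * (1 / 2 ^ J)) :=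
            mul_le_mul_of_nonneg_left hsub hyx0
        _ ≤ 2 ^ J * (Fintype.card κ * (1 / 2 ^ J)) := by gcongr
        _ = Fintype.card κ := by field_simp
  intro u hu
  have hTω := hT0 ω
  have hdT : T ω ≤ Fintype.card κ * T ω := le_mul_of_one_le_left hTω hd
  refine ⟨fun hyx => ?_, fun hK v hv huv => ?_⟩
  · have h1 := (hTb ω x y hxy hy (fl u) (hfl1 u hu)).1 hyx
    have h2 := disc u hu
    have h3 := abs_sub_abs_le_abs_sub (centeredCount P X (lowerOrthant G u) x y ω)
      (centeredCount P X (box (fl u)) x y ω)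
    have h4 : |centeredCount P X (box (fl u)) x y ω| ≤ T ω := h1
    nlinarith
  · have h1 := (hTb ω x y hxy hy (fl u) (hfl1 u hu)).2 (fl v) (hfl1 v hv)
      (fun k => floor_le_floor_add_two_pow hK (by rw [abs_sub_comm]; exact huv k))
      fun k => floor_le_floor_add_two_pow hK (huv k)
    have h2 := disc u hu
    have h3 := disc v hv
    rw [abs_sub_comm] at h3
    have h4 : |centeredCount P X (box (fl u)) x y ω - centeredCount P X (box (fl v)) x y ω| ≤
      Fintype.card κ * T ω := h1
    have h5 := abs_sub_le (centeredCount P X (lowerOrthant G u) x y ω)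
      (centeredCount P X (box (fl u)) x y ω) (centeredCount P X (lowerOrthant G v) x y ω)
    have h6 := abs_sub_le (centeredCount P X (box (fl u)) x y ω)
      (centeredCount P X (box (fl v)) x y ω) (centeredCount P X (lowerOrthant G v) x y ω)
    nlinarith

section Events

variable {Ω E κ : Type*} [MeasurableSpace Ω] [MeasurableSpace E] [Fintype κ] [Nonempty κ]
  {P : Measure Ω} [IsProbabilityMeasure P] {X : ℤ → Ω → E} {K a : ℝ} {G : κ → E → ℝ}

theorem exists_lowerOrthant_event (hX : IsMixing P X K a) (ha : 1 < a)
    (hU : UniformMargins P (X 0) G) :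
    ∃ (B ρ : ℝ) (r : ℕ → ℝ), 0 ≤ B ∧ 0 < ρ ∧ ρ < 1 ∧ Tendsto r atTop (nhds 0) ∧
      ∀ (K : ℕ) (c : ℝ), 0 < c → ∀ᶠ n : ℕ in atTop, ∃ S : Set Ω,
        P.real S ≤ B * (ρ ^ K + r n) / c ∧
        ∀ ω ∉ S, ∀ x y : ℕ, x ≤ y → y ≤ n + 1 → ∀ u : κ → ℝ, (∀ k, u k ≤ 1) →
          ((y : ℝ) - x ≤ (2 : ℝ)⁻¹ ^ K * n →
            |centeredCount P X (lowerOrthant G u) x y ω| ≤ c * √n) ∧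
          ∀ v : κ → ℝ, (∀ k, v k ≤ 1) → (∀ k, |u k - v k| ≤ (2 : ℝ)⁻¹ ^ (K + 1)) →
            |centeredCount P X (lowerOrthant G u) x y ω -
              centeredCount P X (lowerOrthant G v) x y ω| ≤ c * √n := by
  obtain ⟨B, ρ, r, hB, hρ0, hρ1, hr, hT⟩ := exists_lowerOrthant_bound hX ha hU
  set d : ℝ := (Fintype.card κ : ℝ) with hd
  have hd1 : (1 : ℝ) ≤ d := by
    rw [hd]
    exact_mod_cast Fintype.card_pos (α := κ)
  have hlog : Tendsto (fun n : ℕ => Nat.log 2 n + 1) atTop atTop := by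
    refine tendsto_atTop.2 fun b => ?_
    filter_upwards [eventually_ge_atTop (2 ^ b)] with n hn
    exact (Nat.le_log_of_pow_le (by norm_num) hn).trans (Nat.le_succ _)
  refine ⟨B * 2 * (6 * d), ρ, fun n => |r (Nat.log 2 n + 1)|, by positivity, hρ0, hρ1,
    by simpa using (hr.comp hlog).abs, fun K c hc => ?_⟩
  have hsqrt : Tendsto (fun n : ℕ => √(n : ℝ)) atTop atTop :=
    Real.tendsto_sqrt_atTop.comp tendsto_natCast_atTop_atTop
  filter_upwards [hlog.eventually_ge_atTop (K + 1), eventually_ge_atTop 1,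
    hsqrt.eventually_ge_atTop (6 * d / c)] with n hnK hn1 hnc
  set J := Nat.log 2 n + 1
  obtain ⟨T, hT0, hTi, hTe, hTb⟩ := hT J K (by omega)
  have hn0 : (0 : ℝ) < n := by exact_mod_cast hn1
  have hs0 : 0 < √(n : ℝ) := Real.sqrt_pos.2 hn0
  set c0 := c / (6 * d) with hc0
  have hc0p : 0 < c0 := by positivity
  have h1c : 1 ≤ c0 * √(n : ℝ) := by
    rw [hc0, div_mul_eq_mul_div, one_le_div (by positivity)]
    rw [div_le_iff₀ hc] at hnc
    linarith
  have hnJ : n < 2 ^ J := Nat.lt_pow_succ_log_self (by norm_num) n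
  have hJn : 2 ^ J ≤ 2 * n := by
    have := Nat.pow_log_le_self 2 (x := n) (by omega)
    rw [pow_succ]
    omega
  refine ⟨{ω | c0 * √n ≤ T ω}, ?_, fun ω hω x y hxy hy u hu => ?_⟩
  · have h1 := mul_meas_ge_le_integral_of_nonneg (Eventually.of_forall hT0) hTi (c0 * √n)
    have h2 := h1.trans hTe
    have h3 : √(2 ^ J) ≤ 2 * √(n : ℝ) := by
      rw [Real.sqrt_le_left (by positivity), mul_pow, Real.sq_sqrt hn0.le]
      have : (2 : ℝ) ^ J ≤ 2 * n := by exact_mod_cast hJn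
      linarith
    have h5 : B * √(2 ^ J) * (ρ ^ K + r J) ≤ B * (2 * √(n : ℝ)) * (ρ ^ K + |r J|) :=
      (mul_le_mul_of_nonneg_left (add_le_add le_rfl (le_abs_self _)) (by positivity)).trans
        (by gcongr)
    have h6 : c0 * √n * P.real {ω | c0 * √n ≤ T ω} ≤ B * (2 * √(n : ℝ)) * (ρ ^ K + |r J|) :=
      h2.trans h5
    rw [le_div_iff₀ hc]
    have h7 : c = c0 * (6 * d) := by rw [hc0]; field_simp
    rw [h7]
    have h8 : c0 * P.real {ω | c0 * √n ≤ T ω} ≤ B * 2 * (ρ ^ K + |r J|) := by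
      refine le_of_mul_le_mul_left ?_ hs0
      linarith
    have h9 := mul_le_mul_of_nonneg_right h8 (show 0 ≤ 6 * d by positivity)
    linarith
  · have hω' : T ω < c0 * √n := not_le.1 hω
    have hfin : 3 * d * (T ω + 1) ≤ c * √n := by
      have h7 : c = c0 * (6 * d) := by rw [hc0]; field_simp
      have h8 : T ω + 1 ≤ 2 * (c0 * √n) := by linarith
      have h9 := mul_le_mul_of_nonneg_left h8 (show 0 ≤ 3 * d by positivity)
      rw [h7]
      linarith
    obtain ⟨b1, b2⟩ := hTb ω x y hxy (hy.trans hnJ) u hu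
    refine ⟨fun hyx => (b1 ?_).trans hfin, fun v hv huv => (b2 (by omega) v hv huv).trans hfin⟩
    have h1 : (2 : ℝ)⁻¹ ^ K * n ≤ 2 ^ (J - K) := by
      have h2 : (n : ℝ) ≤ 2 ^ J := by exact_mod_cast hnJ.le
      have h3 : (2 : ℝ) ^ J = 2 ^ (J - K) * 2 ^ K := by rw [← pow_add]; congr 1; omega
      rw [inv_pow, inv_mul_le_iff₀ (by positivity), mul_comm, ← h3]
      exact h2
    have h4 : (y : ℝ) ≤ (x + 2 ^ (J - K) : ℕ) := by
      push_cast
      linarith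
    exact_mod_cast h4

theorem exists_modulus_event (hX : IsMixing P X K a) (ha : 1 < a)
    (hU : UniformMargins P (X 0) G) {ε η : ℝ} (hε : 0 < ε) (hη : 0 < η) :
    ∃ δ : ℝ, 0 < δ ∧ ∀ᶠ n : ℕ in atTop, ∃ S : Set Ω, P.real S ≤ η ∧
      ∀ ω ∉ S, ∀ x y : ℕ, x ≤ y → y ≤ n + 1 → ∀ u : κ → ℝ, (∀ k, u k ≤ 1) →
        ((y : ℝ) - x ≤ δ * n → |centeredCount P X (lowerOrthant G u) x y ω| ≤ ε * √n) ∧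
        ∀ v : κ → ℝ, (∀ k, v k ≤ 1) → (∀ k, |u k - v k| ≤ δ) →
          |centeredCount P X (lowerOrthant G u) x y ω -
            centeredCount P X (lowerOrthant G v) x y ω| ≤ ε * √n := by
  obtain ⟨B, ρ, r, hB, hρ0, hρ1, hr, h⟩ := exists_lowerOrthant_event hX ha hU
  have h1 : Tendsto (fun K : ℕ => B * (ρ ^ K + 0) / ε) atTop (nhds 0) := by
    simpa using (((tendsto_pow_atTop_nhds_zero_of_lt_one hρ0.le hρ1).add_const 0).const_mul
      B).div_const ε
  obtain ⟨K, hK⟩ := (h1.eventually_lt_const hη).exists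
  have h2 : Tendsto (fun n : ℕ => B * (ρ ^ K + r n) / ε) atTop (nhds (B * (ρ ^ K + 0) / ε)) :=
    ((hr.const_add _).const_mul B).div_const ε
  refine ⟨(2 : ℝ)⁻¹ ^ (K + 1), by positivity, ?_⟩
  filter_upwards [h2.eventually_lt_const hK, h K ε hε] with n hn ⟨S, hS, hS'⟩
  refine ⟨S, hS.trans hn.le, fun ω hω x y hxy hy u hu => ?_⟩
  obtain ⟨b1, b2⟩ := hS' ω hω x y hxy hy u hu
  refine ⟨fun hyx => b1 (hyx.trans ?_), b2⟩
  gcongr ?_ * _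
  exact pow_le_pow_of_le_one (by norm_num) (by norm_num) (Nat.le_succ K)

theorem exists_bound_event (hX : IsMixing P X K a) (ha : 1 < a)
    (hU : UniformMargins P (X 0) G) {η : ℝ} (hη : 0 < η) :
    ∃ M : ℝ, 0 < M ∧ ∀ᶠ n : ℕ in atTop, ∃ S : Set Ω, P.real S ≤ η ∧
      ∀ ω ∉ S, ∀ x y : ℕ, x ≤ y → y ≤ x + n → y ≤ n + 1 → ∀ u : κ → ℝ, (∀ k, u k ≤ 1) →
        |centeredCount P X (lowerOrthant G u) x y ω| ≤ M * √n := by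
  obtain ⟨B, ρ, r, hB, hρ0, hρ1, hr, h⟩ := exists_lowerOrthant_event hX ha hU
  have h1 : Tendsto (fun M : ℝ => B * (ρ ^ 0 + 1) / M) atTop (nhds 0) :=
    tendsto_const_nhds.div_atTop tendsto_id
  obtain ⟨M, hM, hM0⟩ := ((h1.eventually_lt_const hη).and (eventually_gt_atTop 0)).exists
  refine ⟨M, hM0, ?_⟩
  filter_upwards [hr.eventually_lt_const zero_lt_one, h 0 M hM0] with n hn ⟨S, hS, hS'⟩
  refine ⟨S, hS.trans (le_trans ?_ hM.le), fun ω hω x y hxy hyx hy u hu => ?_⟩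
  · gcongr
  · refine (hS' ω hω x y hxy hy u hu).1 ?_
    have : (y : ℝ) ≤ x + n := by exact_mod_cast hyx
    rw [pow_zero, one_mul]
    linarith

end Events

theorem exists_threshold_of_rank {ι : Type*} (I : Finset ι) {x U : ι → ℝ}
    (hxU : ∀ s t, x s ≤ x t → U s ≤ U t) (hU : ∀ t, U t ∈ Icc (0 : ℝ) 1) {τ c : ℝ}
    (hτ0 : 0 ≤ τ) (hτ : ∀ z, ((I.filter fun t => U t = z).card : ℝ) ≤ τ) (hc0 : 0 ≤ c)
    (hcN : c ≤ I.card) :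
    ∃ v ∈ Icc (0 : ℝ) 1,
      (∀ i ∈ I, U i < v → ((I.filter fun t => x t ≤ x i).card : ℝ) ≤ c) ∧
      (∀ i ∈ I, ((I.filter fun t => x t ≤ x i).card : ℝ) ≤ c → U i ≤ v) ∧
      |((I.filter fun i => U i ≤ v).card : ℝ) - c| ≤ 2 * τ := by
  classical
  set R := I.filter fun i => ((I.filter fun t => x t ≤ x i).card : ℝ) ≤ c with hR
  have hlower : ∀ i ∈ R, ∀ t ∈ I, x t ≤ x i → t ∈ R := by
    intro i hi t ht hti
    refine Finset.mem_filter.2 ⟨ht, le_trans ?_ (Finset.mem_filter.1 hi).2⟩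
    exact_mod_cast Finset.card_le_card
      (Finset.monotone_filter_right I fun s _ hs => le_trans hs hti)
  have hRc : (R.card : ℝ) ≤ c := by
    rcases R.eq_empty_or_nonempty with h | h
    · simpa [h] using hc0
    · obtain ⟨i, hi, hmax⟩ := R.exists_max_image x h
      refine le_trans ?_ (Finset.mem_filter.1 hi).2
      exact_mod_cast Finset.card_le_card fun t ht =>
        Finset.mem_filter.2 ⟨(Finset.mem_filter.1 ht).1, hmax t ht⟩
  have hcR : c ≤ R.card + τ := by
    rcases (I \ R).eq_empty_or_nonempty with h | h
    · have : I.card ≤ R.card := Finset.card_le_card (Finset.sdiff_eq_empty_iff_subset.1 h)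
      have : (I.card : ℝ) ≤ R.card := by exact_mod_cast this
      linarith
    · obtain ⟨i, hi, hmin⟩ := (I \ R).exists_min_image x h
      rw [Finset.mem_sdiff] at hi
      have h1 : c < ((I.filter fun t => x t ≤ x i).card : ℝ) := by
        by_contra! hcon
        exact hi.2 (Finset.mem_filter.2 ⟨hi.1, hcon⟩)
      have h2 : (I.filter fun t => x t ≤ x i) ⊆ R ∪ I.filter fun t => U t = U i := by
        intro t ht
        rw [Finset.mem_filter] at ht
        by_cases hmem : t ∈ R
        · exact Finset.mem_union_left _ hmem
        · refine Finset.mem_union_right _ (Finset.mem_filter.2 ⟨ht.1, ?_⟩)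
          have := hmin t (Finset.mem_sdiff.2 ⟨ht.1, hmem⟩)
          exact le_antisymm (hxU _ _ ht.2) (hxU _ _ this)
      have h3 : ((I.filter fun t => x t ≤ x i).card : ℝ) ≤
          R.card + (I.filter fun t => U t = U i).card := by
        exact_mod_cast (Finset.card_le_card h2).trans (Finset.card_union_le _ _)
      linarith [hτ (U i)]
  obtain ⟨v, hv, hv1, hv2⟩ : ∃ v ∈ Icc (0 : ℝ) 1, (∀ i ∈ I, U i < v → i ∈ R) ∧
      ∀ i ∈ R, U i ≤ v := by
    rcases R.eq_empty_or_nonempty with h | h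
    · exact ⟨0, by simp, fun i _ hi => absurd hi (hU i).1.not_gt, by simp [h]⟩
    · obtain ⟨i, hi, hmax⟩ := R.exists_max_image U h
      refine ⟨U i, hU i, fun t ht htU => hlower i hi t ht ?_, hmax⟩
      by_contra! hcon
      exact htU.not_ge (hxU _ _ hcon.le)
  refine ⟨v, hv, fun i hi hiv => (Finset.mem_filter.1 (hv1 i hi hiv)).2,
    fun i hi hic => hv2 i (Finset.mem_filter.2 ⟨hi, hic⟩), ?_⟩
  have h1 : (R.card : ℝ) ≤ (I.filter fun i => U i ≤ v).card := by
    exact_mod_cast Finset.card_le_card fun i hi =>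
      Finset.mem_filter.2 ⟨(Finset.mem_filter.1 hi).1, hv2 i hi⟩
  have h2 : ((I.filter fun i => U i ≤ v).card : ℝ) ≤ R.card + (I.filter fun t => U t = v).card := by
    refine mod_cast (Finset.card_le_card fun i hi => ?_).trans (Finset.card_union_le _ _)
    rw [Finset.mem_filter] at hi
    rcases hi.2.lt_or_eq with h | h
    · exact Finset.mem_union_left _ (hv1 i hi.1 h)
    · exact Finset.mem_union_right _ (Finset.mem_filter.2 ⟨hi.1, h⟩)
  have h3 := hτ v
  rw [abs_le]
  constructor <;> linarith

theorem exists_thresholds_of_ranks {ι κ : Type*} [Fintype κ] (I : Finset ι) {x U : ι → κ → ℝ}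
    (hxU : ∀ j s t, x s j ≤ x t j → U s j ≤ U t j) (hU : ∀ t j, U t j ∈ Icc (0 : ℝ) 1) {τ : ℝ}
    (hτ0 : 0 ≤ τ) (hτ : ∀ j z, ((I.filter fun t => U t j = z).card : ℝ) ≤ τ) {u : κ → ℝ}
    (hu : ∀ j, u j ∈ Icc (0 : ℝ) 1) :
    ∃ v : κ → ℝ, (∀ j, v j ∈ Icc (0 : ℝ) 1) ∧
      |∑ i ∈ I, (if ∀ j, ((I.filter fun t => x t j ≤ x i j).card : ℝ) ≤ I.card * u j
          then (1 : ℝ) else 0) - ∑ i ∈ I, (if ∀ j, U i j ≤ v j then (1 : ℝ) else 0)| ≤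
        Fintype.card κ * τ ∧
      ∀ j, |∑ i ∈ I, (if U i j ≤ v j then (1 : ℝ) else 0) - I.card * u j| ≤ 2 * τ := by
  classical
  have h := fun j => exists_threshold_of_rank I (x := fun t => x t j) (U := fun t => U t j)
    (c := I.card * u j) (hxU j) (fun t => hU t j) hτ0 (hτ j)
    (mul_nonneg (Nat.cast_nonneg _) (hu j).1)
    (mul_le_of_le_one_right (Nat.cast_nonneg _) (hu j).2)
  choose v hv h1 h2 h3 using h
  refine ⟨v, hv, ?_, fun j => ?_⟩
  · set A := I.filter fun i => ∀ j, ((I.filter fun t => x t j ≤ x i j).card : ℝ) ≤ I.card * u j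
    set B := I.filter fun i => ∀ j, U i j ≤ v j
    have eA : ∑ i ∈ I, (if ∀ j, ((I.filter fun t => x t j ≤ x i j).card : ℝ) ≤ I.card * u j
          then (1 : ℝ) else 0) = A.card := by
      rw [Finset.sum_boole]
    have eB : ∑ i ∈ I, (if ∀ j, U i j ≤ v j then (1 : ℝ) else 0) = B.card := by
      rw [Finset.sum_boole]
    have hAB : A ⊆ B := fun i hi => by
      rw [Finset.mem_filter] at hi ⊢
      exact ⟨hi.1, fun j => h2 j i hi.1 (hi.2 j)⟩
    have hBA : B ⊆ A ∪ Finset.univ.biUnion fun j => I.filter fun t => U t j = v j := by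
      intro i hi
      rw [Finset.mem_filter] at hi
      by_cases hlt : ∀ j, U i j < v j
      · exact Finset.mem_union_left _ (Finset.mem_filter.2 ⟨hi.1, fun j => h1 j i hi.1 (hlt j)⟩)
      · push Not at hlt
        obtain ⟨j, hj⟩ := hlt
        exact Finset.mem_union_right _ (Finset.mem_biUnion.2 ⟨j, Finset.mem_univ _,
          Finset.mem_filter.2 ⟨hi.1, le_antisymm (hi.2 j) hj⟩⟩)
    have c1 : (A.card : ℝ) ≤ B.card := by exact_mod_cast Finset.card_le_card hAB
    have c2 : (B.card : ℝ) ≤ A.card + ∑ j, ((I.filter fun t => U t j = v j).card : ℝ) := by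
      exact_mod_cast (Finset.card_le_card hBA).trans ((Finset.card_union_le _ _).trans
        (Nat.add_le_add_left Finset.card_biUnion_le _))
    have c3 : ∑ j, ((I.filter fun t => U t j = v j).card : ℝ) ≤ Fintype.card κ * τ := by
      refine (Finset.sum_le_sum fun j _ => hτ j (v j)).trans ?_
      simp
    rw [eA, eB, abs_le]
    constructor <;> linarith
  · rw [Finset.sum_boole]
    exact h3 j

theorem abs_sub_sub_sum_le_of_update {κ : Type*} [Fintype κ] [DecidableEq κ] {f : (κ → ℝ) → ℝ}
    {u v g : κ → ℝ} {c : ℝ}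
    (h : ∀ j q, (∀ k, q k = u k ∨ q k = v k) → q j = u j →
      |f (Function.update q j (v j)) - f q - g j| ≤ c) :
    |f v - f u - ∑ j, g j| ≤ Fintype.card κ * c := by
  have key : ∀ s : Finset κ, |f (s.piecewise v u) - f u - ∑ j ∈ s, g j| ≤ s.card * c := by
    intro s
    induction s using Finset.induction_on with
    | empty => simp
    | insert j s hj ih =>
      have h1 := h j (s.piecewise v u) (fun k => by
        by_cases hk : k ∈ s <;> simp [hk]) (by simp [hj])
      rw [Finset.piecewise_insert, Finset.sum_insert hj, Finset.card_insert_of_notMem hj]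
      rw [abs_le] at *
      push_cast
      constructor <;> linarith
  simpa using key Finset.univ

theorem abs_update_sub_sub_le {κ : Type*} [DecidableEq κ] {C Cd : (κ → ℝ) → ℝ}
    {q : κ → ℝ} {j : κ} {t l c : ℝ}
    (hder : ∀ s ∈ uIcc (q j) t,
      HasDerivAt (fun r => C (Function.update q j r)) (Cd (Function.update q j s)) s)
    (hcl : ∀ s ∈ uIcc (q j) t, |Cd (Function.update q j s) - l| ≤ c) :
    |C (Function.update q j t) - C q - l * (t - q j)| ≤ c * |t - q j| := by
  have h := (convex_uIcc (q j) t).norm_image_sub_le_of_norm_hasDerivWithin_le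
    (f := fun r => C (Function.update q j r) - l * r)
    (f' := fun s => Cd (Function.update q j s) - l) (C := c)
    (fun s hs => ((hder s hs).sub (by simpa using (hasDerivAt_id s).const_mul l)).hasDerivWithinAt)
    hcl left_mem_uIcc right_mem_uIcc
  simp only [Function.update_eq_self, Real.norm_eq_abs] at h
  convert h using 2
  ring

/-- Uniform first-order expansion in the `j`-th variable, away from its end points. -/
theorem exists_uniform_expansion {κ : Type*} [Fintype κ] [DecidableEq κ] {C Cd : (κ → ℝ) → ℝ}
    {j : κ}
    (hder : ∀ u : κ → ℝ, (∀ k, u k ∈ Icc (0 : ℝ) 1) → 0 < u j → u j < 1 →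
      HasDerivAt (fun t => C (Function.update u j t)) (Cd u) (u j))
    (hcont : ContinuousOn Cd {u : κ → ℝ | (∀ k, u k ∈ Icc (0 : ℝ) 1) ∧ 0 < u j ∧ u j < 1})
    {η c : ℝ} (hη : 0 < η) (hc : 0 < c) :
    ∃ δ, 0 < δ ∧ ∀ u q : κ → ℝ, (∀ k, u k ∈ Icc (0 : ℝ) 1) → (∀ k, q k ∈ Icc (0 : ℝ) 1) →
      u j ∈ Icc η (1 - η) → q j = u j → (∀ k, |q k - u k| ≤ δ) → ∀ t, |t - u j| ≤ δ →
      |C (Function.update q j t) - C q - Cd u * (t - u j)| ≤ c * |t - u j| := by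
  set S : Set (κ → ℝ) := (Set.univ.pi fun _ => Icc (0 : ℝ) 1) ∩
    (fun u : κ → ℝ => u j) ⁻¹' Icc (η / 2) (1 - η / 2)
  have hS : IsCompact S := (isCompact_univ_pi fun _ => isCompact_Icc).inter_right
    (isClosed_Icc.preimage (continuous_apply j))
  have hu := hS.uniformContinuousOn_of_continuous (hcont.mono fun u hu =>
    ⟨fun k => hu.1 k (mem_univ k), by linarith [hu.2.1], by linarith [hu.2.2]⟩)
  rw [Metric.uniformContinuousOn_iff] at hu
  obtain ⟨δ, hδ, H⟩ := hu c hc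
  refine ⟨min (δ / 2) (η / 2), by positivity, fun u q hu hq huj hqj hqu t ht => ?_⟩
  have h1 : ∀ s ∈ uIcc (q j) t, |s - u j| ≤ min (δ / 2) (η / 2) := by
    intro s hs
    refine le_trans ?_ ht
    rw [← hqj]
    exact abs_sub_left_of_mem_uIcc hs
  have h2 : ∀ s ∈ uIcc (q j) t, s ∈ Icc (η / 2) (1 - η / 2) := by
    intro s hs
    have := (h1 s hs).trans (min_le_right _ _)
    rw [abs_le] at this
    exact ⟨by linarith [huj.1], by linarith [huj.2]⟩
  have h3 : ∀ s ∈ uIcc (q j) t, ∀ k, Function.update q j s k ∈ Icc (0 : ℝ) 1 := by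
    intro s hs k
    rcases eq_or_ne k j with rfl | hk
    · rw [Function.update_self]
      exact ⟨by linarith [(h2 s hs).1], by linarith [(h2 s hs).2]⟩
    · rw [Function.update_of_ne hk]
      exact hq k
  rw [← hqj]
  refine abs_update_sub_sub_le (Cd := Cd) (fun s hs => ?_) fun s hs => ?_
  · have := hder (Function.update q j s) (h3 s hs)
      (by rw [Function.update_self]; linarith [(h2 s hs).1])
      (by rw [Function.update_self]; linarith [(h2 s hs).2])
    simpa using this
  · refine (H _ ⟨fun k _ => h3 s hs k, by simpa using h2 s hs⟩ u
      ⟨fun k _ => hu k, ?_⟩ ?_).le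
    · exact ⟨by linarith [huj.1], by linarith [huj.2]⟩
    · refine ((dist_pi_le_iff (by positivity)).2 fun k => ?_).trans_lt (half_lt_self hδ)
      rw [Real.dist_eq]
      rcases eq_or_ne k j with rfl | hk
      · rw [Function.update_self]
        exact (h1 s hs).trans (min_le_left _ _)
      · rw [Function.update_of_ne hk]
        exact (hqu k).trans (min_le_left _ _)

section JointCdf

variable {Ω E κ : Type*} [MeasurableSpace Ω] [MeasurableSpace E] {P : Measure Ω}
  {Y : Ω → E} {G : κ → E → ℝ}

theorem UniformMargins.measureReal_lowerOrthant_single [DecidableEq κ]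
    (hU : UniformMargins P Y G) (j : κ) {t : ℝ} (ht : t ∈ Icc (0 : ℝ) 1) :
    P.real (Y ⁻¹' lowerOrthant G (Function.update (fun _ => 1) j t)) = t := by
  refine Eq.trans (congrArg (fun A => P.real (Y ⁻¹' A)) ?_) (hU.law j t ht)
  ext x
  refine ⟨fun h => by simpa using h j, fun h k => ?_⟩
  rcases eq_or_ne k j with rfl | hk
  · simpa using h
  · simpa [hk] using (hU.mem_Icc k x).2

theorem UniformMargins.abs_measureReal_lowerOrthant_update_sub_le [IsProbabilityMeasure P]
    [DecidableEq κ] [Finite κ] (hU : UniformMargins P Y G) (hY : Measurable Y) (j : κ)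
    {q : κ → ℝ} {t : ℝ} (hq : q j ∈ Icc (0 : ℝ) 1) (ht : t ∈ Icc (0 : ℝ) 1) :
    |P.real (Y ⁻¹' lowerOrthant G (Function.update q j t)) - P.real (Y ⁻¹' lowerOrthant G q)| ≤
      |t - q j| := by
  have key : ∀ (q : κ → ℝ) (t : ℝ), q j ∈ Icc (0 : ℝ) 1 → t ∈ Icc (0 : ℝ) 1 → q j ≤ t →
      P.real (Y ⁻¹' lowerOrthant G q) ≤
        P.real (Y ⁻¹' lowerOrthant G (Function.update q j t)) ∧
      P.real (Y ⁻¹' lowerOrthant G (Function.update q j t)) ≤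
        P.real (Y ⁻¹' lowerOrthant G q) + (t - q j) := by
    intro q t hq ht hqt
    have hm : ∀ s, MeasurableSet (Y ⁻¹' {x | G j x ≤ s}) := fun s =>
      hY (measurableSet_le (hU.meas j) measurable_const)
    refine ⟨measureReal_mono fun ω hω k => ?_, ?_⟩
    · rcases eq_or_ne k j with rfl | hk
      · rw [Function.update_self]
        exact (hω k).trans hqt
      · rw [Function.update_of_ne hk]
        exact hω k
    · have hsub : Y ⁻¹' {x | G j x ≤ q j} ⊆ Y ⁻¹' {x | G j x ≤ t} := fun ω hω => le_trans hω hqt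
      have h1 : P.real (Y ⁻¹' {x | G j x ≤ t} \ Y ⁻¹' {x | G j x ≤ q j}) = t - q j := by
        rw [measureReal_sdiff hsub (hm _), hU.law j t ht,
          hU.law j _ hq]
      rw [← h1]
      refine (measureReal_mono fun ω hω => ?_).trans (measureReal_union_le _ _)
      by_cases hqj : G j (Y ω) ≤ q j
      · refine Or.inl fun k => ?_
        rcases eq_or_ne k j with rfl | hk
        · exact hqj
        · simpa [hk] using hω k
      · exact Or.inr ⟨by simpa using hω j, hqj⟩
  rcases le_total (q j) t with h | h
  · have := key q t hq ht h
    rw [abs_of_nonneg (by linarith), abs_of_nonneg (by linarith)]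
    linarith
  · have := key (Function.update q j t) (q j) (by simpa using ht) hq (by simpa using h)
    simp only [Function.update_idem, Function.update_eq_self, Function.update_self] at this
    rw [abs_of_nonpos (by linarith), abs_of_nonpos (by linarith)]
    linarith

end JointCdf

theorem abs_hasDerivAt_le_one_of_update {κ : Type*} [DecidableEq κ] {C : (κ → ℝ) → ℝ} {j : κ}
    {u : κ → ℝ} {l : ℝ} (hl : HasDerivAt (fun t => C (Function.update u j t)) l (u j))
    (h0 : 0 < u j) (h1 : u j < 1)
    (hC : ∀ t ∈ Icc (0 : ℝ) 1, |C (Function.update u j t) - C u| ≤ |t - u j|) : |l| ≤ 1 := by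
  have := hl.le_of_lip' (C := 1) zero_le_one (by
    filter_upwards [Icc_mem_nhds h0 h1] with t ht
    simpa using hC t ht)
  simpa using this

section CenteredCount

variable {Ω E κ : Type*} [MeasurableSpace Ω] {P : Measure Ω}
  {X : ℤ → Ω → E} {G : κ → E → ℝ}

theorem centeredCount_lowerOrthant_eq [Fintype κ] (u : κ → ℝ) {x y : ℕ} (hxy : x ≤ y) (ω : Ω) :
    centeredCount P X (lowerOrthant G u) x y ω =
      ∑ i ∈ Finset.Ico x y, (if ∀ k, G k (X i ω) ≤ u k then (1 : ℝ) else 0) -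
        (y - x) * P.real (X 0 ⁻¹' lowerOrthant G u) := by
  rw [centeredCount, Finset.sum_sub_distrib]
  simp [Nat.cast_sub hxy, indicator_apply, lowerOrthant]

theorem centeredCount_lowerOrthant_single_eq [MeasurableSpace E] [Fintype κ] [DecidableEq κ]
    (hU : UniformMargins P (X 0) G) (j : κ) {t : ℝ} (ht : t ∈ Icc (0 : ℝ) 1) {x y : ℕ}
    (hxy : x ≤ y) (ω : Ω) :
    centeredCount P X (lowerOrthant G (Function.update (fun _ => 1) j t)) x y ω =
      ∑ i ∈ Finset.Ico x y, (if G j (X i ω) ≤ t then (1 : ℝ) else 0) - (y - x) * t := by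
  rw [centeredCount_lowerOrthant_eq _ hxy, hU.measureReal_lowerOrthant_single j ht]
  congr 1
  refine Finset.sum_congr rfl fun i _ => if_congr ⟨fun h => by simpa using h j, fun h k => ?_⟩ rfl rfl
  rcases eq_or_ne k j with rfl | hk
  · simpa using h
  · simpa [hk] using (hU.mem_Icc k (X i ω)).2

theorem centeredCount_lowerOrthant_eq_zero_of_neg [MeasurableSpace E]
    (hU : UniformMargins P (X 0) G) {u : κ → ℝ} {j : κ} (hu : u j < 0) (x y : ℕ) (ω : Ω) :
    centeredCount P X (lowerOrthant G u) x y ω = 0 := by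
  have : lowerOrthant G u = ∅ := eq_empty_of_forall_notMem fun z hz =>
    ((hU.mem_Icc j z).1.trans (hz j)).not_gt hu
  simp [this, centeredCount]

theorem centeredCount_lowerOrthant_one [MeasurableSpace E] [IsProbabilityMeasure P]
    (hU : UniformMargins P (X 0) G) (x y : ℕ) (ω : Ω) :
    centeredCount P X (lowerOrthant G fun _ => 1) x y ω = 0 := by
  have : lowerOrthant G (fun _ => 1) = univ := eq_univ_of_forall fun z k => (hU.mem_Icc k z).2
  simp [this, centeredCount]

end CenteredCount

section Ranks

variable {Ω E κ : Type*} [MeasurableSpace Ω] [MeasurableSpace E] {P : Measure Ω}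
  {X : ℤ → Ω → E} {G : κ → E → ℝ}

theorem UniformMargins.card_filter_eq_le [Fintype κ] [DecidableEq κ]
    (hU : UniformMargins P (X 0) G) {x y n : ℕ} (hxy : x ≤ y) (hyn : y ≤ x + n) {ω : Ω}
    {δ e : ℝ} (hδ : 0 < δ) (he : 0 ≤ e)
    (hmod : ∀ u v : κ → ℝ, (∀ k, u k ≤ 1) → (∀ k, v k ≤ 1) → (∀ k, |u k - v k| ≤ δ) →
      |centeredCount P X (lowerOrthant G u) x y ω -
        centeredCount P X (lowerOrthant G v) x y ω| ≤ e) (j : κ) (z : ℝ) :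
    (((Finset.Ico x y).filter fun i : ℕ => G j (X i ω) = z).card : ℝ) ≤ e + 1 := by
  by_cases hz : z ∈ Icc (0 : ℝ) 1
  swap
  · have : ∀ i ∈ Finset.Ico x y, G j (X i ω) ≠ z := fun i _ h => hz (h ▸ hU.mem_Icc j _)
    rw [Finset.filter_eq_empty_iff.2 fun i hi => this i hi]
    simpa using by linarith
  have hN0 : (0 : ℝ) ≤ y - x := sub_nonneg.2 (by exact_mod_cast hxy)
  have hNn : (y : ℝ) - x ≤ n := by
    rw [sub_le_iff_le_add']
    exact_mod_cast hyn
  set s : ℝ := min δ (1 / (n + 1)) with hs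
  have hs0 : 0 < s := by positivity
  have hNs : ((y : ℝ) - x) * s ≤ 1 := by
    calc ((y : ℝ) - x) * s ≤ (n + 1) * (1 / (n + 1)) :=
          mul_le_mul (by linarith) (min_le_right _ _) hs0.le (by positivity)
      _ = 1 := by field_simp
  have hle : ∀ t : ℝ, t ≤ 1 → ∀ k, Function.update (fun _ : κ => (1 : ℝ)) j t k ≤ 1 := by
    intro t ht k
    rcases eq_or_ne k j with rfl | hk
    · simpa using ht
    · simp [hk]
  have hm := hmod (Function.update (fun _ => 1) j z) (Function.update (fun _ => 1) j (z - s))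
    (hle _ hz.2) (hle _ (by linarith [hz.2])) (fun k => by
      rcases eq_or_ne k j with rfl | hk
      · rw [Function.update_self, Function.update_self, sub_sub_cancel, abs_of_pos hs0]
        exact min_le_left _ _
      · simpa [hk] using hδ.le)
  have hm' := (abs_le.1 hm).2
  rw [centeredCount_lowerOrthant_single_eq hU j hz hxy] at hm'
  rcases lt_or_ge (z - s) 0 with hneg | hpos
  · rw [centeredCount_lowerOrthant_eq_zero_of_neg hU (j := j) (by simpa using hneg)] at hm'
    have h1 : (((Finset.Ico x y).filter fun i : ℕ => G j (X i ω) = z).card : ℝ) ≤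
        ∑ i ∈ Finset.Ico x y, (if G j (X i ω) ≤ z then (1 : ℝ) else 0) := by
      rw [← Finset.sum_boole]
      refine Finset.sum_le_sum fun i _ => ?_
      split_ifs <;> linarith
    have h2 : ((y : ℝ) - x) * z ≤ (y - x) * s := mul_le_mul_of_nonneg_left (by linarith) hN0
    linarith
  · rw [centeredCount_lowerOrthant_single_eq hU j ⟨hpos, by linarith [hz.2]⟩ hxy] at hm'
    have h1 : (((Finset.Ico x y).filter fun i : ℕ => G j (X i ω) = z).card : ℝ) ≤
        ∑ i ∈ Finset.Ico x y, (if G j (X i ω) ≤ z then (1 : ℝ) else 0) -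
        ∑ i ∈ Finset.Ico x y, (if G j (X i ω) ≤ z - s then (1 : ℝ) else 0) := by
      rw [← Finset.sum_boole, ← Finset.sum_sub_distrib]
      refine Finset.sum_le_sum fun i _ => ?_
      split_ifs <;> linarith
    linarith

end Ranks

theorem abs_mul_sub_add_le {N f l w u b b' c e : ℝ} (hN : 0 ≤ N) (hl : |l| ≤ 1)
    (hf : |f - l * (w - u)| ≤ c * |w - u|) (hc : c * (N * |w - u|) ≤ e)
    (hb : |b' + N * (w - u)| ≤ 4 * e) (hbb : |b' - b| ≤ e) : |N * f + l * b| ≤ 6 * e := by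
  have h1 : |N * (f - l * (w - u))| ≤ e := by
    rw [abs_mul, abs_of_nonneg hN]
    refine (mul_le_mul_of_nonneg_left hf hN).trans (le_of_eq_of_le (by ring) hc)
  have h2 : |l * (b' + N * (w - u))| ≤ 4 * e := by
    rw [abs_mul]
    exact (mul_le_of_le_one_left (abs_nonneg _) hl).trans hb
  have h3 : |l * (b' - b)| ≤ e := by
    rw [abs_mul]
    exact (mul_le_of_le_one_left (abs_nonneg _) hl).trans hbb
  rw [abs_le] at *
  constructor <;> linarith

theorem abs_mul_add_le_of_abs_le {N f l b w e : ℝ} (hl : |l| ≤ 1)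
    (hf : |f| ≤ |w|) (hw : |N * w| ≤ 6 * e) (hb : |b| ≤ e) : |N * f + l * b| ≤ 7 * e := by
  have h1 : |N * f| ≤ 6 * e := by
    refine le_trans ?_ hw
    rw [abs_mul, abs_mul]
    exact mul_le_mul_of_nonneg_left hf (abs_nonneg _)
  have h2 : |l * b| ≤ e := by
    rw [abs_mul]
    exact (mul_le_of_le_one_left (abs_nonneg _) hl).trans hb
  rw [abs_le] at *
  constructor <;> linarith

section Ranks

variable {Ω κ : Type*} [MeasurableSpace Ω] {P : Measure Ω} [IsProbabilityMeasure P] [Fintype κ]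
  [DecidableEq κ] {X : ℤ → Ω → κ → ℝ} {G : κ → (κ → ℝ) → ℝ}

theorem UniformMargins.abs_sum_rank_sub_le [Nonempty κ] (hU : UniformMargins P (X 0) G)
    (hX0 : Measurable (X 0))
    (hG : ∀ j, ∀ z w : κ → ℝ, z j ≤ w j → G j z ≤ G j w)
    {Cd : κ → (κ → ℝ) → ℝ}
    (hCd : ∀ j u, (∀ k, u k ∈ Icc (0 : ℝ) 1) → |Cd j u| ≤ 1)
    {δ δ' κ₀ c e : ℝ} (hδ : 0 < δ) (hδ' : 0 < δ') (hδδ : δ' ≤ δ) (hκ : 2 * κ₀ ≤ δ)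
    (hκ0 : 0 < κ₀)
    (hexp : ∀ j, ∀ u q : κ → ℝ, (∀ k, u k ∈ Icc (0 : ℝ) 1) → (∀ k, q k ∈ Icc (0 : ℝ) 1) →
      u j ∈ Icc κ₀ (1 - κ₀) → q j = u j → (∀ k, |q k - u k| ≤ δ') → ∀ t, |t - u j| ≤ δ' →
      |P.real (X 0 ⁻¹' lowerOrthant G (Function.update q j t)) -
        P.real (X 0 ⁻¹' lowerOrthant G q) - Cd j u * (t - u j)| ≤ c * |t - u j|)
    {x y n : ℕ} (hxy : x ≤ y) (hyn : y ≤ x + n) {ω : Ω} (he : 1 ≤ e)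
    (hsmall : (y : ℝ) - x ≤ δ * n → ∀ u : κ → ℝ, (∀ k, u k ≤ 1) →
      |centeredCount P X (lowerOrthant G u) x y ω| ≤ e)
    (hmod : ∀ u v : κ → ℝ, (∀ k, u k ≤ 1) → (∀ k, v k ≤ 1) → (∀ k, |u k - v k| ≤ δ) →
      |centeredCount P X (lowerOrthant G u) x y ω -
        centeredCount P X (lowerOrthant G v) x y ω| ≤ e)
    {M : ℝ} (hM : ∀ u : κ → ℝ, (∀ k, u k ≤ 1) →
      |centeredCount P X (lowerOrthant G u) x y ω| ≤ M)
    (hMn : M + 4 * e ≤ δ * δ' * n) (hcM : c * (M + 4 * e) ≤ e) (hc : 0 ≤ c)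
    {u : κ → ℝ} (hu : ∀ k, u k ∈ Icc (0 : ℝ) 1) :
    |∑ i ∈ Finset.Ico x y, (if ∀ j, (((Finset.Ico x y).filter
        fun t : ℕ => X t ω j ≤ X i ω j).card : ℝ) ≤ (y - x) * u j then (1 : ℝ) else 0) -
      (y - x) * P.real (X 0 ⁻¹' lowerOrthant G u) -
      (centeredCount P X (lowerOrthant G u) x y ω - ∑ j, Cd j u *
        centeredCount P X (lowerOrthant G (Function.update (fun _ => 1) j (u j))) x y ω)| ≤
      11 * Fintype.card κ * e := by
  have hN0 : (0 : ℝ) ≤ y - x := sub_nonneg.2 (by exact_mod_cast hxy)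
  obtain ⟨v, hv, hA, hvu⟩ := exists_thresholds_of_ranks (Finset.Ico x y)
    (x := fun t : ℕ => X t ω) (U := fun t : ℕ => fun j => G j (X t ω))
    (fun j s t h => hG j _ _ h) (fun t j => hU.mem_Icc j _) (τ := 2 * e) (by linarith)
    (fun j z => (hU.card_filter_eq_le hxy hyn hδ (by linarith) hmod j z).trans (by linarith)) hu
  have hcard : ((Finset.Ico x y).card : ℝ) = y - x := by
    rw [Nat.card_Ico, Nat.cast_sub hxy]
  simp only [hcard] at hA hvu
  set N : ℝ := (y : ℝ) - x with hN
  set b : (κ → ℝ) → ℝ := fun w => centeredCount P X (lowerOrthant G w) x y ω with hb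
  set C : (κ → ℝ) → ℝ := fun w => P.real (X 0 ⁻¹' lowerOrthant G w) with hC
  change |_ - N * C u - (b u - ∑ j, Cd j u * b (Function.update (fun _ => 1) j (u j)))| ≤ _
  have hone : ∀ j, ∀ t : ℝ, t ≤ 1 → ∀ k, Function.update (fun _ : κ => (1 : ℝ)) j t k ≤ 1 := by
    intro j t ht k
    rcases eq_or_ne k j with rfl | hk
    · simpa using ht
    · simp [hk]
  have hmod1 : ∀ j, ∀ t t' : ℝ, t ≤ 1 → t' ≤ 1 → |t - t'| ≤ δ →
      |b (Function.update (fun _ => 1) j t) - b (Function.update (fun _ => 1) j t')| ≤ e := by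
    intro j t t' ht ht' h
    refine hmod _ _ (hone j t ht) (hone j t' ht') fun k => ?_
    rcases eq_or_ne k j with rfl | hk
    · simpa using h
    · simpa [hk] using hδ.le
  have hvj : ∀ j, |b (Function.update (fun _ => 1) j (v j)) + N * (v j - u j)| ≤ 4 * e := by
    intro j
    rw [hb]
    dsimp only
    rw [centeredCount_lowerOrthant_single_eq hU j (hv j) hxy]
    convert hvu j using 1
    · congr 1
      ring
    · ring
  have hlip : ∀ j q, (∀ k, q k = u k ∨ q k = v k) → q j = u j →
      |C (Function.update q j (v j)) - C q| ≤ |v j - u j| := by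
    intro j q _ hqj
    have := hU.abs_measureReal_lowerOrthant_update_sub_le hX0 j (q := q) (by rw [hqj]; exact hu j)
      (hv j)
    rwa [hqj] at this
  have hcoord : |b v - b u| ≤ 2 * e ∧ ∀ j q, (∀ k, q k = u k ∨ q k = v k) → q j = u j →
      |N * (C (Function.update q j (v j)) - C q) +
        Cd j u * b (Function.update (fun _ => 1) j (u j))| ≤ 7 * e := by
    rcases le_or_gt N (δ * n) with hs | hs
    · have hs' := hsmall hs
      refine ⟨?_, fun j q hq hqj => ?_⟩
      · have h1 := hs' u fun k => (hu k).2
        have h2 := hs' v fun k => (hv k).2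
        simp only [hb]
        rw [abs_le] at *
        constructor <;> linarith
      · refine abs_mul_add_le_of_abs_le (hCd j u hu) (hlip j q hq hqj) ?_
          (hs' _ (hone j _ (hu j).2))
        have h1 := hvj j
        have h2 := hs' _ (hone j _ (hv j).2)
        change |b _| ≤ e at h2
        rw [abs_le] at *
        constructor <;> linarith
    · have hNv : ∀ j, N * |v j - u j| ≤ M + 4 * e := by
        intro j
        have h0 : |N * (v j - u j)| = N * |v j - u j| := by rw [abs_mul, abs_of_nonneg hN0]
        rw [← h0]
        have h1 := hvj j
        have h2 := hM _ (hone j _ (hv j).2)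
        change |b _| ≤ M at h2
        rw [abs_le] at *
        constructor <;> linarith
      have hN1 : 0 < N := lt_of_le_of_lt (by positivity) hs
      have hclose : ∀ j, |v j - u j| ≤ δ' := by
        intro j
        have h2 : δ * n * δ' ≤ N * δ' := mul_le_mul_of_nonneg_right hs.le hδ'.le
        refine le_of_mul_le_mul_left ?_ hN1
        linarith [hNv j]
      refine ⟨(hmod v u (fun k => (hv k).2) (fun k => (hu k).2)
        fun k => (hclose k).trans hδδ).trans (by linarith), fun j q hq hqj => ?_⟩
      have hbb := hmod1 j _ _ (hv j).2 (hu j).2 ((hclose j).trans hδδ)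
      by_cases huj : u j ∈ Icc κ₀ (1 - κ₀)
      · refine (abs_mul_sub_add_le hN0 (hCd j u hu) (hexp j u q hu (fun k => ?_) huj hqj
          (fun k => ?_) _ (hclose j)) ?_ (hvj j) hbb).trans (by linarith)
        · rcases hq k with h | h <;> rw [h]
          exacts [hu k, hv k]
        · rcases hq k with h | h <;> rw [h]
          · simpa using hδ'.le
          · exact hclose k
        · exact (mul_le_mul_of_nonneg_left (hNv j) hc).trans hcM
      · have hb1 : |b (Function.update (fun _ => 1) j (u j))| ≤ e := by
          rcases lt_or_ge (u j) κ₀ with h | h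
          · have := hmod1 j (u j) (-(δ / 2)) (hu j).2 (by linarith)
              (by rw [abs_le]; constructor <;> linarith [(hu j).1])
            rwa [show b (Function.update (fun _ => 1) j (-(δ / 2))) = 0 from
              centeredCount_lowerOrthant_eq_zero_of_neg hU (j := j) (by simpa using hδ) _ _ _,
              sub_zero] at this
          · have h' : 1 - κ₀ < u j := by
              by_contra! hcon
              exact huj ⟨h, hcon⟩
            have := hmod1 j (u j) 1 (hu j).2 le_rfl
              (by rw [abs_le]; constructor <;> linarith [(hu j).2])
            rwa [Function.update_eq_self, show b (fun _ => 1) = 0 from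
              centeredCount_lowerOrthant_one hU _ _ _, sub_zero] at this
        refine abs_mul_add_le_of_abs_le (hCd j u hu) (hlip j q hq hqj) ?_ hb1
        have h1 := hvj j
        rw [abs_le] at *
        constructor <;> linarith
  have htel := abs_sub_sub_sum_le_of_update (f := fun w => N * C w) (u := u) (v := v)
    (g := fun j => -(Cd j u * b (Function.update (fun _ => 1) j (u j)))) (c := 7 * e)
    (fun j q hq hqj => by
      convert hcoord.2 j q hq hqj using 2
      ring)
  rw [Finset.sum_neg_distrib] at htel
  have hbv : b v = ∑ i ∈ Finset.Ico x y, (if ∀ k, G k (X i ω) ≤ v k then (1 : ℝ) else 0) - N * C v :=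
    centeredCount_lowerOrthant_eq v hxy ω
  have hd : (1 : ℝ) ≤ Fintype.card κ := by exact_mod_cast Fintype.card_pos
  have hd' : e ≤ Fintype.card κ * e := le_mul_of_one_le_left (by linarith) hd
  have h1 := hcoord.1
  rw [abs_le] at *
  constructor <;> linarith

end Ranks

theorem measureReal_cdf_comp_le {Ω : Type*} [MeasurableSpace Ω] {P : Measure Ω}
    [IsProbabilityMeasure P] {Z : Ω → ℝ} (hZ : Measurable Z) {F : ℝ → ℝ}
    (hF : ∀ x, F x = P.real {ω | Z ω ≤ x}) (hFc : Continuous F) {v : ℝ} (hv : v ∈ Icc (0 : ℝ) 1) :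
    P.real {ω | F (Z ω) ≤ v} = v := by
  have := Measure.isProbabilityMeasure_map (μ := P) hZ.aemeasurable
  have hFcdf : F = ProbabilityTheory.cdf (P.map Z) := by
    ext x
    rw [hF, ProbabilityTheory.cdf_eq_real, map_measureReal_apply hZ measurableSet_Iic]
    rfl
  have hmono : Monotone F := hFcdf ▸ ProbabilityTheory.monotone_cdf _
  have hsurj : ∀ w, 0 < w → w < 1 → ∃ x, F x = w := by
    intro w h0 h1
    have hbot : Tendsto F atBot (nhds 0) := hFcdf ▸ ProbabilityTheory.tendsto_cdf_atBot _
    have htop : Tendsto F atTop (nhds 1) := hFcdf ▸ ProbabilityTheory.tendsto_cdf_atTop _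
    obtain ⟨x, hx⟩ := (hbot.eventually (gt_mem_nhds h0)).exists
    obtain ⟨y, hy⟩ := (htop.eventually (lt_mem_nhds h1)).exists
    exact mem_range_of_exists_le_of_exists_ge hFc ⟨x, hx.le⟩ ⟨y, hy.le⟩
  refine le_antisymm ?_ ?_
  · by_contra! hcon
    obtain ⟨w, hvw, hw⟩ := exists_between hcon
    obtain ⟨x, rfl⟩ := hsurj w (hv.1.trans_lt hvw) (hw.trans_le measureReal_le_one)
    refine hw.not_ge ?_
    rw [hF x]
    refine measureReal_mono fun ω hω => ?_
    by_contra! hlt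
    exact (hω.trans_lt hvw).not_ge (hmono (not_le.1 hlt).le)
  · by_contra! hcon
    obtain ⟨w, hw, hwv⟩ := exists_between hcon
    obtain ⟨x, rfl⟩ := hsurj w (measureReal_nonneg.trans_lt hw) (hwv.trans_le hv.2)
    refine hw.not_ge ?_
    rw [hF x]
    exact measureReal_mono fun ω hω => (hmono hω).trans hwv.le

theorem uniformMargins_cdf {Ω κ : Type*} [MeasurableSpace Ω] {P : Measure Ω}
    [IsProbabilityMeasure P] {Y : Ω → κ → ℝ} (hY : Measurable Y) {F : κ → ℝ → ℝ}
    (hF : ∀ j x, F j x = P.real {ω | Y ω j ≤ x}) (hFc : ∀ j, Continuous (F j)) :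
    UniformMargins P Y fun j x => F j (x j) where
  meas j := (hFc j).measurable.comp (measurable_pi_apply j)
  mem_Icc j x := by
    rw [hF]
    exact ⟨measureReal_nonneg, measureReal_le_one⟩
  law j v hv := measureReal_cdf_comp_le ((measurable_pi_apply j).comp hY) (hF j) (hFc j) hv

theorem exists_rank_event {Ω κ : Type*} [MeasurableSpace Ω] {P : Measure Ω}
    [IsProbabilityMeasure P] [Fintype κ] [DecidableEq κ] [Nonempty κ] {X : ℤ → Ω → κ → ℝ}
    {G : κ → (κ → ℝ) → ℝ} {K a : ℝ} (hX : IsMixing P X K a) (ha : 1 < a)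
    (hU : UniformMargins P (X 0) G) (hG : ∀ j, ∀ z w : κ → ℝ, z j ≤ w j → G j z ≤ G j w)
    {Cd : κ → (κ → ℝ) → ℝ}
    (hder : ∀ j, ∀ u : κ → ℝ, (∀ k, u k ∈ Icc (0 : ℝ) 1) → 0 < u j → u j < 1 →
      HasDerivAt (fun t => P.real (X 0 ⁻¹' lowerOrthant G (Function.update u j t))) (Cd j u) (u j))
    (hcont : ∀ j, ContinuousOn (Cd j)
      {u : κ → ℝ | (∀ k, u k ∈ Icc (0 : ℝ) 1) ∧ 0 < u j ∧ u j < 1})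
    (hzero : ∀ j, ∀ u : κ → ℝ, (∀ k, u k ∈ Icc (0 : ℝ) 1) → u j = 0 ∨ u j = 1 → Cd j u = 0)
    {ε η : ℝ} (hε : 0 < ε) (hη : 0 < η) :
    ∀ᶠ n : ℕ in atTop, ∃ S : Set Ω, P.real S ≤ η ∧ ∀ ω ∉ S, ∀ x y : ℕ, x ≤ y → y ≤ x + n →
      y ≤ n + 1 → ∀ u : κ → ℝ, (∀ k, u k ∈ Icc (0 : ℝ) 1) →
      |∑ i ∈ Finset.Ico x y, (if ∀ j, (((Finset.Ico x y).filter
          fun t : ℕ => X t ω j ≤ X i ω j).card : ℝ) ≤ (y - x) * u j then (1 : ℝ) else 0) -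
        (y - x) * P.real (X 0 ⁻¹' lowerOrthant G u) -
        (centeredCount P X (lowerOrthant G u) x y ω - ∑ j, Cd j u *
          centeredCount P X (lowerOrthant G (Function.update (fun _ => 1) j (u j))) x y ω)| ≤
        ε * √n := by
  have hd : (0 : ℝ) < Fintype.card κ := by exact_mod_cast Fintype.card_pos
  have hCd : ∀ j u, (∀ k, u k ∈ Icc (0 : ℝ) 1) → |Cd j u| ≤ 1 := by
    intro j u hu
    rcases (hu j).1.eq_or_lt with h0 | h0
    · simp [hzero j u hu (Or.inl h0.symm)]
    rcases (hu j).2.eq_or_lt with h1 | h1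
    · simp [hzero j u hu (Or.inr h1)]
    · exact abs_hasDerivAt_le_one_of_update
        (C := fun w => P.real (X 0 ⁻¹' lowerOrthant G w)) (hder j u hu h0 h1) h0 h1
        fun t ht => hU.abs_measureReal_lowerOrthant_update_sub_le (hX.meas 0) j (hu j) ht
  set ε' : ℝ := ε / (11 * Fintype.card κ) with hε'
  have hε'0 : 0 < ε' := by positivity
  obtain ⟨δ, hδ, hmod⟩ := exists_modulus_event hX ha hU hε'0 (half_pos hη)
  obtain ⟨M, hM, hbound⟩ := exists_bound_event hX ha hU (half_pos hη)
  set c : ℝ := ε' / (M + 4 * ε') with hc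
  have hc0 : 0 < c := by positivity
  choose δj hδj hexp using fun j => exists_uniform_expansion
    (C := fun w => P.real (X 0 ⁻¹' lowerOrthant G w)) (hder j) (hcont j) (half_pos hδ) hc0
  obtain ⟨j₀, hj₀⟩ := Finite.exists_min δj
  set δ' := min δ (δj j₀) with hδ'
  have hδ'0 : 0 < δ' := lt_min hδ (hδj _)
  have hsqrt : Tendsto (fun n : ℕ => √(n : ℝ)) atTop atTop :=
    Real.tendsto_sqrt_atTop.comp tendsto_natCast_atTop_atTop
  filter_upwards [hmod, hbound, hsqrt.eventually_ge_atTop (1 / ε'),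
    hsqrt.eventually_ge_atTop ((M + 4 * ε') / (δ * δ'))] with n ⟨S, hS, hS'⟩ ⟨T, hT, hT'⟩ hn1 hn2
  refine ⟨S ∪ T, (measureReal_union_le _ _).trans (by linarith), fun ω hω x y hxy hyn hyn' u hu => ?_⟩
  rw [mem_union, not_or] at hω
  have hS'' := hS' ω hω.1 x y hxy hyn'
  rw [div_le_iff₀ (by positivity)] at hn1 hn2
  have hnn : √(n : ℝ) * √n = n := Real.mul_self_sqrt (Nat.cast_nonneg n)
  refine (hU.abs_sum_rank_sub_le (hX.meas 0) hG hCd hδ hδ'0 (min_le_left _ _) (κ₀ := δ / 2)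
    (by linarith) (half_pos hδ) (c := c) (e := ε' * √n) (fun j u q hu hq huj hqj hqu t ht =>
      hexp j u q hu hq huj hqj (fun k => (hqu k).trans ((min_le_right _ _).trans (hj₀ j))) t
        (ht.trans ((min_le_right _ _).trans (hj₀ j)))) hxy hyn (by linarith)
    (fun h u hu => (hS'' u hu).1 h) (fun u v hu hv huv => (hS'' u hu).2 v hv huv)
    (hT' ω hω.2 x y hxy hyn hyn') ?_ ?_ hc0.le hu).trans (le_of_eq ?_)
  · have h := mul_le_mul_of_nonneg_right hn2 (Real.sqrt_nonneg n)
    rw [mul_right_comm, hnn] at h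
    linarith
  · rw [hc]
    refine le_of_eq ?_
    field_simp
  · rw [hε']
    field_simp

section SequentialCopula

variable {d : ℕ} {X : ℤ → Ω → Fin d → ℝ} {F : Fin d → ℝ → ℝ} {C : (Fin d → ℝ) → ℝ} {n : ℕ}
  {s t : ℝ}

theorem seqEmpProc_eq_centeredCount [MeasurableSpace Ω] {P : Measure Ω} {u : Fin d → ℝ}
    (hC : C u = P.real (X 0 ⁻¹' lowerOrthant (fun j x => F j (x j)) u)) (ω : Ω) :
    seqEmpProc d X F C n s t u ω = (√n)⁻¹ * centeredCount P X
      (lowerOrthant (fun j x => F j (x j)) u) (⌊(n : ℝ) * s⌋₊ + 1) (⌊(n : ℝ) * t⌋₊ + 1) ω := by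
  rw [seqEmpProc, centeredCount, Finset.Ico_add_one_right_eq_Icc, hC]
  simp only [indicator_apply, lowerOrthant, mem_ofPred_eq]

theorem pseudoObs_le_iff {k l i : ℕ} (hkl : k ≤ l) {ω : Ω} {j : Fin d} {v : ℝ} :
    pseudoObs d X k l i ω j ≤ v ↔
      (((Finset.Icc k l).filter fun t : ℕ => X t ω j ≤ X i ω j).card : ℝ) ≤ (l - k + 1) * v := by
  have : (k : ℝ) ≤ l := by exact_mod_cast hkl
  rw [pseudoObs, div_le_iff₀ (by linarith), mul_comm]

theorem seqEmpCopProc_eq (hn : 0 < n) (hst : ⌊(n : ℝ) * s⌋₊ ≤ ⌊(n : ℝ) * t⌋₊) (u : Fin d → ℝ)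
    (ω : Ω) :
    seqEmpCopProc d X C n s t u ω = (√n)⁻¹ *
      (∑ i ∈ Finset.Ico (⌊(n : ℝ) * s⌋₊ + 1) (⌊(n : ℝ) * t⌋₊ + 1),
        (if ∀ j, (((Finset.Ico (⌊(n : ℝ) * s⌋₊ + 1) (⌊(n : ℝ) * t⌋₊ + 1)).filter
          fun r : ℕ => X r ω j ≤ X i ω j).card : ℝ) ≤
            (((⌊(n : ℝ) * t⌋₊ + 1 : ℕ) : ℝ) - (⌊(n : ℝ) * s⌋₊ + 1 : ℕ)) * u j
          then (1 : ℝ) else 0) -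
        (((⌊(n : ℝ) * t⌋₊ + 1 : ℕ) : ℝ) - (⌊(n : ℝ) * s⌋₊ + 1 : ℕ)) * C u) := by
  have hn' : (0 : ℝ) < n := by exact_mod_cast hn
  rw [seqEmpCopProc, empCop]
  generalize ⌊(n : ℝ) * s⌋₊ = x at *
  generalize ⌊(n : ℝ) * t⌋₊ = y at *
  rcases hst.eq_or_lt with rfl | hlt
  · simp
  · have hxy : (x : ℝ) < y := by exact_mod_cast hlt
    have hxy' : (y : ℝ) - x ≠ 0 := by linarith
    rw [if_pos (by omega), Finset.Ico_add_one_right_eq_Icc]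
    simp only [pseudoObs_le_iff (show x + 1 ≤ y by omega)]
    push_cast
    rw [show (y : ℝ) - (x + 1) + 1 = y - x by ring, show (y : ℝ) + 1 - (x + 1) = y - x by ring,
      ← Real.sqrt_div_self]
    field_simp


theorem abs_seqEmpCopProc_sub_approx_eq [MeasurableSpace Ω] {P : Measure Ω}
    (hC : ∀ u, C u = P.real (X 0 ⁻¹' lowerOrthant (fun j x => F j (x j)) u))
    (Cd : Fin d → (Fin d → ℝ) → ℝ) (hn : 0 < n) (hst : ⌊(n : ℝ) * s⌋₊ ≤ ⌊(n : ℝ) * t⌋₊)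
    (u : Fin d → ℝ) (ω : Ω) :
    |seqEmpCopProc d X C n s t u ω - seqEmpCopProcApprox d X F C Cd n s t u ω| = (√n)⁻¹ *
      |∑ i ∈ Finset.Ico (⌊(n : ℝ) * s⌋₊ + 1) (⌊(n : ℝ) * t⌋₊ + 1),
        (if ∀ j, (((Finset.Ico (⌊(n : ℝ) * s⌋₊ + 1) (⌊(n : ℝ) * t⌋₊ + 1)).filter
          fun r : ℕ => X r ω j ≤ X i ω j).card : ℝ) ≤
            (((⌊(n : ℝ) * t⌋₊ + 1 : ℕ) : ℝ) - (⌊(n : ℝ) * s⌋₊ + 1 : ℕ)) * u j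
          then (1 : ℝ) else 0) -
        (((⌊(n : ℝ) * t⌋₊ + 1 : ℕ) : ℝ) - (⌊(n : ℝ) * s⌋₊ + 1 : ℕ)) *
          P.real (X 0 ⁻¹' lowerOrthant (fun j x => F j (x j)) u) -
        (centeredCount P X (lowerOrthant (fun j x => F j (x j)) u)
            (⌊(n : ℝ) * s⌋₊ + 1) (⌊(n : ℝ) * t⌋₊ + 1) ω -
          ∑ j, Cd j u * centeredCount P X
            (lowerOrthant (fun j x => F j (x j)) (Function.update (fun _ => 1) j (u j)))
            (⌊(n : ℝ) * s⌋₊ + 1) (⌊(n : ℝ) * t⌋₊ + 1) ω)| := by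
  rw [seqEmpCopProc_eq hn hst, seqEmpCopProcApprox, seqEmpProc_eq_centeredCount (hC u)]
  simp only [seqEmpProc_eq_centeredCount (hC _), coordVec, mul_left_comm _ (√(n : ℝ))⁻¹]
  rw [← Finset.mul_sum, ← mul_sub, ← mul_sub, abs_mul, abs_of_nonneg (by positivity), hC]

end SequentialCopula

/-- Proposition 1: for a strictly stationary, strongly mixing sequence
with `α_r = O(r^{-a})`, `a > 1`, continuous margins, and a copula satisfying
Condition 2, `sup_{(s,t,u)∈Δ×[0,1]^d} |C̄_n(s,t,u) − C̃_n(s,t,u)|` converges to `0` in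
outer probability. -/
theorem seqEmpCopProc_approx {Ω : Type*} [MeasurableSpace Ω]
    (P : Measure Ω) [IsProbabilityMeasure P]
    (d : ℕ) (hd : 1 ≤ d)
    (X : ℤ → Ω → Fin d → ℝ) (hX : ∀ i, Measurable (X i))
    -- strict stationarity
    (hstat : ∀ k : ℤ,
      Measure.map (fun ω => fun i : ℤ => X (i + k) ω) P
        = Measure.map (fun ω => fun i : ℤ => X i ω) P)
    -- marginal c.d.f.s, assumed continuous
    (F : Fin d → ℝ → ℝ)
    (hF : ∀ j x, F j x = (P {ω | X 0 ω j ≤ x}).toReal)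
    (hFcont : ∀ j, Continuous (F j))
    -- strong mixing coefficients α_r = O(r^{-a}) for some a > 1
    (a : ℝ) (ha : 1 < a)
    (hmix : ∃ K : ℝ, ∀ r : ℕ, 1 ≤ r → ∀ p : ℤ, ∀ A B : Set Ω,
      MeasurableSet[⨆ i : {i : ℤ // i ≤ p},
        MeasurableSpace.comap (X i.1) (inferInstance : MeasurableSpace (Fin d → ℝ))] A →
      MeasurableSet[⨆ i : {i : ℤ // p + r ≤ i},
        MeasurableSpace.comap (X i.1) (inferInstance : MeasurableSpace (Fin d → ℝ))] B →
      |(P (A ∩ B)).toReal - (P A).toReal * (P B).toReal| ≤ K * (r : ℝ) ^ (-a))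
    -- the copula of X_0
    (C : (Fin d → ℝ) → ℝ)
    (hC : ∀ u : Fin d → ℝ, C u = (P {ω | ∀ j, F j (X 0 ω j) ≤ u j}).toReal)
    -- Condition 2, with Ċ_j extended by 0 to the boundary
    (Cdot : Fin d → (Fin d → ℝ) → ℝ)
    (hCdot_deriv : ∀ (j : Fin d) (u : Fin d → ℝ), (∀ k, u k ∈ Icc (0:ℝ) 1) →
      0 < u j → u j < 1 →
      HasDerivAt (fun t => C (Function.update u j t)) (Cdot j u) (u j))
    (hCdot_cont : ∀ j : Fin d, ContinuousOn (Cdot j)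
      {u : Fin d → ℝ | (∀ k, u k ∈ Icc (0:ℝ) 1) ∧ 0 < u j ∧ u j < 1})
    (hCdot_zero : ∀ (j : Fin d) (u : Fin d → ℝ), (∀ k, u k ∈ Icc (0:ℝ) 1) →
      u j = 0 ∨ u j = 1 → Cdot j u = 0) :
    -- conclusion: convergence to 0 in outer probability of the uniform distance
    ∀ ε : ℝ, 0 < ε →
      Tendsto (fun n : ℕ =>
          P {ω | ε < ⨆ q : {q : ℝ × ℝ × (Fin d → ℝ) //
                0 ≤ q.1 ∧ q.1 ≤ q.2.1 ∧ q.2.1 ≤ 1 ∧ ∀ j, q.2.2 j ∈ Icc (0:ℝ) 1},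
              |seqEmpCopProc d X C n q.1.1 q.1.2.1 q.1.2.2 ω
                - seqEmpCopProcApprox d X F C Cdot n q.1.1 q.1.2.1 q.1.2.2 ω|})
        atTop (nhds 0) := by
  have hP : ∀ A, (P A).toReal = P.real A := fun _ => rfl
  simp only [hP] at hF hmix hC
  obtain ⟨K, hK⟩ := hmix
  have : Nonempty (Fin d) := ⟨⟨0, hd⟩⟩
  have hlaw : ∀ i A, MeasurableSet A → P.real (X i ⁻¹' A) = P.real (X 0 ⁻¹' A) := by
    intro i A hA
    have hY : ∀ k : ℤ, Measurable fun ω => fun m : ℤ => X (m + k) ω := fun k =>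
      measurable_pi_lambda _ fun m => hX _
    have hA' : MeasurableSet ((fun f : ℤ → Fin d → ℝ => f 0) ⁻¹' A) := measurable_pi_apply 0 hA
    have h := congrArg (fun μ => μ.real ((fun f : ℤ → Fin d → ℝ => f 0) ⁻¹' A)) (hstat i)
    simp only [map_measureReal_apply (hY i) hA',
      map_measureReal_apply (measurable_pi_lambda _ fun m => hX m) hA', ← preimage_comp] at h
    simpa [Function.comp_def] using h
  have hXm : IsMixing P X K a := ⟨hX, hlaw, hK⟩
  have hU := uniformMargins_cdf (hX 0) hF hFcont
  have hmono : ∀ j, ∀ z w : Fin d → ℝ, z j ≤ w j → F j (z j) ≤ F j (w j) := by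
    intro j z w h
    rw [hF, hF]
    exact measureReal_mono fun ω hω => le_trans hω h
  have hC' : ∀ u, C u = P.real (X 0 ⁻¹' lowerOrthant (fun j x => F j (x j)) u) := hC
  intro ε hε
  rw [ENNReal.tendsto_nhds_zero]
  intro η hη
  rcases eq_or_ne η ⊤ with rfl | hη'
  · simp
  have hevent := exists_rank_event hXm ha hU hmono (Cd := Cdot)
    (fun j u hu h0 h1 => by simpa only [hC'] using hCdot_deriv j u hu h0 h1) hCdot_cont hCdot_zero
    hε (ENNReal.toReal_pos hη.ne' hη')
  filter_upwards [hevent, eventually_gt_atTop 0] with n ⟨S, hS, hS'⟩ hn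
  refine (measure_mono (t := S) fun ω hω => ?_).trans
    ((ENNReal.ofReal_toReal (measure_ne_top P S)).symm.trans_le (ENNReal.ofReal_le_of_le_toReal hS))
  by_contra hωS
  refine (not_lt.2 (Real.iSup_le (fun q => ?_) hε.le)) hω
  obtain ⟨⟨s, t, u⟩, hs, hst, ht, hu⟩ := q
  have hn' : (0 : ℝ) < n := by exact_mod_cast hn
  have hfl : ⌊(n : ℝ) * s⌋₊ ≤ ⌊(n : ℝ) * t⌋₊ :=
    Nat.floor_mono (mul_le_mul_of_nonneg_left hst hn'.le)
  have hfn : ⌊(n : ℝ) * t⌋₊ ≤ n := Nat.floor_le_of_le (mul_le_of_le_one_right hn'.le ht)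
  rw [abs_seqEmpCopProc_sub_approx_eq hC' Cdot hn hfl,
    inv_mul_le_iff₀ (Real.sqrt_pos.2 hn'), mul_comm _ ε]
  refine le_of_eq_of_le ?_ (hS' ω hωS (⌊(n : ℝ) * s⌋₊ + 1) (⌊(n : ℝ) * t⌋₊ + 1) (by omega)
    (by omega) (by omega) u hu)
  congr!
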